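/- arXiv:2007.08683 — 6 statements merged into one kernel-verified Lean document; each statement's English description precedes it below -/
import Mathlib

section
/- Define the two-variable integer polynomials F_m by F₀ = 1, F₁ = Y − X, and F_{m+2} = (Y − 2X)·F_{m+1} − X²·F_m for m ≥ 0. Let A, B be integers and let (u_m) be the sequence defined by u₀ = 1, u₁ = A, and u_{m+2} = A·u_{m+1} − B·u_m. Then u_{2m} = F_m(B, A²) for all m ≥ 0. In particular, if the coefficients of a weight 2k newform satisfy a_f(p^{2m}) = ±c for a prime p, then (p^{2k−1}, a_f(p)²) is an integer solution of the Thue equation F_m(X, Y) = ±c. -/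
/-- The degree-`m` Thue forms of the paper (there denoted `F_{2m}(X,Y)`), defined over any
commutative ring by `F₀ = 1`, `F₁ = Y − X`, `F_{m+2} = (Y − 2X)·F_{m+1} − X²·F_m`. -/
def ThueF {R : Type*} [CommRing R] (X Y : R) : ℕ → R
  | 0 => 1
  | 1 => Y - X
  | (m + 2) => (Y - 2 * X) * ThueF X Y (m + 1) - X ^ 2 * ThueF X Y m

/-- Every second term of a sequence satisfying `u_{n+2} = A·u_{n+1} − B·u_n` again satisfies a
linear recurrence of order two. -/
theorem lucas_rec_step_two {R : Type*} [CommRing R] {A B : R} {u : ℕ → R}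
    (hurec : ∀ m : ℕ, u (m + 2) = A * u (m + 1) - B * u m) (n : ℕ) :
    u (n + 4) = (A ^ 2 - 2 * B) * u (n + 2) - B ^ 2 * u n := by
  linear_combination hurec (n + 2) + A * hurec (n + 1) + B * hurec n

theorem lucas_even_index_eq_ThueF (A B : ℤ) (u : ℕ → ℤ)
    (hu0 : u 0 = 1) (hu1 : u 1 = A)
    (hurec : ∀ m : ℕ, u (m + 2) = A * u (m + 1) - B * u m) :
    ∀ m : ℕ, u (2 * m) = ThueF B (A ^ 2) m := by
  intro m
  induction m using Nat.twoStepInduction with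
  | zero => simp [ThueF, hu0]
  | one =>
    have h := hurec 0
    simp only [zero_add, hu0, hu1] at h
    simp only [mul_one, ThueF, h]
    ring
  | more m ih0 ih1 =>
    rw [ThueF, ← ih0, ← ih1]
    exact lucas_rec_step_two hurec (2 * m)
end

section
/- Define the polynomials F_m by F₀ = 1, F₁ = Y − X, and F_{m+2} = (Y − 2X)·F_{m+1} − X²·F_m for m ≥ 0. Then for every m ≥ 1 and all real numbers X, Y, one has F_m(X, Y) = ∏_{k=1}^{m} (Y − 4X·cos²(πk/(2m+1))). -/
open Polynomial in
theorem ThueF_C_X_monic_natDegree {R : Type*} [CommRing R] [Nontrivial R] (a : R) (m : ℕ) :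
    (ThueF (C a) (X : R[X]) m).Monic ∧ (ThueF (C a) (X : R[X]) m).natDegree = m := by
  induction m using Nat.twoStepInduction with
  | zero => simp [ThueF]
  | one => simp [ThueF, monic_X_sub_C]
  | more m ih₀ ih₁ =>
    have hrec : ThueF (C a) (X : R[X]) (m + 2) =
        (X - C (2 * a)) * ThueF (C a) X (m + 1) - C (a ^ 2) * ThueF (C a) X m := by
      simp [ThueF, map_ofNat C 2]
    have hmonic : ((X - C (2 * a)) * ThueF (C a) (X : R[X]) (m + 1)).Monic :=
      (monic_X_sub_C _).mul ih₁.1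
    have hnat : ((X - C (2 * a)) * ThueF (C a) (X : R[X]) (m + 1)).natDegree = m + 2 := by
      rw [(monic_X_sub_C _).natDegree_mul ih₁.1, natDegree_X_sub_C, ih₁.2]
      ring
    have hlt : (C (a ^ 2) * ThueF (C a) (X : R[X]) m).natDegree <
        ((X - C (2 * a)) * ThueF (C a) (X : R[X]) (m + 1)).natDegree := by
      rw [hnat]
      have := natDegree_C_mul_le (a ^ 2) (ThueF (C a) (X : R[X]) m)
      have := ih₀.2
      omega
    rw [hrec]
    exact ⟨hmonic.sub_of_left (degree_lt_degree hlt),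
      (natDegree_sub_eq_left_of_natDegree_lt hlt).trans hnat⟩

open Polynomial in
theorem eval_ThueF_C_X {R : Type*} [CommRing R] (a y : R) (m : ℕ) :
    (ThueF (C a) (X : R[X]) m).eval y = ThueF a y m := by
  induction m using Nat.twoStepInduction with
  | zero => simp [ThueF]
  | one => simp [ThueF]
  | more m ih₀ ih₁ => simp [ThueF, ih₀, ih₁]

theorem ThueF_zero_left {R : Type*} [CommRing R] (y : R) (m : ℕ) : ThueF 0 y m = y ^ m := by
  induction m using Nat.twoStepInduction with
  | zero => simp [ThueF]
  | one => simp [ThueF]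
  | more m ih₀ ih₁ => simp [ThueF, ih₁]; ring

theorem ThueF_four_mul_cos_sq_mul_sin (x θ : ℝ) (m : ℕ) :
    ThueF x (4 * x * Real.cos θ ^ 2) m * Real.sin θ = x ^ m * Real.sin ((2 * m + 1) * θ) := by
  induction m using Nat.twoStepInduction with
  | zero => simp [ThueF]
  | one =>
    have h : Real.sin ((2 * (1 : ℕ) + 1) * θ) = Real.sin (3 * θ) := by norm_num
    rw [h, Real.sin_three_mul]
    simp only [ThueF]
    linear_combination 4 * x * Real.sin θ * Real.sin_sq_add_cos_sq θ
  | more m ih₀ ih₁ =>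
    have h₂ : (2 * ((m + 2 : ℕ) : ℝ) + 1) * θ = (2 * ((m + 1 : ℕ) : ℝ) + 1) * θ + 2 * θ := by
      push_cast; ring
    have h₀ : (2 * (m : ℝ) + 1) * θ = (2 * ((m + 1 : ℕ) : ℝ) + 1) * θ - 2 * θ := by
      push_cast; ring
    rw [h₀, Real.sin_sub, Real.cos_two_mul] at ih₀
    rw [h₂, Real.sin_add, Real.cos_two_mul]
    simp only [ThueF]
    linear_combination (4 * x * Real.cos θ ^ 2 - 2 * x) * ih₁ - x ^ 2 * ih₀

theorem ThueF_product_formula (m : ℕ) (hm : 1 ≤ m) (X Y : ℝ) :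
    ThueF X Y m =
      ∏ k ∈ Finset.Icc 1 m,
        (Y - 4 * X * Real.cos (Real.pi * k / (2 * m + 1)) ^ 2) := by
  rcases eq_or_ne X 0 with rfl | hX
  · simp [ThueF_zero_left]
  set θ : ℕ → ℝ := fun k => Real.pi * k / (2 * m + 1) with hθ
  have hden : (0 : ℝ) < 2 * m + 1 := by positivity
  have hθ_mem : ∀ k ∈ Finset.Icc 1 m, 0 < θ k ∧ θ k < Real.pi / 2 := by
    intro k hk
    obtain ⟨hk1, hkm⟩ := Finset.mem_Icc.1 hk
    have hk1' : (1 : ℝ) ≤ k := by exact_mod_cast hk1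
    have hkm' : (k : ℝ) ≤ m := by exact_mod_cast hkm
    refine ⟨by have := Real.pi_pos; positivity, ?_⟩
    rw [hθ, div_lt_div_iff₀ hden two_pos]
    nlinarith [Real.pi_pos]
  let v : ℕ → ℝ := fun k => 4 * X * Real.cos (θ k) ^ 2
  have hv_inj : Set.InjOn v (Finset.Icc 1 m : Finset ℕ) := by
    intro i hi j hj hij
    obtain ⟨hi0, hi1⟩ := hθ_mem i hi
    obtain ⟨hj0, hj1⟩ := hθ_mem j hj
    have hsq : Real.cos (θ i) ^ 2 = Real.cos (θ j) ^ 2 :=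
      mul_left_cancel₀ (mul_ne_zero four_ne_zero hX) hij
    have hcos : Real.cos (θ i) = Real.cos (θ j) :=
      (sq_eq_sq₀ (Real.cos_nonneg_of_mem_Icc ⟨by linarith, hi1.le⟩)
        (Real.cos_nonneg_of_mem_Icc ⟨by linarith, hj1.le⟩)).1 hsq
    have hθij : θ i = θ j :=
      Real.injOn_cos ⟨hi0.le, by linarith⟩ ⟨hj0.le, by linarith⟩ hcos
    have := Real.pi_ne_zero
    simpa [hθ, div_left_inj' hden.ne', this] using hθij
  have hv_root : ∀ k ∈ Finset.Icc 1 m, ThueF X (v k) m = 0 := by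
    intro k hk
    obtain ⟨hk0, hk1⟩ := hθ_mem k hk
    have hsin : Real.sin (θ k) ≠ 0 :=
      (Real.sin_pos_of_pos_of_lt_pi hk0 (by linarith)).ne'
    have hmul : (2 * m + 1) * θ k = k * Real.pi := by
      simp only [hθ]; field_simp
    have h := ThueF_four_mul_cos_sq_mul_sin X (θ k) m
    rw [hmul, Real.sin_nat_mul_pi, mul_zero] at h
    exact (mul_eq_zero.1 h).resolve_right hsin
  obtain ⟨hmonic, hnat⟩ := ThueF_C_X_monic_natDegree X m
  have hdeg : (ThueF (Polynomial.C X) (Polynomial.X : Polynomial ℝ) m).degree = m := by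
    rw [Polynomial.degree_eq_natDegree hmonic.ne_zero, hnat]
  have hnodal : ThueF (Polynomial.C X) Polynomial.X m = Lagrange.nodal (Finset.Icc 1 m) v := by
    refine Polynomial.eq_of_degree_sub_lt_of_eval_index_eq _ hv_inj ?_ fun k hk => ?_
    · have hlt := Polynomial.degree_sub_lt_left (q := Lagrange.nodal (Finset.Icc 1 m) v)
        (by rw [hdeg, Lagrange.degree_nodal]; simp) hmonic.ne_zero
        (by rw [hmonic.leadingCoeff, Lagrange.nodal_monic.leadingCoeff])
      simpa [hdeg] using hlt
    · rw [eval_ThueF_C_X, hv_root k hk, Lagrange.eval_nodal_at_node hk]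
  rw [← eval_ThueF_C_X, hnodal, Lagrange.eval_nodal]
end

section
/- Define the polynomials F_m by F₀ = 1, F₁ = Y − X, and F_{m+2} = (Y − 2X)·F_{m+1} − X²·F_m for m ≥ 0. For every m ≥ 1 and all real numbers X, Y, one has ∏_{k=1}^{m} (Y − 2X·cos(2πk/(2m+1))) = F_m(X, Y + 2X); equivalently, with ℓ = 2m+1, the Thue form F_{ℓ−1}(X,Y) of the paper equals F̂_ℓ(X, Y − 2X), where F̂_ℓ(X,Y) = ∏_{k=1}^{(ℓ−1)/2} (Y − 2X·cos(2πk/ℓ)). -/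
namespace ThueF

open Polynomial

theorem map {R S : Type*} [CommRing R] [CommRing S] (f : R →+* S) (x y : R) (m : ℕ) :
    f (ThueF x y m) = ThueF (f x) (f y) m := by
  induction m using Nat.twoStepInduction with
  | zero => simp [ThueF]
  | one => simp [ThueF]
  | more m ih₀ ih₁ => simp [ThueF, ih₀, ih₁, map_ofNat f 2]

theorem mul_mul {R : Type*} [CommRing R] (c x y : R) (m : ℕ) :
    ThueF (c * x) (c * y) m = c ^ m * ThueF x y m := by
  induction m using Nat.twoStepInduction with
  | zero => simp [ThueF]
  | one => simp [ThueF, mul_sub]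
  | more m ih₀ ih₁ =>
    simp only [ThueF, ih₀, ih₁]
    ring

theorem zero_left {R : Type*} [CommRing R] (y : R) (m : ℕ) : ThueF 0 y m = y ^ m := by
  induction m using Nat.twoStepInduction with
  | zero => simp [ThueF]
  | one => simp [ThueF]
  | more m ih₀ ih₁ =>
    simp only [ThueF, ih₁]
    ring

theorem monic_and_natDegree {R : Type*} [CommRing R] [Nontrivial R] (m : ℕ) :
    (ThueF (1 : R[X]) (X + 2) m).Monic ∧ (ThueF (1 : R[X]) (X + 2) m).natDegree = m := by
  induction m using Nat.twoStepInduction with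
  | zero => simp [ThueF]
  | one =>
    have h : (X + 2 - 1 : R[X]) = X + C 1 := by
      rw [C_1]
      ring
    simp only [ThueF, h]
    exact ⟨monic_X_add_C 1, natDegree_X_add_C 1⟩
  | more m ih₀ ih₁ =>
    have h : ThueF (1 : R[X]) (X + 2) (m + 2) =
        X * ThueF 1 (X + 2) (m + 1) - ThueF 1 (X + 2) m := by
      simp only [ThueF]
      ring
    have hmon := monic_X.mul ih₁.1
    have hdeg : (X * ThueF (1 : R[X]) (X + 2) (m + 1)).natDegree = m + 2 := by
      rw [monic_X.natDegree_mul ih₁.1, ih₁.2, natDegree_X]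
      ring
    have hlt : (ThueF (1 : R[X]) (X + 2) m).natDegree <
        (X * ThueF (1 : R[X]) (X + 2) (m + 1)).natDegree := by
      rw [hdeg, ih₀.2]
      lia
    rw [h]
    exact ⟨hmon.sub_of_left (degree_lt_degree hlt),
      (natDegree_sub_eq_left_of_natDegree_lt hlt).trans hdeg⟩

theorem sin_mul_eq_sin (θ : ℝ) (m : ℕ) :
    Real.sin θ * ThueF 1 (2 * Real.cos (2 * θ) + 2) m = Real.sin ((2 * m + 1) * θ) := by
  induction m using Nat.twoStepInduction with
  | zero => simp [ThueF]
  | one =>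
    have h : (2 * ((1 : ℕ) : ℝ) + 1) * θ = 3 * θ := by
      push_cast
      ring
    rw [h, Real.sin_three_mul, Real.cos_two_mul]
    simp only [ThueF]
    linear_combination 4 * Real.sin θ * Real.sin_sq_add_cos_sq θ
  | more m ih₀ ih₁ =>
    have h₂ : (2 * ((m + 2 : ℕ) : ℝ) + 1) * θ = (2 * ((m + 1 : ℕ) : ℝ) + 1) * θ + 2 * θ := by
      push_cast
      ring
    have h₀ : (2 * (m : ℝ) + 1) * θ = (2 * ((m + 1 : ℕ) : ℝ) + 1) * θ - 2 * θ := by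
      push_cast
      ring
    rw [h₀, Real.sin_sub] at ih₀
    rw [h₂, Real.sin_add]
    simp only [ThueF]
    linear_combination 2 * Real.cos (2 * θ) * ih₁ - ih₀

theorem eq_prod_X_sub_C (m : ℕ) :
    ThueF (1 : ℝ[X]) (X + 2) m =
      ∏ k ∈ Finset.Icc 1 m, (X - C (2 * Real.cos (2 * Real.pi * k / (2 * m + 1)))) := by
  have hm : (0 : ℝ) < 2 * m + 1 := by positivity
  have hangle {k : ℕ} (hk : k ∈ Finset.Icc 1 m) :
      0 < 2 * Real.pi * k / (2 * m + 1) ∧ 2 * Real.pi * k / (2 * m + 1) < Real.pi := by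
    obtain ⟨h₁, h₂⟩ := Finset.mem_Icc.mp hk
    have h₁' : (0 : ℝ) < k := by exact_mod_cast h₁
    have h₂' : (k : ℝ) ≤ m := by exact_mod_cast h₂
    refine ⟨by positivity, ?_⟩
    rw [div_lt_iff₀ hm]
    nlinarith [Real.pi_pos]
  have hdvd : (∏ k ∈ Finset.Icc 1 m, (X - C (2 * Real.cos (2 * Real.pi * k / (2 * m + 1))))) ∣
      ThueF (1 : ℝ[X]) (X + 2) m := by
    refine Finset.prod_dvd_of_coprime (fun i hi j hj hij => ?_) fun k hk => ?_
    · refine isCoprime_X_sub_C_of_isUnit_sub (sub_ne_zero.mpr fun h => hij ?_).isUnit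
      have h' := Real.injOn_cos ⟨(hangle hi).1.le, (hangle hi).2.le⟩
        ⟨(hangle hj).1.le, (hangle hj).2.le⟩ (mul_left_cancel₀ two_ne_zero h)
      have h'' := mul_left_cancel₀ (by positivity) ((div_left_inj' hm.ne').mp h')
      exact_mod_cast h''
    · obtain ⟨h₁, h₂⟩ := hangle hk
      rw [dvd_iff_isRoot, IsRoot.def, ← coe_evalRingHom, map]
      have h := sin_mul_eq_sin (2 * Real.pi * k / (2 * m + 1) / 2) m
      rw [mul_div_cancel₀ _ two_ne_zero,
        show (2 * (m : ℝ) + 1) * (2 * Real.pi * k / (2 * m + 1) / 2) = k * Real.pi by field_simp,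
        Real.sin_nat_mul_pi] at h
      have hsin : Real.sin (2 * Real.pi * k / (2 * m + 1) / 2) ≠ 0 :=
        (Real.sin_pos_of_pos_of_lt_pi (by linarith) (by linarith)).ne'
      simpa using (mul_eq_zero.mp h).resolve_left hsin
  refine eq_of_monic_of_dvd_of_natDegree_le (monic_prod_X_sub_C _ _)
    (monic_and_natDegree m).1 hdvd ?_
  rw [(monic_and_natDegree m).2, natDegree_finsetProd_X_sub_C_eq_card]
  simp

end ThueF

/-- The product `F̂_ℓ(X,Y)` with `ℓ = 2m+1` equals the Thue form `F_m` shifted by `2X` in the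
second variable: `∏_{k=1}^{m} (Y − 2X·cos(2πk/(2m+1))) = F_m(X, Y + 2X)`. -/
theorem ThueF_eq_Fhat_shift (m : ℕ) (hm : 1 ≤ m) (X Y : ℝ) :
    ∏ k ∈ Finset.Icc 1 m, (Y - 2 * X * Real.cos (2 * Real.pi * k / (2 * m + 1))) =
      ThueF X (Y + 2 * X) m := by
  rcases eq_or_ne X 0 with rfl | hX
  · simp [ThueF.zero_left]
  · have h := congrArg (Polynomial.evalRingHom (Y / X)) (ThueF.eq_prod_X_sub_C m)
    rw [ThueF.map, map_prod] at h
    simp only [map_one, map_add, map_ofNat, map_sub, Polynomial.coe_evalRingHom,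
      Polynomial.eval_X, Polynomial.eval_C] at h
    have hscale := ThueF.mul_mul X 1 (Y / X + 2) m
    rw [mul_one, mul_add, mul_div_cancel₀ _ hX, mul_comm X 2, h] at hscale
    have hpow : X ^ m = ∏ _k ∈ Finset.Icc 1 m, X := by simp
    rw [hscale, hpow, ← Finset.prod_mul_distrib]
    refine Finset.prod_congr rfl fun k _ => ?_
    field_simp
end

section
/- Define the polynomials F_m by F₀ = 1, F₁ = Y − X, and F_{m+2} = (Y − 2X)·F_{m+1} − X²·F_m for m ≥ 0. Then none of the following equations has a solution in integers X, Y: (a) Y² = 5X^42 − 524; (b) F₃(X, Y) = 617 and F₃(X, Y) = −617; (c) F₃(X, Y) = 657931 and F₃(X, Y) = −657931; (d) F₅(X, Y) = 617 and F₅(X, Y) = −617; (e) F₆(X, Y) = 657931; (f) Y² = X^25 − 657931. -/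
/-- Residues modulo `1891 = 31 * 61` of the pairs `(Y, u)` with `Y² = 5u² - 524`. -/
def pellResidues : List (ℕ × ℕ) :=
  [(9, 11), (14, 12), (41, 21), (51, 25), (78, 1706), (114, 52),
   (139, 63), (169, 415), (175, 924), (192, 133), (264, 528), (301, 135),
   (325, 1241), (366, 164), (366, 629), (600, 707), (606, 74), (620, 1123),
   (620, 1805), (630, 1199), (715, 181), (724, 1699), (746, 1452), (784, 538),
   (785, 1168), (789, 353), (797, 414), (901, 1049), (924, 660), (932, 429),
   (959, 429), (967, 660), (990, 1049), (1094, 414), (1102, 353), (1106, 1168),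
   (1107, 538), (1145, 1452), (1167, 1699), (1176, 181), (1261, 1199), (1271, 1123),
   (1271, 1805), (1285, 74), (1291, 707), (1525, 164), (1525, 629), (1566, 1241),
   (1590, 135), (1627, 528), (1699, 133), (1716, 924), (1722, 415), (1752, 63),
   (1777, 52), (1813, 1706), (1840, 25), (1850, 21), (1877, 12), (1882, 11)]

theorem pellResidues_step : ∀ v ∈ pellResidues,
    (946 * (3 * v.1 + 5 * v.2) % 1891, 946 * (v.1 + 3 * v.2) % 1891) ∈ pellResidues ∧
      ((1891 - v.1) % 1891, v.2) ∈ pellResidues := by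
  decide +kernel

theorem pellResidues_lt : ∀ v ∈ pellResidues, v.1 < 1891 ∧ v.2 < 1891 := by
  decide +kernel

theorem cube_notMem_pellResidues :
    ∀ x < 1891, ∀ v ∈ pellResidues, v.2 ≠ x ^ 3 % 1891 := by
  decide +kernel

theorem exists_mem_pellResidues (n : ℕ) : ∀ u Y : ℤ, 0 < u → u ≤ n → Y ^ 2 = 5 * u ^ 2 - 524 →
    ∃ v ∈ pellResidues, Y ≡ v.1 [ZMOD 1891] ∧ u ≡ v.2 [ZMOD 1891] := by
  induction n using Nat.strong_induction_on with
  | _ n ih =>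
    have key : ∀ u Y : ℤ, 0 < u → 0 ≤ Y → u ≤ n → Y ^ 2 = 5 * u ^ 2 - 524 →
        ∃ v ∈ pellResidues, Y ≡ v.1 [ZMOD 1891] ∧ u ≡ v.2 [ZMOD 1891] := by
      intro u Y hu hY hn h
      have h11 : 11 ≤ u := by
        by_contra! hlt
        nlinarith [sq_nonneg Y]
      rcases h11.eq_or_lt with rfl | h12
      · have : Y = 9 := by nlinarith
        subst this
        exact ⟨(9, 11), by decide +kernel, by decide, by decide⟩
      · have hYu : u < Y := by nlinarith
        have hY3 : Y < 3 * u := by nlinarith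
        have hpar : (3 * u - Y) % 2 = 0 := by
          have h1 : (Y ^ 2 - u ^ 2) % 2 = 0 := by omega
          rcases Int.emod_two_eq_zero_or_one Y with hy | hy <;>
          rcases Int.emod_two_eq_zero_or_one u with hu' | hu' <;>
          simp [Int.sub_emod, pow_two, Int.mul_emod, hy, hu'] at h1 ⊢
        obtain ⟨a, ha⟩ : (2 : ℤ) ∣ 3 * u - Y := Int.dvd_of_emod_eq_zero hpar
        obtain ⟨b, hb⟩ : (2 : ℤ) ∣ 3 * Y - 5 * u := by omega
        have hu2 : 2 * u = 3 * a + b := by linarith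
        have hY2 : 2 * Y = 3 * b + 5 * a := by linarith
        have hab : b ^ 2 = 5 * a ^ 2 - 524 := by nlinarith
        obtain ⟨v, hv, hb', ha'⟩ := ih a.toNat (by omega) a b (by omega) (by omega) hab
        refine ⟨_, (pellResidues_step v hv).1, ?_, ?_⟩
        · have : Y ≡ 946 * (3 * b + 5 * a) [ZMOD 1891] := by
            rw [← hY2]
            exact (Int.modEq_iff_dvd.2 ⟨Y, by ring⟩)
          push_cast
          exact this.trans (((((hb'.mul_left 3).add (ha'.mul_left 5)).mul_left 946)).trans
            (Int.mod_modEq _ _).symm)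
        · have : u ≡ 946 * (b + 3 * a) [ZMOD 1891] := by
            rw [add_comm, ← hu2]
            exact (Int.modEq_iff_dvd.2 ⟨u, by ring⟩)
          push_cast
          exact this.trans ((((hb'.add (ha'.mul_left 3)).mul_left 946)).trans
            (Int.mod_modEq _ _).symm)
    intro u Y hu hn h
    rcases le_total 0 Y with hY | hY
    · exact key u Y hu hY hn h
    · obtain ⟨v, hv, hY', hu'⟩ := key u (-Y) hu (by linarith) hn (by linarith [neg_sq Y])
      refine ⟨_, (pellResidues_step v hv).2, ?_, hu'⟩
      have hlt : v.1 ≤ 1891 := (pellResidues_lt v hv).1.le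
      push_cast [Nat.cast_sub hlt]
      refine Int.ModEq.trans ?_ (Int.mod_modEq _ _).symm
      have := hY'.neg
      rw [neg_neg] at this
      exact this.trans (Int.modEq_iff_dvd.2 ⟨1, by ring⟩)

theorem five_mul_pow_sub_ne_sq (X Y : ℤ) : Y ^ 2 ≠ 5 * X ^ 42 - 524 := by
  have key : ∀ x : ℤ, 0 ≤ x → Y ^ 2 ≠ 5 * x ^ 42 - 524 := by
    intro x hx h
    have hx0 : 0 < x := by
      rcases hx.eq_or_lt with rfl | h0
      · nlinarith [sq_nonneg Y]
      · exact h0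
    obtain ⟨v, hv, -, hu⟩ := exists_mem_pellResidues (x ^ 21).toNat (x ^ 21) Y (by positivity)
      (Int.self_le_toNat _) (by rw [h]; ring)
    lift x to ℕ using hx
    have h1 : ((x ^ 7 % 1891) ^ 3) ≡ v.2 [MOD 1891] := by
      have h2 : x ^ 21 ≡ v.2 [MOD 1891] := by
        exact_mod_cast (Int.natCast_modEq_iff).1 (by exact_mod_cast hu)
      refine Nat.ModEq.trans ?_ h2
      rw [show x ^ 21 = (x ^ 7) ^ 3 by ring]
      exact (Nat.mod_modEq _ _).pow 3
    refine cube_notMem_pellResidues (x ^ 7 % 1891) (Nat.mod_lt _ (by norm_num)) v hv ?_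
    rw [h1, Nat.mod_eq_of_lt (pellResidues_lt v hv).2]
  intro h
  exact key |X| (abs_nonneg X) (by rw [h, Even.pow_abs (by decide)])

/-- The norm of `b + ω` in the ring `ℤ[ω]`, where `ω ^ 2 = ω - 164483`. -/
def shiftNorm (b : ℤ) : ℤ := b ^ 2 + b + 164483

open Nat in
theorem exists_smooth_cofactor : ∀ p < 469, (∃ q < p, 2 ≤ q ∧ q ∣ p) ∨
    (∀ x < p, ¬ p ∣ x ^ 2 + x + 164483) ∨ p ∈ [0, 1, 5, 11, 13, 37] ∨
    ∃ x < 800, p ∣ x ^ 2 + x + 164483 ∧ x ^ 2 + x + 164483 ∣ p * (p - 1)! ^ 8 := by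
  decide +kernel

/-- The formal properties of the map sending `(a, b)` with `a ∣ shiftNorm b` to the class of the
ideal `(a, b + ω)`. -/
structure IsFormClass {G : Type*} [AddCommGroup G] (f : ℕ → ℤ → G) : Prop where
  add_mul (a : ℕ) (b k : ℤ) : f a (b + k * a) = f a b
  mul (a₁ a₂ : ℕ) (b : ℤ) : ((a₁ * a₂ : ℕ) : ℤ) ∣ shiftNorm b →
    f (a₁ * a₂) b = f a₁ b + f a₂ b
  principal (a : ℕ) (b : ℤ) : (a : ℤ) = shiftNorm b → f a b = 0
  conj (a : ℕ) (b : ℤ) : (a : ℤ) ∣ shiftNorm b → f a (-1 - b) = -f a b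

namespace IsFormClass

variable {G : Type*} [AddCommGroup G] {f : ℕ → ℤ → G}

theorem one (hf : IsFormClass f) (b : ℤ) : f 1 b = 0 := by
  have h := hf.mul 1 1 b (by simp)
  simpa using h

theorem pow (hf : IsFormClass f) (a k : ℕ) (b : ℤ) (h : ((a ^ k : ℕ) : ℤ) ∣ shiftNorm b) :
    f (a ^ k) b = k • f a b := by
  induction k with
  | zero => simpa using hf.one b
  | succ k ih =>
    rw [pow_succ] at h ⊢
    rw [hf.mul _ _ _ h, ih (dvd_trans (by exact_mod_cast Dvd.intro _ rfl) h), succ_nsmul]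

theorem nsmul_eq_zero_of_primes (hf : IsFormClass f) (n : ℕ) (a : ℕ) :
    ∀ b : ℤ, a ≠ 0 → (a : ℤ) ∣ shiftNorm b →
      (∀ p, p.Prime → p ∣ a → ∀ b' : ℤ, (p : ℤ) ∣ shiftNorm b' → n • f p b' = 0) →
      n • f a b = 0 := by
  induction a using induction_on_primes with
  | zero => intro b h; exact absurd rfl h
  | one => intro b _ _ _; rw [hf.one, smul_zero]
  | prime_mul p a hp ih =>
    intro b h0 hd H
    have hpd : (p : ℤ) ∣ shiftNorm b := dvd_trans (by push_cast; exact Dvd.intro _ rfl) hd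
    have had : (a : ℤ) ∣ shiftNorm b := dvd_trans (by push_cast; exact Dvd.intro_left _ rfl) hd
    rw [hf.mul _ _ _ hd, smul_add, H p hp (Dvd.intro _ rfl) b hpd,
      ih b (right_ne_zero_of_mul h0) had fun q hq hqa => H q hq (hqa.mul_left p), add_zero]

theorem nsmul_eq_zero_of_root (hf : IsFormClass f) {n p : ℕ} (hp : p.Prime) {x b : ℤ}
    (hx : (p : ℤ) ∣ shiftNorm x) (hb : (p : ℤ) ∣ shiftNorm b) (h : n • f p x = 0) :
    n • f p b = 0 := by
  have hd : (p : ℤ) ∣ (b - x) * (b + x + 1) := by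
    rw [show (b - x) * (b + x + 1) = shiftNorm b - shiftNorm x by unfold shiftNorm; ring]
    exact dvd_sub hb hx
  rcases (Nat.prime_iff_prime_int.mp hp).dvd_or_dvd hd with ⟨k, hk⟩ | ⟨k, hk⟩
  · rw [show b = x + k * p by linear_combination hk, hf.add_mul, h]
  · rw [show b = -1 - x + k * p by linear_combination hk, hf.add_mul, hf.conj _ _ hx, smul_neg, h,
      neg_zero]

theorem nsmul_eq_zero_of_cofactor (hf : IsFormClass f) {n p c : ℕ} (hp : p.Prime) {x b : ℤ}
    (hb : (p : ℤ) ∣ shiftNorm b) (hx : ((p * c : ℕ) : ℤ) = shiftNorm x)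
    (H : ∀ q, q.Prime → q ∣ c → ∀ b' : ℤ, (q : ℤ) ∣ shiftNorm b' → n • f q b' = 0) :
    n • f p b = 0 := by
  have hpx : (p : ℤ) ∣ shiftNorm x := hx ▸ by push_cast; exact Dvd.intro _ rfl
  have hcx : (c : ℤ) ∣ shiftNorm x := hx ▸ by push_cast; exact Dvd.intro_left _ rfl
  refine hf.nsmul_eq_zero_of_root hp hpx hb ?_
  have hc : c ≠ 0 := by
    rintro rfl
    have : 0 < shiftNorm x := by unfold shiftNorm; nlinarith [sq_nonneg (2 * x + 1)]
    simp at hx; omega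
  have h1 := hf.nsmul_eq_zero_of_primes n c x hc hcx H
  have h2 := hf.mul p c x (hx ▸ dvd_rfl)
  rw [hf.principal _ _ hx] at h2
  rw [eq_neg_of_add_eq_zero_left h2.symm, smul_neg, h1, neg_zero]

theorem base_relations (hf : IsFormClass f) :
    (165 • f 5 1 = 0 ∧ 165 • f 11 0 = 0 ∧ 165 • f 13 2 = 0 ∧ 165 • f 37 7 = 0) := by
  have e5 (k : ℤ) : f 5 (1 + k * 5) = f 5 1 := hf.add_mul 5 1 k
  have c5 (k : ℤ) : f 5 (-2 + k * 5) = -f 5 1 :=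
    (hf.add_mul 5 (-2) k).trans (hf.conj 5 1 (by decide))
  have e11 (k : ℤ) : f 11 (0 + k * 11) = f 11 0 := hf.add_mul 11 0 k
  have c11 (k : ℤ) : f 11 (-1 + k * 11) = -f 11 0 :=
    (hf.add_mul 11 (-1) k).trans (hf.conj 11 0 (by decide))
  have e13 (k : ℤ) : f 13 (2 + k * 13) = f 13 2 := hf.add_mul 13 2 k
  have c13 (k : ℤ) : f 13 (-3 + k * 13) = -f 13 2 :=
    (hf.add_mul 13 (-3) k).trans (hf.conj 13 2 (by decide))
  have e19 (k : ℤ) : f 19 (0 + k * 19) = f 19 0 := hf.add_mul 19 0 k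
  have e37 (k : ℤ) : f 37 (7 + k * 37) = f 37 7 := hf.add_mul 37 7 k
  have c37 (k : ℤ) : f 37 (-8 + k * 37) = -f 37 7 :=
    (hf.add_mul 37 (-8) k).trans (hf.conj 37 7 (by decide))
  have r1 : 3 • f 5 43 + 3 • f 11 43 = 0 := by
    rw [← hf.pow _ _ _ (by decide), ← hf.pow _ _ _ (by decide), ← hf.mul _ _ _ (by decide)]
    exact hf.principal _ _ (by decide)
  have r2 : 3 • f 5 81 + 2 • f 37 81 = 0 := by
    rw [← hf.pow _ _ _ (by decide), ← hf.pow _ _ _ (by decide), ← hf.mul _ _ _ (by decide)]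
    exact hf.principal _ _ (by decide)
  have r3 : 3 • f 5 418 + f 11 418 + f 13 418 + f 19 418 = 0 := by
    rw [← hf.pow _ _ _ (by decide), ← hf.mul _ _ _ (by decide), ← hf.mul _ _ _ (by decide),
      ← hf.mul _ _ _ (by decide)]
    exact hf.principal _ _ (by decide)
  have r4 : 2 • f 11 769 + 2 • f 13 769 + f 37 769 = 0 := by
    rw [← hf.pow _ _ _ (by decide), ← hf.pow _ _ _ (by decide), ← hf.mul _ _ _ (by decide),
      ← hf.mul _ _ _ (by decide)]
    exact hf.principal _ _ (by decide)
  have r5 : f 5 1596 + 4 • f 13 1596 + f 19 1596 = 0 := by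
    rw [← hf.pow _ _ _ (by decide), ← hf.mul _ _ _ (by decide), ← hf.mul _ _ _ (by decide)]
    exact hf.principal _ _ (by decide)
  rw [show f 5 43 = -f 5 1 from c5 9, show f 11 43 = -f 11 0 from c11 4] at r1
  rw [show f 5 81 = f 5 1 from e5 16, show f 37 81 = f 37 7 from e37 2] at r2
  rw [show f 5 418 = -f 5 1 from c5 84, show f 11 418 = f 11 0 from e11 38,
    show f 13 418 = f 13 2 from e13 32, show f 19 418 = f 19 0 from e19 22] at r3
  rw [show f 11 769 = -f 11 0 from c11 70, show f 13 769 = f 13 2 from e13 59,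
    show f 37 769 = -f 37 7 from c37 21] at r4
  rw [show f 5 1596 = f 5 1 from e5 319, show f 13 1596 = -f 13 2 from c13 123,
    show f 19 1596 = f 19 0 from e19 84] at r5
  refine ⟨?_, ?_, ?_, ?_⟩
  · linear_combination (norm := module) (-24 : ℤ) • r1 + (15 : ℤ) • r2 - (12 : ℤ) • r3 +
      (30 : ℤ) • r4 + (12 : ℤ) • r5
  · linear_combination (norm := module) (-31 : ℤ) • r1 - (15 : ℤ) • r2 +
      (12 : ℤ) • r3 - (30 : ℤ) • r4 - (12 : ℤ) • r5
  · linear_combination (norm := module) (-13 : ℤ) • r1 + (15 : ℤ) • r2 + (21 : ℤ) • r3 +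
      (30 : ℤ) • r4 - (21 : ℤ) • r5
  · linear_combination (norm := module) (36 : ℤ) • r1 + (60 : ℤ) • r2 +
      (18 : ℤ) • r3 - (45 : ℤ) • r4 - (18 : ℤ) • r5
theorem nsmul_prime_eq_zero (hf : IsFormClass f) (p : ℕ) :
    p.Prime → ∀ b : ℤ, (p : ℤ) ∣ shiftNorm b → 165 • f p b = 0 := by
  induction p using Nat.strong_induction_on with
  | _ p ih =>
  intro hp b hb
  rcases lt_or_ge p 469 with hlt | hge
  · rcases exists_smooth_cofactor p hlt with ⟨q, hqp, hq2, hq⟩ | hno | hbase | ⟨x, -, hpx, hx⟩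
    · rcases hp.eq_one_or_self_of_dvd q hq with rfl | rfl <;> omega
    · exfalso
      have hp0 : (0 : ℤ) < p := by exact_mod_cast hp.pos
      have h0 := Int.emod_nonneg b hp0.ne'
      have h1 := Int.emod_lt_of_pos b hp0
      refine hno (b % p).toNat (by omega) ?_
      zify
      rw [Int.toNat_of_nonneg h0]
      have := hb
      rw [shiftNorm, ← Int.emod_add_mul_ediv b p] at this
      refine (Int.dvd_iff_dvd_of_dvd_sub ?_).mp this
      exact ⟨(b / p) * (2 * (b % p) + p * (b / p) + 1), by ring⟩
    · obtain ⟨h5, h11, h13, h37⟩ := hf.base_relations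
      simp only [List.mem_cons, List.not_mem_nil, or_false] at hbase
      rcases hbase with rfl | rfl | rfl | rfl | rfl | rfl
      · exact absurd hp Nat.not_prime_zero
      · exact absurd hp Nat.not_prime_one
      · exact hf.nsmul_eq_zero_of_root hp (by decide) hb h5
      · exact hf.nsmul_eq_zero_of_root hp (by decide) hb h11
      · exact hf.nsmul_eq_zero_of_root hp (by decide) hb h13
      · exact hf.nsmul_eq_zero_of_root hp (by decide) hb h37
    · obtain ⟨c, hc⟩ := hpx
      refine hf.nsmul_eq_zero_of_cofactor hp hb (x := x) (c := c)
        (by rw [← hc, shiftNorm]; push_cast; ring) ?_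
      intro q hq hqc b' hb'
      refine ih q ?_ hq b' hb'
      rw [hc] at hx
      have := hqc.trans (Nat.dvd_of_mul_dvd_mul_left hp.pos hx)
      have := hq.dvd_factorial.mp (hq.dvd_of_dvd_pow this)
      have := hp.pos
      omega
  · have hp0 : (0 : ℤ) < p := by exact_mod_cast hp.pos
    obtain ⟨x, hxb, hx1, hx2⟩ : ∃ x : ℤ, (p : ℤ) ∣ x - b ∧ -p ≤ 2 * x + 1 ∧ 2 * x + 1 ≤ p := by
      have h0 := Int.emod_nonneg b hp0.ne'
      have h1 := Int.emod_lt_of_pos b hp0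
      have h2 := Int.emod_add_mul_ediv b p
      rcases le_or_gt (2 * (b % p) + 1) p with h | h
      · exact ⟨b % p, ⟨-(b / p), by linear_combination h2⟩, by omega, h⟩
      · exact ⟨b % p - p, ⟨-(b / p) - 1, by linear_combination h2⟩, by omega, by omega⟩
    have hpx : (p : ℤ) ∣ shiftNorm x := by
      refine (Int.dvd_iff_dvd_of_dvd_sub ?_).mp hb
      obtain ⟨k, hk⟩ := hxb
      exact ⟨-k * (x + b + 1), by unfold shiftNorm; linear_combination -(x + b + 1) * hk⟩
    obtain ⟨c, hc⟩ := hpx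
    have hN : 0 < shiftNorm x := by unfold shiftNorm; nlinarith [sq_nonneg (2 * x + 1)]
    have hc0 : 0 < c := by
      rw [hc] at hN
      exact pos_of_mul_pos_right hN hp0.le
    lift c to ℕ using hc0.le
    have hge' : (469 : ℤ) ≤ p := by exact_mod_cast hge
    have hcp : (c : ℤ) < p := by
      have h4 : 4 * (p * c : ℤ) = (2 * x + 1) ^ 2 + 657931 := by rw [← hc]; unfold shiftNorm; ring
      by_contra! h
      nlinarith [mul_nonneg (sub_nonneg.mpr hx2) (neg_le_iff_add_nonneg.mp hx1)]
    refine hf.nsmul_eq_zero_of_cofactor hp hb (x := x) (c := c) (by rw [hc]; push_cast; rfl) ?_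
    intro q hq hqc b' hb'
    refine ih q ?_ hq b' hb'
    have := Nat.le_of_dvd (by omega) hqc
    omega

theorem nsmul_eq_zero (hf : IsFormClass f) {a : ℕ} {b : ℤ} (h : (a : ℤ) ∣ shiftNorm b) :
    165 • f a b = 0 := by
  refine hf.nsmul_eq_zero_of_primes 165 a b ?_ h fun p hp _ b' hb' =>
    hf.nsmul_prime_eq_zero p hp b' hb'
  rintro rfl
  have : 0 < shiftNorm b := by unfold shiftNorm; nlinarith [sq_nonneg (2 * b + 1)]
  simp at h; omega

end IsFormClass

section IdealClass

open scoped nonZeroDivisors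

variable {R : Type*} [CommRing R] [IsDomain R]

open Classical in
/-- The class of an invertible ideal of a domain; the trivial class for the other ideals. -/
noncomputable def idealClass (I : Ideal R) : ClassGroup R :=
  if h : IsUnit (I : FractionalIdeal R⁰ (FractionRing R)) then
    ClassGroup.mk (FractionRing R) h.unit else 1

theorem idealClass_of_isUnit {I : Ideal R} (h : IsUnit (I : FractionalIdeal R⁰ (FractionRing R))) :
    idealClass I = ClassGroup.mk (FractionRing R) h.unit :=
  dif_pos h

theorem idealClass_mul {I J : Ideal R}
    (h : IsUnit ((I * J : Ideal R) : FractionalIdeal R⁰ (FractionRing R))) :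
    idealClass (I * J) = idealClass I * idealClass J := by
  have h' := h
  rw [FractionalIdeal.coeIdeal_mul] at h'
  have hI := isUnit_of_mul_isUnit_left h'
  have hJ := isUnit_of_mul_isUnit_right h'
  rw [idealClass_of_isUnit h, idealClass_of_isUnit hI, idealClass_of_isUnit hJ, ← map_mul]
  congr 1
  ext1
  simp [FractionalIdeal.coeIdeal_mul]

theorem idealClass_eq_one_iff {I : Ideal R}
    (h : IsUnit (I : FractionalIdeal R⁰ (FractionRing R))) :
    idealClass I = 1 ↔ ∃ x : R, x ≠ 0 ∧ I = Ideal.span {x} := by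
  rw [idealClass_of_isUnit h, ClassGroup.mk_eq_one_of_coe_ideal (I' := I) h.unit_spec]

theorem isUnit_coeIdeal_span_singleton {x : R} (hx : x ≠ 0) :
    IsUnit ((Ideal.span {x} : Ideal R) : FractionalIdeal R⁰ (FractionRing R)) := by
  rw [FractionalIdeal.coeIdeal_span_singleton]
  refine IsUnit.of_mul_eq_one (FractionalIdeal.spanSingleton R⁰ (algebraMap R _ x)⁻¹) ?_
  rw [FractionalIdeal.spanSingleton_mul_spanSingleton, mul_inv_cancel₀,
    FractionalIdeal.spanSingleton_one]
  simpa using hx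

theorem idealClass_span_singleton {x : R} (hx : x ≠ 0) :
    idealClass (Ideal.span {x} : Ideal R) = 1 :=
  (idealClass_eq_one_iff (isUnit_coeIdeal_span_singleton hx)).mpr ⟨x, hx, rfl⟩

end IdealClass

/-- The ring `ℤ[ω]` with `ω ^ 2 = ω - 164483`, of discriminant `-657931`. -/
abbrev QuadOrder : Type := QuadraticAlgebra ℤ (-164483) 1

namespace QuadOrder

open QuadraticAlgebra

theorem four_mul_norm (z : QuadOrder) :
    4 * QuadraticAlgebra.norm z = (2 * z.re + z.im) ^ 2 + 657931 * z.im ^ 2 := by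
  rw [norm_def]; ring

instance : IsDomain QuadOrder := by
  have key (z : QuadOrder) (hz : QuadraticAlgebra.norm z = 0) : z = 0 := by
    have h1 := four_mul_norm z
    rw [hz] at h1
    have h2 : z.im = 0 := by nlinarith [sq_nonneg (2 * z.re + z.im), sq_nonneg z.im]
    have h3 : z.re = 0 := by rw [h2] at h1; nlinarith
    ext <;> simp [h2, h3]
  have : NoZeroDivisors QuadOrder := ⟨fun {x y} h => by
    have := congrArg QuadraticAlgebra.norm h
    rw [map_mul, QuadraticAlgebra.norm_zero, mul_eq_zero] at this
    exact this.imp (key _) (key _)⟩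
  exact NoZeroDivisors.to_isDomain _

/-- The ideal `(a, b + ω)`. -/
def formIdeal (a : ℕ) (b : ℤ) : Ideal QuadOrder :=
  Ideal.span {(a : QuadOrder), b + (ω : QuadOrder)}

theorem add_omega_sq (b : ℤ) :
    (b + (ω : QuadOrder)) * (b + (ω : QuadOrder)) =
      (2 * b + 1 : ℤ) * (b + (ω : QuadOrder)) - shiftNorm b := by
  ext <;> simp [shiftNorm, pow_two] <;> ring

theorem add_omega_mul_conj (b : ℤ) :
    (b + (ω : QuadOrder)) * ((-1 - b : ℤ) + (ω : QuadOrder)) = -shiftNorm b := by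
  ext <;> simp [shiftNorm, pow_two]; ring

theorem exists_bezout {a₁ a₂ b : ℤ} (h : a₁ * a₂ ∣ shiftNorm b) :
    ∃ u v w : ℤ, u * a₁ + v * a₂ + w * (2 * b + 1) = 1 := by
  have hg : Int.gcd (Int.gcd a₁ a₂) (2 * b + 1) = 1 := by
    by_contra hne
    obtain ⟨r, hr, hrd⟩ := Nat.exists_prime_and_dvd hne
    have hrd' : (r : ℤ) ∣ (Int.gcd (Int.gcd a₁ a₂) (2 * b + 1) : ℤ) := by exact_mod_cast hrd
    have h12 := hrd'.trans (Int.gcd_dvd_left _ _)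
    have h3 := hrd'.trans (Int.gcd_dvd_right _ _)
    have h1 := h12.trans (Int.gcd_dvd_left _ _)
    have h2 := h12.trans (Int.gcd_dvd_right _ _)
    have hd : ((r : ℤ) * r) ∣ 657931 := by
      have e : (657931 : ℤ) = 4 * shiftNorm b - (2 * b + 1) * (2 * b + 1) := by
        unfold shiftNorm; ring
      rw [e]
      exact dvd_sub (((mul_dvd_mul h1 h2).trans h).mul_left _) (mul_dvd_mul h3 h3)
    have hd' : r * r ∣ 657931 := by exact_mod_cast hd
    have hp : Nat.Prime 657931 := by norm_num
    rcases (Nat.dvd_prime hp).mp (Dvd.dvd.trans (Dvd.intro _ rfl) hd') with h | h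
    · exact hr.one_lt.ne' h
    · rw [h] at hd'; revert hd'; decide
  have e1 := Int.gcd_eq_gcd_ab a₁ a₂
  have e2 := Int.gcd_eq_gcd_ab (Int.gcd a₁ a₂) (2 * b + 1)
  rw [hg] at e2
  generalize Int.gcdA (Int.gcd a₁ a₂) (2 * b + 1) = s at e2
  generalize Int.gcdB (Int.gcd a₁ a₂) (2 * b + 1) = t at e2
  push_cast at e2
  exact ⟨Int.gcdA a₁ a₂ * s, Int.gcdB a₁ a₂ * s, t, by linear_combination -e2 - s * e1⟩

theorem formIdeal_add_mul (a : ℕ) (b k : ℤ) : formIdeal a (b + k * a) = formIdeal a b := by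
  unfold formIdeal
  push_cast
  rw [add_right_comm, Ideal.span_pair_add_mul_left]

theorem formIdeal_mul {a₁ a₂ : ℕ} {b : ℤ} (h : ((a₁ * a₂ : ℕ) : ℤ) ∣ shiftNorm b) :
    formIdeal a₁ b * formIdeal a₂ b = formIdeal (a₁ * a₂) b := by
  obtain ⟨u, v, w, huvw⟩ := exists_bezout (a₁ := a₁) (a₂ := a₂) (b := b) (by exact_mod_cast h)
  obtain ⟨c, hc⟩ := h
  have hsq := add_omega_sq b
  rw [hc] at hsq
  have hone : (u * a₁ + v * a₂ + w * (2 * b + 1) : QuadOrder) = 1 := by exact_mod_cast huvw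
  unfold formIdeal
  rw [Ideal.span_pair_mul_span_pair]
  push_cast at hsq ⊢
  apply le_antisymm
  · rw [Ideal.span_le]
    rintro x (rfl | rfl | rfl | rfl)
    · exact Ideal.mem_span_pair.mpr ⟨1, 0, by ring⟩
    · exact Ideal.mem_span_pair.mpr ⟨0, a₁, by ring⟩
    · exact Ideal.mem_span_pair.mpr ⟨0, a₂, by ring⟩
    · exact Ideal.mem_span_pair.mpr ⟨-c, 2 * b + 1, by rw [hsq]; ring⟩
  · rw [Ideal.span_le]
    rintro x (rfl | rfl)
    · exact Ideal.subset_span (by simp)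
    · simp only [SetLike.mem_coe, Ideal.mem_span_insert', Ideal.mem_span_singleton']
      exact ⟨-(w * c), -u, -v, w, by linear_combination w * hsq + (b + (ω : QuadOrder)) * hone⟩

theorem formIdeal_mul_conj {a : ℕ} {b : ℤ} (h : (a : ℤ) ∣ shiftNorm b) :
    formIdeal a (-1 - b) * formIdeal a b = Ideal.span {(a : QuadOrder)} := by
  obtain ⟨c, hc⟩ := h
  obtain ⟨u, v, w, huvw⟩ := exists_bezout (a₁ := a) (a₂ := c) (b := b) (by rw [hc])
  have hN := add_omega_mul_conj b
  rw [hc] at hN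
  have hone : (u * a + v * c + w * (2 * b + 1) : QuadOrder) = 1 := by exact_mod_cast huvw
  unfold formIdeal
  rw [Ideal.span_pair_mul_span_pair]
  push_cast at hN ⊢
  apply le_antisymm
  · rw [Ideal.span_le]
    rintro x (rfl | rfl | rfl | rfl)
    · exact Ideal.mem_span_singleton'.mpr ⟨a, by ring⟩
    · exact Ideal.mem_span_singleton'.mpr ⟨b + (ω : QuadOrder), by ring⟩
    · exact Ideal.mem_span_singleton'.mpr ⟨-1 - b + (ω : QuadOrder), by ring⟩
    · exact Ideal.mem_span_singleton'.mpr ⟨-c, by linear_combination -hN⟩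
  · rw [Ideal.span_le]
    rintro x rfl
    simp only [SetLike.mem_coe, Ideal.mem_span_insert', Ideal.mem_span_singleton']
    exact ⟨-u, -w, w, -v, by linear_combination -v * hN + a * hone⟩

theorem formIdeal_of_eq {a : ℕ} {b : ℤ} (h : (a : ℤ) = shiftNorm b) :
    formIdeal a b = Ideal.span {b + (ω : QuadOrder)} := by
  have hN := add_omega_mul_conj b
  rw [← h] at hN
  push_cast at hN
  refine le_antisymm ?_ (Ideal.span_mono (by simp))
  rw [formIdeal, Ideal.span_le]
  rintro x (rfl | rfl)
  · exact Ideal.mem_span_singleton'.mpr ⟨1 + b - (ω : QuadOrder), by linear_combination -hN⟩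
  · exact Ideal.mem_span_singleton_self _

theorem natCast_ne_zero_of_dvd {a : ℕ} {b : ℤ} (h : (a : ℤ) ∣ shiftNorm b) :
    (a : QuadOrder) ≠ 0 := by
  intro h0
  rw [Nat.cast_eq_zero.mp h0] at h
  have : 0 < shiftNorm b := by unfold shiftNorm; nlinarith [sq_nonneg (2 * b + 1)]
  simp at h; omega

open scoped nonZeroDivisors in
theorem isUnit_formIdeal {a : ℕ} {b : ℤ} (h : (a : ℤ) ∣ shiftNorm b) :
    IsUnit (formIdeal a b : FractionalIdeal QuadOrder⁰ (FractionRing QuadOrder)) := by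
  have := isUnit_coeIdeal_span_singleton (natCast_ne_zero_of_dvd h)
  rw [← formIdeal_mul_conj h, FractionalIdeal.coeIdeal_mul] at this
  exact isUnit_of_mul_isUnit_right this

theorem isFormClass :
    IsFormClass fun a b => Additive.ofMul (idealClass (formIdeal a b)) where
  add_mul a b k := by simp only [formIdeal_add_mul]
  mul a₁ a₂ b h := by
    have := isUnit_formIdeal h
    rw [← formIdeal_mul h] at this ⊢
    rw [idealClass_mul this, ofMul_mul]
  principal a b h := by
    rw [formIdeal_of_eq h, idealClass_span_singleton, ofMul_one]
    intro h0
    simpa using congrArg QuadraticAlgebra.im h0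
  conj a b h := by
    have h0 := natCast_ne_zero_of_dvd h
    have := isUnit_coeIdeal_span_singleton h0
    rw [← formIdeal_mul_conj h] at this
    rw [eq_neg_iff_add_eq_zero, ← ofMul_mul, ← idealClass_mul this, formIdeal_mul_conj h,
      idealClass_span_singleton h0, ofMul_one]

end QuadOrder

namespace QuadOrder

open QuadraticAlgebra

theorem isUnit_iff (z : QuadOrder) : IsUnit z ↔ z = 1 ∨ z = -1 := by
  refine ⟨fun h => ?_, by rintro (rfl | rfl) <;> simp⟩
  rw [isUnit_iff_norm_isUnit, Int.isUnit_iff] at h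
  have h4 := four_mul_norm z
  have him : z.im = 0 := by
    rcases h with h | h <;> rw [h] at h4 <;> nlinarith [sq_nonneg (2 * z.re + z.im), sq_nonneg z.im]
  rw [him] at h4
  have hre : z.re = 1 ∨ z.re = -1 := by
    have hsq : z.re ^ 2 = 1 := by rcases h with h | h <;> rw [h] at h4 <;> nlinarith
    simpa using hsq
  rcases hre with hre | hre
  · left; ext <;> simp [hre, him]
  · right; ext <;> simp [hre, him]

theorem exists_pow_five_eq {x : ℕ} {b : ℤ} {α : QuadOrder}
    (hb : ((x ^ 25 : ℕ) : ℤ) ∣ shiftNorm b) (hα : formIdeal (x ^ 25) b = Ideal.span {α}) :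
    ∃ γ : QuadOrder, γ ^ 5 = α := by
  have hx : ((x : ℕ) : ℤ) ∣ shiftNorm b := dvd_trans
    (by push_cast; exact dvd_pow_self _ (by decide)) hb
  have hx5 : ((x ^ 5 : ℕ) : ℤ) ∣ shiftNorm b :=
    dvd_trans (by push_cast; exact pow_dvd_pow _ (by decide)) hb
  have h165 := isFormClass.nsmul_eq_zero hx
  have h25 := isFormClass.pow x 25 b hb
  have h5 := isFormClass.pow x 5 b hx5
  have hα0 : α ≠ 0 := by
    rintro rfl
    have : ((x ^ 25 : ℕ) : QuadOrder) ∈ formIdeal (x ^ 25) b := Ideal.subset_span (by simp)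
    rw [hα] at this
    exact natCast_ne_zero_of_dvd hb (by simpa using this)
  rw [hα, idealClass_span_singleton hα0, ofMul_one] at h25
  have h0 : 5 • Additive.ofMul (idealClass (formIdeal x b)) = 0 := by
    linear_combination (norm := module) (2 : ℤ) • h165 + (13 : ℤ) • h25
  rw [h0, ← ofMul_one, Additive.ofMul.injective.eq_iff,
    idealClass_eq_one_iff (isUnit_formIdeal hx5)] at h5
  obtain ⟨γ, -, hγ⟩ := h5
  have hpow (k : ℕ) (hk : (((x ^ 5) ^ k : ℕ) : ℤ) ∣ shiftNorm b) :
      formIdeal ((x ^ 5) ^ k) b = Ideal.span {γ ^ k} := by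
    induction k with
    | zero =>
      rw [pow_zero, pow_zero, Ideal.span_singleton_one, Ideal.eq_top_iff_one]
      exact Ideal.subset_span (by simp)
    | succ k ih =>
      rw [pow_succ] at hk
      rw [pow_succ, ← formIdeal_mul hk, ih (dvd_trans (by push_cast; exact Dvd.intro _ rfl) hk),
        hγ, Ideal.span_singleton_mul_span_singleton, pow_succ]
  have h5' := hpow 5 (by rw [← pow_mul]; exact hb)
  rw [← pow_mul, hα, Ideal.span_singleton_eq_span_singleton] at h5'
  obtain ⟨u, hu⟩ := h5'
  rcases (isUnit_iff _).mp u.isUnit with h | h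
  · exact ⟨γ, by rw [← hu, h, mul_one]⟩
  · exact ⟨-γ, by rw [Odd.neg_pow (by decide), ← hu, h]; ring⟩

theorem formIdeal_eq_span {a : ℕ} {y b : ℤ} (ha : Odd a) (hb : 2 * b + 1 = y + a)
    (hn : y ^ 2 + 657931 = a) : formIdeal a b =
      Ideal.span {y - 1 + 2 * (ω : QuadOrder)} := by
  obtain ⟨k, rfl⟩ := ha
  have hω : (ω : QuadOrder) * ω = ω - 164483 := by ext <;> simp
  have e1 : (((2 * k + 1 : ℕ) : ℤ) : QuadOrder) = ((y ^ 2 + 657931 : ℤ) : QuadOrder) := by rw [hn]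
  have e2 : ((2 * b + 1 : ℤ) : QuadOrder) = ((y + (2 * k + 1 : ℕ) : ℤ) : QuadOrder) := by rw [hb]
  push_cast at e1 e2
  unfold formIdeal
  push_cast
  apply le_antisymm
  · rw [Ideal.span_le]
    rintro x (rfl | rfl)
    · refine Ideal.mem_span_singleton'.mpr ⟨y + 1 - 2 * (ω : QuadOrder), ?_⟩
      linear_combination -e1 - 4 * hω
    · refine Ideal.mem_span_singleton'.mpr
        ⟨(y + 1 - 2 * (ω : QuadOrder)) * (b + (ω : QuadOrder)) - k -
          k * (y + 1 - 2 * (ω : QuadOrder)), ?_⟩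
      linear_combination (b + (ω : QuadOrder) - k) * (-e1 - 4 * hω) + k * e2
  · rw [Ideal.span_le]
    rintro x rfl
    refine Ideal.mem_span_pair.mpr ⟨-1, 2, ?_⟩
    linear_combination e2

theorem im_pow_five_ne_two (z : QuadOrder) : (z ^ 5).im ≠ 2 := by
  intro h
  obtain ⟨p, q⟩ := z
  have hE : q * (5 * (p ^ 4 + 2 * p ^ 3 * q - 328964 * p ^ 2 * q ^ 2 - 328965 * p * q ^ 3 +
      5410832768 * q ^ 4) + q ^ 4) = 2 := by
    refine Eq.trans ?_ h
    simp [pow_succ]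
    ring
  have hq : q ∣ 2 := ⟨_, hE.symm⟩
  have h1 : q ≤ 2 := Int.le_of_dvd (by norm_num) hq
  have h2 : -q ≤ 2 := Int.le_of_dvd (by norm_num) ((neg_dvd).mpr hq)
  obtain rfl | rfl | rfl | rfl | rfl : q = -2 ∨ q = -1 ∨ q = 0 ∨ q = 1 ∨ q = 2 := by omega
  · omega
  · omega
  · omega
  · omega
  · have hs : ((p + 1) ^ 2 - 657931) ^ 2 = 346298560609 := by
      refine mul_left_cancel₀ (a := 10) (by norm_num) ?_
      linear_combination hE
    have hl := abs_lt_of_sq_lt_sq (a := (p + 1) ^ 2 - 657931) (b := 588472) (by omega) (by norm_num)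
    have hg := abs_lt_of_sq_lt_sq (a := 588471) (b := |(p + 1) ^ 2 - 657931|)
      (by rw [sq_abs]; omega) (abs_nonneg _)
    rw [abs_of_pos (by norm_num)] at hg
    omega

end QuadOrder

open QuadraticAlgebra in
theorem sq_ne_pow_twentyfive_sub (X Y : ℤ) : Y ^ 2 ≠ X ^ 25 - 657931 := by
  intro h
  have hX0 : 0 < X := by
    by_contra! hX
    have : X ^ 25 ≤ 0 := Odd.pow_nonpos (by decide) hX
    nlinarith [sq_nonneg Y]
  have hXodd : Odd X := by
    by_contra hX
    obtain ⟨k, rfl⟩ := Int.not_odd_iff_even.mp hX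
    have h8 : (k + k) ^ 25 = 8 * (2 ^ 22 * k ^ 25) := by ring
    rcases Int.even_or_odd' Y with ⟨m, rfl | rfl⟩
    · ring_nf at h h8; omega
    · obtain ⟨n, hn⟩ := Int.even_mul_succ_self m
      have h4 : (2 * m + 1) ^ 2 = 4 * (m * (m + 1)) + 1 := by ring
      omega
  lift X to ℕ using hX0.le
  have hXodd' : Odd (X ^ 25) := (by exact_mod_cast hXodd : Odd X).pow
  have hYeven : Even Y := by
    by_contra hY
    have h2 := (Int.not_even_iff_odd.mp hY).pow (n := 2)
    rw [h] at h2
    exact (Int.not_even_iff_odd.mpr h2) (hXodd.pow.sub_odd (by decide))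
  obtain ⟨m, rfl⟩ := hYeven
  obtain ⟨k, hk⟩ := hXodd'
  have hcast : ((X ^ 25 : ℕ) : ℤ) = 2 * k + 1 := by rw [hk]; push_cast; ring
  have ha : (m + m) ^ 2 + 657931 = ((X ^ 25 : ℕ) : ℤ) := by push_cast; linear_combination h
  have hb : 2 * (m + k) + 1 = m + m + ((X ^ 25 : ℕ) : ℤ) := by rw [hcast]; ring
  have hdvd : ((X ^ 25 : ℕ) : ℤ) ∣ shiftNorm (m + k) := by
    have hk' : (k : ℤ) = 2 * m ^ 2 + 328965 := by
      refine mul_left_cancel₀ (a := 2) (by norm_num) ?_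
      linear_combination -ha - hcast
    refine ⟨m + m ^ 2 + 164483, ?_⟩
    rw [hcast, hk', shiftNorm]
    ring
  obtain ⟨γ, hγ⟩ := QuadOrder.exists_pow_five_eq hdvd (QuadOrder.formIdeal_eq_span ⟨k, hk⟩ hb ha)
  exact QuadOrder.im_pow_five_ne_two γ (by rw [hγ]; simp)

open NumberField

instance (p : ℕ) [NeZero p] : IsCyclotomicExtension {p} ℚ (CyclotomicField p ℚ) :=
  have : NeZero ((p : ℕ) : ℚ) := ⟨Nat.cast_ne_zero.2 (NeZero.ne p)⟩
  CyclotomicField.isCyclotomicExtension p ℚ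

/-- The ring of integers of the `p`-th cyclotomic field. -/
abbrev CycInt (p : ℕ) [NeZero p] : Type := 𝓞 (CyclotomicField p ℚ)

/-- The standard primitive `p`-th root of unity in `CycInt p`. -/
noncomputable def cycZeta (p : ℕ) [NeZero p] : CycInt p :=
  (IsCyclotomicExtension.zeta_spec p ℚ (CyclotomicField p ℚ)).toInteger

theorem cycZeta_isPrimitiveRoot (p : ℕ) [NeZero p] : IsPrimitiveRoot (cycZeta p) p :=
  (IsCyclotomicExtension.zeta_spec p ℚ (CyclotomicField p ℚ)).toInteger_isPrimitiveRoot

theorem exists_ringHom_cycZeta (p : ℕ) [hp : Fact p.Prime] {S : Type*} [CommRing S] {z : S}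
    (hz : ∑ i ∈ Finset.range p, z ^ i = 0) : ∃ φ : CycInt p →+* S, φ (cycZeta p) = z := by
  have hζ := IsCyclotomicExtension.zeta_spec p ℚ (CyclotomicField p ℚ)
  have hgen : hζ.integralPowerBasis.gen = cycZeta p := hζ.integralPowerBasis_gen
  have hmin : minpoly ℤ (cycZeta p) = Polynomial.cyclotomic p ℤ :=
    by
    rw [Polynomial.cyclotomic_eq_minpoly hζ hp.out.pos]
    exact (minpoly.algebraMap_eq RingOfIntegers.coe_injective (cycZeta p)).symm
  have h0 : Polynomial.aeval z (minpoly ℤ hζ.integralPowerBasis.gen) = 0 := by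
    rw [hgen, hmin, Polynomial.cyclotomic_prime]
    simpa using hz
  refine ⟨(hζ.integralPowerBasis.lift z h0).toRingHom, ?_⟩
  rw [← hgen]
  exact hζ.integralPowerBasis.lift_gen z h0

theorem ringHom_ext_cycZeta {p : ℕ} [hp : Fact p.Prime] {S : Type*} [CommRing S]
    {φ ψ : CycInt p →+* S} (h : φ (cycZeta p) = ψ (cycZeta p)) : φ = ψ := by
  have hζ := IsCyclotomicExtension.zeta_spec p ℚ (CyclotomicField p ℚ)
  have hgen : hζ.integralPowerBasis.gen = cycZeta p := hζ.integralPowerBasis_gen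
  have := hζ.integralPowerBasis.algHom_ext (f := φ.toIntAlgHom) (g := ψ.toIntAlgHom)
    (by rw [hgen]; exact h)
  ext x
  exact DFunLike.congr_fun this x

/-- A family of homomorphisms to `ℤ/ℓ` trivial on `T`, with non-degenerate values on a family `ε`,
shows that `ε` generates modulo `T` and `ℓ`-th powers. -/
theorem exists_eq_mul_prod_pow_mul_pow {G : Type*} [CommGroup G] {r : ℕ} {ℓ : ℕ} [Fact ℓ.Prime]
    (T : Subgroup G) (f : Fin r → G)
    (hf : ∀ x, ∃ t ∈ T, ∃ e : Fin r → ℤ, x = t * ∏ i, f i ^ e i)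
    (χ : Fin r → G →* Multiplicative (ZMod ℓ)) (hχ : ∀ i, ∀ t ∈ T, χ i t = 1)
    (ε : Fin r → G)
    (hε : ∀ i j, (χ i (ε j)).toAdd = if i = j then 1 else 0) (u : G) :
    ∃ t ∈ T, ∃ a : Fin r → ℕ, (∀ i, a i < ℓ) ∧ ∃ w, u = t * (∏ i, ε i ^ a i) * w ^ ℓ := by
  choose t ht e he using hf
  have hval : ∀ i x, (χ i x).toAdd = ∑ k, (χ i (f k)).toAdd * (e x k : ZMod ℓ) := by
    intro i x
    conv_lhs => rw [he x]
    rw [map_mul, hχ i _ (ht x), one_mul, map_prod, toAdd_prod]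
    refine Finset.sum_congr rfl fun k _ => ?_
    rw [map_zpow, toAdd_zpow, zsmul_eq_mul, mul_comm]
  let M : Matrix (Fin r) (Fin r) (ZMod ℓ) := fun i k => (χ i (f k)).toAdd
  let E : Matrix (Fin r) (Fin r) (ZMod ℓ) := fun k j => (e (ε j) k : ZMod ℓ)
  have hME : M * E = 1 := by
    ext i j
    rw [Matrix.mul_apply, Matrix.one_apply, ← hε i j, hval i (ε j)]
  have hEM : E * M = 1 := mul_eq_one_comm.1 hME
  have hker : ∀ x, (∀ i, χ i x = 1) → ∃ s ∈ T, ∃ w, x = s * w ^ ℓ := by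
    intro x hx
    have hMe : M.mulVec (fun k => (e x k : ZMod ℓ)) = 0 := by
      ext i
      simp only [Matrix.mulVec, dotProduct, M, ← hval i x, hx i, toAdd_one, Pi.zero_apply]
    have he0 : (fun k => (e x k : ZMod ℓ)) = 0 := by
      rw [← Matrix.one_mulVec (fun k => (e x k : ZMod ℓ)), ← hEM, ← Matrix.mulVec_mulVec, hMe,
        Matrix.mulVec_zero]
    have hdvd : ∀ k, ∃ d, e x k = ℓ * d := fun k =>
      (ZMod.intCast_zmod_eq_zero_iff_dvd _ ℓ).1 (congrFun he0 k)
    choose d hd using hdvd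
    refine ⟨t x, ht x, ∏ k, f k ^ d k, ?_⟩
    conv_lhs => rw [he x]
    rw [← Finset.prod_pow]
    congr 1
    refine Finset.prod_congr rfl fun k _ => ?_
    rw [hd k, mul_comm, zpow_mul, zpow_natCast]
  obtain ⟨s, hs, w, hw⟩ := hker (u * (∏ i, ε i ^ (χ i u).toAdd.val)⁻¹) (by
    intro i
    apply Multiplicative.toAdd.injective
    rw [map_mul, map_inv, map_prod, toAdd_mul, toAdd_inv, toAdd_prod, toAdd_one]
    simp [hε])
  refine ⟨s, hs, fun i => (χ i u).toAdd.val, fun i => ZMod.val_lt _, w, ?_⟩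
  rw [mul_right_comm, ← hw, inv_mul_cancel_right]

theorem exists_torsion_mul_prod_zpow (p r : ℕ) [hp : Fact p.Prime] (hr : p = 2 * r + 3)
    : ∃ f : Fin r → (CycInt p)ˣ, ∀ x, ∃ t ∈ CommGroup.torsion (CycInt p)ˣ, ∃ e : Fin r → ℤ,
      x = t * ∏ i, f i ^ e i := by
  have hrank : Units.rank (CyclotomicField p ℚ) = r := by
    unfold Units.rank
    rw [InfinitePlace.card_eq_nrRealPlaces_add_nrComplexPlaces,
      IsCyclotomicExtension.Rat.nrRealPlaces_eq_zero (n := p) _ (by omega),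
      IsCyclotomicExtension.Rat.nrComplexPlaces_eq_totient_div_two p, Nat.totient_prime hp.out]
    omega
  refine ⟨fun i => Units.fundSystem _ (finCongr hrank.symm i), fun x => ?_⟩
  obtain ⟨⟨t, e⟩, h, -⟩ := Units.exist_unique_eq_mul_prod (CyclotomicField p ℚ) x
  refine ⟨t, t.2, fun i => e (finCongr hrank.symm i), ?_⟩
  rw [h]
  congr 1
  exact (Equiv.prod_comp (finCongr hrank.symm) (fun i => Units.fundSystem _ i ^ e i)).symm

theorem exists_eq_neg_cycZeta_pow {p : ℕ} [hp : Fact p.Prime] (hodd : Odd p) {t : (CycInt p)ˣ}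
    (ht : t ∈ CommGroup.torsion (CycInt p)ˣ) : ∃ k : ℕ, (t : CycInt p) = (-cycZeta p) ^ k := by
  have hζ := IsCyclotomicExtension.zeta_spec p ℚ (CyclotomicField p ℚ)
  obtain ⟨k, hk⟩ := hζ.exists_neg_pow_of_isOfFinOrder hodd
    (x := algebraMap (CycInt p) (CyclotomicField p ℚ) t)
    (MonoidHom.isOfFinOrder
      ((algebraMap (CycInt p) (CyclotomicField p ℚ)).toMonoidHom.comp (Units.coeHom _)) ht)
  refine ⟨k, RingOfIntegers.coe_injective ?_⟩
  rw [hk, map_pow, map_neg]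
  rfl

theorem exists_dlog {G R : Type*} [CommGroup G] [CommRing R] [IsDomain R] {ℓ : ℕ}
    [hl : Fact ℓ.Prime] {g : R} (hg : IsPrimitiveRoot g ℓ) (χ : G →* R)
    (hχ : ∀ x, χ x ^ ℓ = 1) :
    ∃ ψ : G →* Multiplicative (ZMod ℓ), ∀ x, (χ x = 1 → ψ x = 1) ∧
      (χ x = g → (ψ x).toAdd = 1) := by
  choose i hi hg' using fun x => hg.eq_pow_of_pow_eq_one (hχ x)
  have key : ∀ m n : ℕ, g ^ m = g ^ n → (m : ZMod ℓ) = n := by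
    intro m n h
    rw [ZMod.natCast_eq_natCast_iff]
    refine hg.pow_inj (Nat.mod_lt _ hl.out.pos) (Nat.mod_lt _ hl.out.pos) ?_
    rwa [hg.eq_orderOf, pow_mod_orderOf, pow_mod_orderOf]
  refine ⟨MonoidHom.mk' (fun x => Multiplicative.ofAdd (i x : ZMod ℓ)) fun x y => ?_,
    fun x => ⟨fun h => ?_, fun h => ?_⟩⟩
  · rw [← ofAdd_add, ← Nat.cast_add]
    exact congrArg _ (key _ _ (by rw [pow_add, hg', hg', hg', map_mul]))
  · have := key (i x) 0 (by rw [hg', h, pow_zero])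
    simp [this]
  · have := key (i x) 1 (by rw [hg', h, pow_one])
    simp [this]

theorem exists_unit_exponents {p r ℓ q₀ e₀ : ℕ} [hp : Fact p.Prime] [hl : Fact ℓ.Prime]
    [hq : Fact q₀.Prime] (hr : p = 2 * r + 3) (hq₀ : q₀ = ℓ * e₀ + 1)
    (ε : Fin r → (CycInt p)ˣ) (φ φ' : Fin r → CycInt p →+* ZMod q₀)
    (hφ : ∀ i, φ i (cycZeta p) * φ' i (cycZeta p) = 1) {g : ZMod q₀} (hg : IsPrimitiveRoot g ℓ)
    (hdual : ∀ i j, (φ i (ε j) * φ' i (ε j)) ^ e₀ = if i = j then g else 1)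
    (u : (CycInt p)ˣ) :
    ∃ a : Fin r → ℕ, (∀ i, a i < ℓ) ∧ ∀ q e : ℕ, q.Prime → q = ℓ * e + 1 →
      ∀ φ φ' : CycInt p →+* ZMod q, φ (cycZeta p) * φ' (cycZeta p) = 1 →
        (φ u * φ' u) ^ e = ∏ i, ((φ (ε i) * φ' (ε i)) ^ e) ^ a i := by
  have hodd : Odd p := ⟨r + 1, by omega⟩
  obtain ⟨f, hf⟩ := exists_torsion_mul_prod_zpow p r hr
  have htors : ∀ {q : ℕ} (φ φ' : CycInt p →+* ZMod q), φ (cycZeta p) * φ' (cycZeta p) = 1 →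
      ∀ t ∈ CommGroup.torsion (CycInt p)ˣ, φ t * φ' t = 1 := by
    intro q φ φ' h t ht
    obtain ⟨k, hk⟩ := exists_eq_neg_cycZeta_pow hodd ht
    rw [hk, map_pow, map_pow, ← mul_pow, map_neg, map_neg, neg_mul_neg, h, one_pow]
  have hunit : ∀ {q e : ℕ}, q.Prime → q = ℓ * e + 1 → ∀ (φ φ' : CycInt p →+* ZMod q)
      (w : (CycInt p)ˣ), ((φ w * φ' w) ^ e) ^ ℓ = 1 := by
    intro q e hq hqe φ φ' w
    have : Fact q.Prime := ⟨hq⟩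
    rw [← pow_mul, show e * ℓ = q - 1 by rw [hqe, mul_comm, Nat.add_sub_cancel]]
    exact ZMod.pow_card_sub_one_eq_one
      (mul_ne_zero (w.isUnit.map φ).ne_zero (w.isUnit.map φ').ne_zero)
  let χ : Fin r → (CycInt p)ˣ →* ZMod q₀ := fun i =>
    { toFun := fun w => (φ i w * φ' i w) ^ e₀
      map_one' := by simp
      map_mul' := fun x y => by simp only [Units.val_mul, map_mul]; ring }
  choose ψ hψ using fun i => exists_dlog hg (χ i) fun x => hunit hq.out hq₀ (φ i) (φ' i) x
  obtain ⟨t, ht, a, ha, w, hw⟩ := exists_eq_mul_prod_pow_mul_pow _ f hf ψ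
    (fun i t ht => (hψ i t).1 (by
      change (φ i t * φ' i t) ^ e₀ = 1
      rw [htors _ _ (hφ i) t ht, one_pow])) ε
    (fun i j => by
      split_ifs with h
      · exact (hψ i (ε j)).2 ((hdual i j).trans (if_pos h))
      · rw [(hψ i (ε j)).1 ((hdual i j).trans (if_neg h)), toAdd_one]) u
  refine ⟨a, ha, fun q e hqp hqe φ φ' h => ?_⟩
  have h1 := htors φ φ' h t ht
  have h2 := hunit hqp hqe φ φ' w
  have h3 : (φ u * φ' u) ^ e = (φ t * φ' t) ^ e * (∏ i, ((φ (ε i) * φ' (ε i)) ^ e) ^ a i) *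
      ((φ w * φ' w) ^ e) ^ ℓ := by
    have hprod : ∏ i, ((φ (ε i) * φ' (ε i)) ^ e) ^ a i =
        ((∏ i, φ (ε i) ^ a i) * ∏ i, φ' (ε i) ^ a i) ^ e := by
      rw [← Finset.prod_mul_distrib, ← Finset.prod_pow]
      exact Finset.prod_congr rfl fun i _ => by rw [← mul_pow, pow_right_comm]
    rw [hw, hprod]
    simp only [Units.val_mul, Units.val_pow_eq_pow_val, Units.coe_prod, map_mul, map_pow, map_prod]
    ring
  rw [h3, h1, h2, one_pow, one_mul, mul_one]

theorem exists_unit_exponents_two {p r q₀ e₀ : ℕ} [hp : Fact p.Prime]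
    [hq : Fact q₀.Prime] (hr : p = 2 * r + 3) (hq₀ : q₀ = 2 * e₀ + 1) (hpe : p ∣ e₀)
    (heven : Even e₀) (ε : Fin r → (CycInt p)ˣ) (φ : Fin r → CycInt p →+* ZMod q₀)
    (hdual : ∀ i j, (φ i (ε j)) ^ e₀ = if i = j then -1 else 1) (u : (CycInt p)ˣ) :
    ∃ s < 2, ∃ b : Fin r → ℕ, (∀ i, b i < 2) ∧ ∀ q e : ℕ, q.Prime → q = 2 * e + 1 → p ∣ e →
      ∀ φ : CycInt p →+* ZMod q,
        (φ u) ^ e = ((-1) ^ e) ^ s * ∏ i, ((φ (ε i)) ^ e) ^ b i := by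
  have hodd : Odd p := ⟨r + 1, by omega⟩
  obtain ⟨f, hf⟩ := exists_torsion_mul_prod_zpow p r hr
  have htors : ∀ {q e : ℕ} (φ : CycInt p →+* ZMod q), p ∣ e → ∀ k : ℕ,
      φ ((-cycZeta p) ^ k) ^ e = ((-1) ^ e) ^ (k % 2) := by
    rintro q _ φ ⟨e, rfl⟩ k
    have h1 : φ (cycZeta p) ^ p = 1 := by
      rw [← map_pow, (cycZeta_isPrimitiveRoot p).pow_eq_one, map_one]
    rw [map_pow, map_neg, ← pow_mul, mul_comm k, pow_mul, neg_pow (φ _), pow_mul (φ _), h1, one_pow,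
      mul_one]
    conv_lhs => rw [← Nat.div_add_mod k 2, pow_add, pow_mul, pow_right_comm (-1), neg_one_sq,
      one_pow, one_pow, one_mul]
  have hunit : ∀ {q e : ℕ}, q.Prime → q = 2 * e + 1 → ∀ (φ : CycInt p →+* ZMod q)
      (w : (CycInt p)ˣ), (φ w ^ e) ^ 2 = 1 := by
    intro q e hq hqe φ w
    have : Fact q.Prime := ⟨hq⟩
    rw [← pow_mul, show e * 2 = q - 1 by rw [hqe, mul_comm, Nat.add_sub_cancel]]
    exact ZMod.pow_card_sub_one_eq_one (w.isUnit.map φ).ne_zero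
  have hg : IsPrimitiveRoot (-1 : ZMod q₀) 2 := IsPrimitiveRoot.neg_one q₀ (by omega)
  let χ : Fin r → (CycInt p)ˣ →* ZMod q₀ := fun i =>
    { toFun := fun w => φ i w ^ e₀
      map_one' := by simp
      map_mul' := fun x y => by simp only [Units.val_mul, map_mul]; ring }
  choose ψ hψ using fun i => exists_dlog hg (χ i) fun x => hunit hq.out hq₀ (φ i) x
  obtain ⟨t, ht, b, hb, w, hw⟩ := exists_eq_mul_prod_pow_mul_pow (ℓ := 2) _ f hf ψ
    (fun i t ht => (hψ i t).1 (by
      change φ i t ^ e₀ = 1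
      obtain ⟨k, hk⟩ := exists_eq_neg_cycZeta_pow hodd ht
      rw [hk, htors _ hpe, heven.neg_one_pow, one_pow])) ε
    (fun i j => by
      split_ifs with h
      · exact (hψ i (ε j)).2 ((hdual i j).trans (if_pos h))
      · rw [(hψ i (ε j)).1 ((hdual i j).trans (if_neg h)), toAdd_one]) u
  obtain ⟨k, hk⟩ := exists_eq_neg_cycZeta_pow hodd ht
  refine ⟨k % 2, Nat.mod_lt _ two_pos, b, hb, fun q e hqp hqe hpe' φ => ?_⟩
  have h2 := hunit hqp hqe φ w
  have h3 : φ u ^ e = φ t ^ e * (∏ i, (φ (ε i) ^ e) ^ b i) * (φ w ^ e) ^ 2 := by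
    have hprod : ∏ i, (φ (ε i) ^ e) ^ b i = (∏ i, φ (ε i) ^ b i) ^ e := by
      rw [← Finset.prod_pow]
      exact Finset.prod_congr rfl fun i _ => by rw [pow_right_comm]
    rw [hw, hprod]
    simp only [Units.val_mul, Units.val_pow_eq_pow_val, Units.coe_prod, map_mul, map_pow, map_prod]
    ring
  rw [h3, h2, mul_one, hk, htors φ hpe']

/-- The polynomials with `lucasV (z + z⁻¹) k = z ^ k + z⁻¹ ^ k`. -/
def lucasV {R : Type*} [CommRing R] (t : R) : ℕ → R
  | 0 => 2
  | 1 => t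
  | (k + 2) => t * lucasV t (k + 1) - lucasV t k

theorem map_lucasV {R S : Type*} [CommRing R] [CommRing S] (φ : R →+* S) (t : R) (k : ℕ) :
    φ (lucasV t k) = lucasV (φ t) k := by
  induction k using Nat.twoStepInduction with
  | zero => simpa only [lucasV] using map_ofNat φ 2
  | one => simp [lucasV]
  | more k h1 h2 => simp [lucasV, h1, h2]

theorem lucasV_add {R : Type*} [CommRing R] {z z' : R} (h : z * z' = 1) (k : ℕ) :
    lucasV (z + z') k = z ^ k + z' ^ k := by
  induction k using Nat.twoStepInduction with
  | zero => norm_num [lucasV]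
  | one => simp [lucasV]
  | more k h1 h2 =>
    rw [lucasV, h1, h2]
    linear_combination (z ^ k + z' ^ k) * h

theorem sub_dvd_lucasV_sub {R : Type*} [CommRing R] (x y : R) (k : ℕ) :
    x - y ∣ lucasV x k - lucasV y k := by
  induction k using Nat.twoStepInduction with
  | zero => simp [lucasV]
  | one => simp [lucasV]
  | more k h1 h2 =>
    rw [lucasV, lucasV, show x * lucasV x (k + 1) - lucasV x k -
      (y * lucasV y (k + 1) - lucasV y k) = (x - y) * lucasV x (k + 1) +
        y * (lucasV x (k + 1) - lucasV y (k + 1)) - (lucasV x k - lucasV y k) by ring]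
    exact dvd_sub (dvd_add (dvd_mul_right _ _) (h2.mul_left _)) h1

/-- The combination `∑ cᵢ (zⁱ + z⁻ⁱ)` expressed through `t = z + z⁻¹`. -/
def realForm {R : Type*} [CommRing R] {n : ℕ} (c : Fin n → ℤ) (t : R) : R :=
  ∑ i : Fin n, (c i : R) * lucasV t (i + 1)

theorem map_realForm {R S : Type*} [CommRing R] [CommRing S] (φ : R →+* S) {n : ℕ}
    (c : Fin n → ℤ) (t : R) : φ (realForm c t) = realForm c (φ t) := by
  simp [realForm, map_lucasV]

theorem map_ThueF {R S : Type*} [CommRing R] [CommRing S] (φ : R →+* S) (X Y : R) (m : ℕ) :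
    φ (ThueF X Y m) = ThueF (φ X) (φ Y) m := by
  induction m using Nat.twoStepInduction with
  | zero => simp [ThueF]
  | one => simp [ThueF]
  | more k h1 h2 => simp [ThueF, h1, h2, map_ofNat φ 2]

/-- The element `ζ + ζ⁻¹` of `CycInt p`. -/
noncomputable def cycReal (p : ℕ) [NeZero p] : CycInt p :=
  cycZeta p + cycZeta p ^ (p - 1)

theorem cycZeta_mul_pow (p : ℕ) [NeZero p] : cycZeta p * cycZeta p ^ (p - 1) = 1 := by
  rw [← pow_succ', Nat.sub_add_cancel (NeZero.pos p), (cycZeta_isPrimitiveRoot p).pow_eq_one]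

theorem map_cycReal {p : ℕ} [NeZero p] {S : Type*} [CommRing S] (φ : CycInt p →+* S) {z z' : S}
    (hφ : φ (cycZeta p) = z) (h : z * z' = 1) : φ (cycReal p) = z + z' := by
  have h1 : z * z ^ (p - 1) = 1 := by
    rw [← hφ, ← map_pow, ← map_mul, cycZeta_mul_pow, map_one]
  rw [cycReal, map_add, map_pow, hφ]
  linear_combination z' * h1 - z ^ (p - 1) * h

/-- The sum of the `zᵏ + z⁻ᵏ`, in the form in which it is used for `p = 2 n + 1`. -/
theorem one_add_sum_lucasV {R : Type*} [CommRing R] {n : ℕ} {z z' : R}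
    (h : z * z' = 1) (hz : ∑ i ∈ Finset.range (2 * n + 1), z ^ i = 0) :
    1 + ∑ i : Fin n, lucasV (z + z') (i + 1) = 0 := by
  have hu : IsUnit (z ^ n) := (IsUnit.of_mul_eq_one _ h).pow n
  have key : ∀ m : ℕ, z ^ m * (1 + ∑ i ∈ Finset.range m, (z ^ (i + 1) + z' ^ (i + 1))) =
      ∑ i ∈ Finset.range (2 * m + 1), z ^ i := by
    intro m
    induction m with
    | zero => simp
    | succ m ih =>
      have h1 : z ^ (m + 1) * z' ^ (m + 1) = 1 := by rw [← mul_pow, h, one_pow]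
      rw [show 2 * (m + 1) + 1 = (2 * m + 1) + 1 + 1 by ring, Finset.sum_range_succ,
        Finset.sum_range_succ', Finset.sum_range_succ, pow_zero]
      simp only [pow_succ _ (_ : ℕ), ← Finset.sum_mul] at ih h1 ⊢
      linear_combination z * ih + h1
  rw [Fin.sum_univ_eq_sum_range fun i => lucasV (z + z') (i + 1)]
  simp only [lucasV_add h]
  exact (hu.mul_right_eq_zero).1 ((key n).trans hz)

theorem exists_eq_realForm_mul_unit {p n l : ℕ} [hp : Fact p.Prime] [hl : Fact l.Prime]
    (hpn : p = 2 * n + 1) (hn : 0 < n) (c : Fin n → ℤ) (ρ : ℤ)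
    (hρ : (1 + ∑ i : Fin n, lucasV (ρ : ZMod l) (i + 1)) = 0)
    (hF : ∀ (R : Type) [CommRing R] (t X Y : R), 1 + ∑ i : Fin n, lucasV t (i + 1) = 0 →
      ∏ i : Fin n, (Y - (2 + lucasV t (i + 1)) * X) = ThueF X Y n)
    (hc : ∏ i : Fin n, realForm c (lucasV (cycReal p) (i + 1)) = l ∨
      ∏ i : Fin n, realForm c (lucasV (cycReal p) (i + 1)) = -l)
    (hκ : realForm c (cycReal p) ∣ ρ - cycReal p) {X Y : ℤ}
    (hXY : ThueF X Y n = l ∨ ThueF X Y n = -l) :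
    ∃ m : Fin n, ∃ u : (CycInt p)ˣ,
      (Y : CycInt p) - (2 + lucasV (cycReal p) (m + 1)) * X = realForm c (cycReal p) * u := by
  have hζ := cycZeta_isPrimitiveRoot p
  have hsum : ∀ k : Fin n, ∑ i ∈ Finset.range p, (cycZeta p ^ (k.val + 1)) ^ i = 0 := fun k =>
    (hζ.pow_of_coprime _ (Nat.coprime_of_lt_prime (Nat.succ_ne_zero _)
      (by omega) hp.out).symm).geom_sum_eq_zero hp.out.one_lt
  have hV : ∀ k, lucasV (cycReal p) k = cycZeta p ^ k + (cycZeta p ^ (p - 1)) ^ k :=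
    lucasV_add (cycZeta_mul_pow p)
  have hrel : ∀ k : Fin n, 1 + ∑ i : Fin n, lucasV (lucasV (cycReal p) (k + 1)) (i + 1) = 0 := by
    intro k
    rw [hV]
    exact one_add_sum_lucasV (by rw [← mul_pow, cycZeta_mul_pow, one_pow]) (hpn ▸ hsum k)
  choose σ hσ using fun k => exists_ringHom_cycZeta p (hsum k)
  have hσt : ∀ k, σ k (cycReal p) = lucasV (cycReal p) (k + 1) := fun k => by
    rw [hV]
    exact map_cycReal (σ k) (hσ k) (by rw [← mul_pow, cycZeta_mul_pow, one_pow])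
  have hcomm : ∀ k m : ℕ, lucasV (lucasV (cycReal p) k) m = lucasV (lucasV (cycReal p) m) k := by
    intro k m
    rw [hV k, hV m, lucasV_add (by rw [← mul_pow, cycZeta_mul_pow, one_pow]),
      lucasV_add (by rw [← mul_pow, cycZeta_mul_pow, one_pow])]
    ring
  have hπl : realForm c (cycReal p) ∣ (l : CycInt p) := by
    have h1 : realForm c (cycReal p) ∣ ∏ i : Fin n, realForm c (lucasV (cycReal p) (i + 1)) := by
      have := Finset.dvd_prod_of_mem
        (fun i : Fin n => realForm c (lucasV (cycReal p) (i + 1))) (Finset.mem_univ ⟨0, hn⟩)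
      simpa [lucasV] using this
    rcases hc with h | h <;> rw [h] at h1
    · exact h1
    · exact (dvd_neg.1 h1)
  obtain ⟨m, hm⟩ : ∃ m : Fin n, ((Y - (2 + lucasV ρ (m + 1)) * X : ℤ) : ZMod l) = 0 := by
    have h0 : ∏ i : Fin n, ((Y : ZMod l) - (2 + lucasV (ρ : ZMod l) (i + 1)) * X) = 0 := by
      rw [hF _ _ _ _ hρ]
      have := congrArg (Int.castRingHom (ZMod l)) (a₁ := ThueF X Y n) (a₂ := 0)
      rw [← eq_intCast (Int.castRingHom (ZMod l)) X, ← eq_intCast (Int.castRingHom (ZMod l)) Y,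
        ← map_ThueF]
      rcases hXY with h | h <;> rw [h] <;> simp
    obtain ⟨m, -, hm⟩ := Finset.prod_eq_zero_iff.1 h0
    refine ⟨m, ?_⟩
    have := map_lucasV (Int.castRingHom (ZMod l)) ρ (m + 1)
    simp only [eq_intCast] at this
    push_cast
    rw [this]
    exact hm
  obtain ⟨d, hd⟩ := (ZMod.intCast_zmod_eq_zero_iff_dvd _ l).1 hm
  have hdvd : realForm c (cycReal p) ∣
      (Y : CycInt p) - (2 + lucasV (cycReal p) (m + 1)) * X := by
    have h1 : (Y : CycInt p) - (2 + lucasV (ρ : CycInt p) (m + 1)) * X = l * d := by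
      have := map_lucasV (Int.castRingHom (CycInt p)) ρ (m + 1)
      simp only [eq_intCast] at this
      rw [← this]
      exact_mod_cast congrArg (Int.cast : ℤ → CycInt p) hd
    have h2 := hκ.trans (sub_dvd_lucasV_sub (ρ : CycInt p) (cycReal p) (m + 1))
    rw [show (Y : CycInt p) - (2 + lucasV (cycReal p) (m + 1)) * X = l * d +
      (lucasV (ρ : CycInt p) (m + 1) - lucasV (cycReal p) (m + 1)) * X by
        rw [← h1]; ring]
    exact dvd_add (hπl.mul_right _) (h2.mul_right _)
  obtain ⟨u, hu⟩ := hdvd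
  have hprod : (∏ i : Fin n, realForm c (lucasV (cycReal p) (i + 1))) * ∏ i : Fin n, σ i u =
      ThueF (X : CycInt p) Y n := by
    rw [← hF _ _ _ _ (hrel m), ← Finset.prod_mul_distrib]
    refine Finset.prod_congr rfl fun k _ => ?_
    have h1 := congrArg (σ k) hu
    rw [map_mul, map_realForm, hσt] at h1
    rw [← h1]
    simp only [map_sub, map_mul, map_add, map_lucasV, hσt, map_intCast, map_ofNat, hcomm]
  have hthue : ThueF (X : CycInt p) Y n = l ∨ ThueF (X : CycInt p) Y n = -l := by
    rw [← eq_intCast (Int.castRingHom (CycInt p)) X, ← eq_intCast (Int.castRingHom (CycInt p)) Y,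
        ← map_ThueF]
    rcases hXY with h | h <;> rw [h] <;> simp
  have hl0 : (l : CycInt p) ≠ 0 := Nat.cast_ne_zero.2 hl.out.ne_zero
  have hunit : ∏ i : Fin n, σ i u = 1 ∨ ∏ i : Fin n, σ i u = -1 := by
    rcases hc with h | h <;> rcases hthue with h' | h' <;> rw [h, h'] at hprod
    · exact Or.inl (mul_left_cancel₀ hl0 (by linear_combination hprod))
    · exact Or.inr (mul_left_cancel₀ hl0 (by linear_combination hprod))
    · exact Or.inr (mul_left_cancel₀ hl0 (by linear_combination -hprod))
    · exact Or.inl (mul_left_cancel₀ hl0 (by linear_combination -hprod))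
  have hσ0 : σ ⟨0, hn⟩ u = u := by
    have : σ ⟨0, hn⟩ = RingHom.id _ := ringHom_ext_cycZeta (by simpa using hσ ⟨0, hn⟩)
    rw [this, RingHom.id_apply]
  have : IsUnit u := by
    rw [← hσ0]
    refine isUnit_of_dvd_unit (Finset.dvd_prod_of_mem (fun i => σ i u) (Finset.mem_univ _)) ?_
    rcases hunit with h | h <;> rw [h]
    · exact isUnit_one
    · exact isUnit_one.neg
  exact ⟨m, this.unit, hu⟩

theorem lucasV_zero {R : Type*} [CommRing R] (t : R) : lucasV t 0 = 2 := rfl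

theorem lucasV_mul_lucasV {R : Type*} [CommRing R] (t : R) (i j : ℕ) :
    lucasV t i * lucasV t (i + j) = lucasV t (2 * i + j) + lucasV t j := by
  induction i using Nat.twoStepInduction generalizing j with
  | zero => simp [lucasV]; ring
  | one =>
    rw [show 2 * 1 + j = j + 2 by ring, lucasV, lucasV, add_comm 1 j]; ring
  | more i h1 h2 =>
    have e1 := h2 (j + 1)
    have e2 := h1 (j + 2)
    have e3 : lucasV t (2 * (i + 1) + (j + 1) + 1) =
        t * lucasV t (2 * (i + 1) + (j + 1)) - lucasV t (2 * i + (j + 2)) := by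
      rw [show 2 * (i + 1) + (j + 1) + 1 = (2 * i + j + 2) + 2 by ring, lucasV,
        show 2 * (i + 1) + (j + 1) = 2 * i + j + 2 + 1 by ring,
        show 2 * i + (j + 2) = 2 * i + j + 2 by ring]
    have e4 : lucasV t (j + 2) = t * lucasV t (j + 1) - lucasV t j := rfl
    rw [show i + 1 + (j + 1) = i + j + 2 by ring] at e1
    rw [show i + (j + 2) = i + j + 2 by ring] at e2
    rw [show i + 2 + j = i + j + 2 by ring,
      show 2 * (i + 2) + j = 2 * (i + 1) + (j + 1) + 1 by ring, e3,
      show lucasV t (i + 2) = t * lucasV t (i + 1) - lucasV t i from rfl]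
    linear_combination t * e1 - e2 - e4

theorem lucasV_cycReal (p : ℕ) [NeZero p] (k : ℕ) :
    lucasV (cycReal p) k = cycZeta p ^ k + (cycZeta p ^ (p - 1)) ^ k :=
  lucasV_add (cycZeta_mul_pow p) k

theorem lucasV_lucasV_cycReal (p : ℕ) [NeZero p] (k m : ℕ) :
    lucasV (lucasV (cycReal p) k) m = lucasV (cycReal p) (k * m) := by
  rw [lucasV_cycReal, lucasV_add (by rw [← mul_pow, cycZeta_mul_pow, one_pow]), lucasV_cycReal,
    pow_mul, pow_mul]

theorem lucasV_cycReal_congr {p : ℕ} [NeZero p] {a b : ℕ}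
    (h : a % p = b % p ∨ (a + b) % p = 0) : lucasV (cycReal p) a = lucasV (cycReal p) b := by
  have hp : cycZeta p ^ p = 1 := (cycZeta_isPrimitiveRoot p).pow_eq_one
  have hp' : (cycZeta p ^ (p - 1)) ^ p = 1 := by rw [pow_right_comm, hp, one_pow]
  rw [lucasV_cycReal, lucasV_cycReal]
  rcases h with h | h
  · rw [pow_eq_pow_mod a hp, pow_eq_pow_mod b hp, pow_eq_pow_mod a hp', pow_eq_pow_mod b hp', h]
  · have h1 (k : ℕ) : cycZeta p ^ k * (cycZeta p ^ (p - 1)) ^ k = 1 := by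
      rw [← mul_pow, cycZeta_mul_pow, one_pow]
    have h2 : cycZeta p ^ a * cycZeta p ^ b = 1 := by
      rw [← pow_add, pow_eq_pow_mod _ hp, h, pow_zero]
    have e1 : (cycZeta p ^ (p - 1)) ^ b = cycZeta p ^ a := by
      linear_combination (-(cycZeta p ^ (p - 1)) ^ b) * h2 + cycZeta p ^ a * h1 b
    have e2 : (cycZeta p ^ (p - 1)) ^ a = cycZeta p ^ b := by
      linear_combination (-(cycZeta p ^ (p - 1)) ^ a) * h2 + cycZeta p ^ b * h1 a
    rw [e1, e2, add_comm]

theorem one_add_sum_lucasV_cycReal {p n : ℕ} [hp : Fact p.Prime] (h : p = 2 * n + 1) :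
    1 + ∑ i : Fin n, lucasV (cycReal p) (i + 1) = 0 :=
  one_add_sum_lucasV (cycZeta_mul_pow p)
    (h ▸ (cycZeta_isPrimitiveRoot p).geom_sum_eq_zero hp.out.one_lt)

instance fact_prime_seven : Fact (Nat.Prime 7) := ⟨by norm_num⟩

instance fact_prime_eleven : Fact (Nat.Prime 11) := ⟨by norm_num⟩

instance fact_prime_thirteen : Fact (Nat.Prime 13) := ⟨by norm_num⟩

theorem prod_eq_ThueF_seven (R : Type) [CommRing R] (t X Y : R)
    (h : 1 + ∑ i : Fin 3, lucasV t (i + 1) = 0) :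
    ∏ i : Fin 3, (Y - (2 + lucasV t (i + 1)) * X) = ThueF X Y 3 := by
  simp only [Fin.sum_univ_succ, Fin.prod_univ_succ, Fin.val_succ, Finset.univ_eq_empty,
    Finset.sum_empty, Finset.prod_empty, lucasV, ThueF] at h ⊢
  linear_combination
    (
      -t ^ 3 * X ^ 3 - t ^ 2 * X ^ 3 + t ^ 2 * X ^ 2 * Y + 2 * t * X ^ 3 - X ^ 3 + 2 * X ^ 2 *
      Y - X * Y ^ 2) * h

theorem prod_eq_ThueF_eleven (R : Type) [CommRing R] (t X Y : R)
    (h : 1 + ∑ i : Fin 5, lucasV t (i + 1) = 0) :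
    ∏ i : Fin 5, (Y - (2 + lucasV t (i + 1)) * X) = ThueF X Y 5 := by
  simp only [Fin.sum_univ_succ, Fin.prod_univ_succ, Fin.val_succ, Finset.univ_eq_empty,
    Finset.sum_empty, Finset.prod_empty, lucasV, ThueF] at h ⊢
  linear_combination
    (
      -t ^ 10 * X ^ 5 - t ^ 9 * X ^ 5 + t ^ 9 * X ^ 4 * Y + 9 * t ^ 8 * X ^ 5 + 6 * t ^ 7 * X ^
      5 - 5 * t ^ 7 * X ^ 4 * Y - t ^ 7 * X ^ 3 * Y ^ 2 - 30 * t ^ 6 * X ^ 5 + t ^ 6 * X ^ 4 *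
      Y - 11 * t ^ 5 * X ^ 5 + 4 * t ^ 5 * X ^ 4 * Y + 6 * t ^ 5 * X ^ 3 * Y ^ 2 + 42 * t ^ 4 *
      X ^ 5 + 4 * t ^ 4 * X ^ 4 * Y - 6 * t ^ 4 * X ^ 3 * Y ^ 2 + t ^ 4 * X ^ 2 * Y ^ 3 + 7 * t
      ^ 3 * X ^ 5 + 7 * t ^ 3 * X ^ 4 * Y - 10 * t ^ 3 * X ^ 3 * Y ^ 2 - 20 * t ^ 2 * X ^ 5 -
      20 * t ^ 2 * X ^ 4 * Y + 18 * t ^ 2 * X ^ 3 * Y ^ 2 - 3 * t ^ 2 * X ^ 2 * Y ^ 3 - 3 * t *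
      X ^ 5 - 3 * t * X ^ 4 * Y + 3 * t * X ^ 3 * Y ^ 2 + X ^ 5 + 17 * X ^ 4 * Y - 21 * X ^ 3 *
      Y ^ 2 + 8 * X ^ 2 * Y ^ 3 - X * Y ^ 4) * h

theorem prod_eq_ThueF_thirteen (R : Type) [CommRing R] (t X Y : R)
    (h : 1 + ∑ i : Fin 6, lucasV t (i + 1) = 0) :
    ∏ i : Fin 6, (Y - (2 + lucasV t (i + 1)) * X) = ThueF X Y 6 := by
  simp only [Fin.sum_univ_succ, Fin.prod_univ_succ, Fin.val_succ, Finset.univ_eq_empty,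
    Finset.sum_empty, Finset.prod_empty, lucasV, ThueF] at h ⊢
  linear_combination
    (
      t ^ 15 * X ^ 6 + t ^ 14 * X ^ 6 - t ^ 14 * X ^ 5 * Y - 14 * t ^ 13 * X ^ 6 - 11 * t ^ 12
      * X ^ 6 + 10 * t ^ 12 * X ^ 5 * Y + t ^ 12 * X ^ 4 * Y ^ 2 + 80 * t ^ 11 * X ^ 6 - t ^ 11
      * X ^ 5 * Y + 46 * t ^ 10 * X ^ 6 - 34 * t ^ 10 * X ^ 5 * Y - 11 * t ^ 10 * X ^ 4 * Y ^ 2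
      - 235 * t ^ 9 * X ^ 6 + 6 * t ^ 9 * X ^ 4 * Y ^ 2 - t ^ 9 * X ^ 3 * Y ^ 3 - 90 * t ^ 8 *
      X ^ 6 + 35 * t ^ 8 * X ^ 5 * Y + 46 * t ^ 8 * X ^ 4 * Y ^ 2 + 364 * t ^ 7 * X ^ 6 + 43 *
      t ^ 7 * X ^ 5 * Y - 48 * t ^ 7 * X ^ 4 * Y ^ 2 + 8 * t ^ 7 * X ^ 3 * Y ^ 3 + 83 * t ^ 6 *
      X ^ 6 + 31 * t ^ 6 * X ^ 5 * Y - 85 * t ^ 6 * X ^ 4 * Y ^ 2 - t ^ 6 * X ^ 3 * Y ^ 3 - 266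
      * t ^ 5 * X ^ 6 - 162 * t ^ 5 * X ^ 5 * Y + 142 * t ^ 5 * X ^ 4 * Y ^ 2 - 28 * t ^ 5 * X
      ^ 3 * Y ^ 3 + t ^ 5 * X ^ 2 * Y ^ 4 - 38 * t ^ 4 * X ^ 6 - 58 * t ^ 4 * X ^ 5 * Y + 56 *
      t ^ 4 * X ^ 4 * Y ^ 2 + 5 * t ^ 4 * X ^ 3 * Y ^ 3 + 59 * t ^ 3 * X ^ 6 + 201 * t ^ 3 * X
      ^ 5 * Y - 178 * t ^ 3 * X ^ 4 * Y ^ 2 + 47 * t ^ 3 * X ^ 3 * Y ^ 3 - 4 * t ^ 3 * X ^ 2 *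
      Y ^ 4 + 15 * t ^ 2 * X ^ 6 + 5 * t ^ 2 * X ^ 5 * Y + 2 * t ^ 2 * X ^ 4 * Y ^ 2 - 6 * t ^
      2 * X ^ 3 * Y ^ 3 + 3 * t * X ^ 6 - 63 * t * X ^ 5 * Y + 66 * t * X ^ 4 * Y ^ 2 - 24 * t
      * X ^ 3 * Y ^ 3 + 3 * t * X ^ 2 * Y ^ 4 + X ^ 6 - 21 * X ^ 5 * Y + 38 * X ^ 4 * Y ^ 2 -
      28 * X ^ 3 * Y ^ 3 + 9 * X ^ 2 * Y ^ 4 - X * Y ^ 5) * h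

theorem realForm_dvd_617_seven : realForm ![2, 9, 5] (cycReal 7) ∣
    (254 : ℤ) - cycReal 7 := by
  have h := one_add_sum_lucasV_cycReal (p := 7) (n := 3) rfl
  generalize cycReal 7 = t at h ⊢
  refine ⟨realForm ![-15, 16, -1] t, ?_⟩
  simp [realForm, Fin.sum_univ_succ, lucasV] at h ⊢
  linear_combination
    (
      5 * t ^ 3 - 76 * t ^ 2 - 11 * t + 322) * h

theorem prod_realForm_617_seven :
    ∏ i : Fin 3, realForm ![2, 9, 5] (lucasV (cycReal 7) (i + 1)) = 617 := by
  have hs := one_add_sum_lucasV_cycReal (p := 7) (n := 3) rfl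
  simp [Fin.prod_univ_succ, realForm, Fin.sum_univ_succ, lucasV_lucasV_cycReal] at hs ⊢
  have f4 := lucasV_cycReal_congr (p := 7) (a := 4) (b := 3) (by decide)
  have f5 := lucasV_cycReal_congr (p := 7) (a := 5) (b := 2) (by decide)
  have f6 := lucasV_cycReal_congr (p := 7) (a := 6) (b := 1) (by decide)
  have f9 := lucasV_cycReal_congr (p := 7) (a := 9) (b := 2) (by decide)
  have m (i j : ℕ) := lucasV_mul_lucasV (cycReal 7) i j
  have m11 := m 1 0
  have m12 := m 1 1
  have m13 := m 1 2
  have m22 := m 2 0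
  have m23 := m 2 1
  have m33 := m 3 0
  simp only [Nat.reduceAdd, Nat.reduceMul, f4, f5, f6, f9, lucasV_zero] at m11 m12 m13 m22 m23 m33 ⊢
  clear m f4 f5 f6 f9
  generalize lucasV (cycReal 7) = T at *
  have e2 : (2 * T 1 + 9 * T 2 + 5 * T 3) *
      (5 * T 1 + 2 * T 2 + 9 * T 3) =
      39 * T 1 - 2 * T 2 - 36 * T 3 := by
    linear_combination
      10 * m11 + 49 * m12 + 43 * m13 + 18 * m22 + 91 * m23 + 45 * m33 + 146 * hs
  have e3 : (39 * T 1 - 2 * T 2 - 36 * T 3) *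
      (9 * T 1 + 5 * T 2 + 2 * T 3) =
      -617 * T 1 - 617 * T 2 - 617 * T 3 := by
    linear_combination
      351 * m11 + 177 * m12 - 246 * m13 - 10 * m22 - 184 * m23 - 72 * m33 + 538 * hs
  linear_combination
      e2 * ((9 * T 1 + 5 * T 2 + 2 * T 3)) + e3 - 617 * hs

theorem realForm_dvd_657931_seven : realForm ![91, 12, 11] (cycReal 7) ∣
    (355206 : ℤ) - cycReal 7 := by
  have h := one_add_sum_lucasV_cycReal (p := 7) (n := 3) rfl
  generalize cycReal 7 = t at h ⊢
  refine ⟨realForm ![3384, 2829, -589] t, ?_⟩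
  simp [realForm, Fin.sum_univ_succ, lucasV] at h ⊢
  linear_combination
    (
      6479 * t ^ 3 - 30530 * t ^ 2 - 12959 * t - 219414) * h

theorem prod_realForm_657931_seven :
    ∏ i : Fin 3, realForm ![91, 12, 11] (lucasV (cycReal 7) (i + 1)) = 657931 := by
  have hs := one_add_sum_lucasV_cycReal (p := 7) (n := 3) rfl
  simp [Fin.prod_univ_succ, realForm, Fin.sum_univ_succ, lucasV_lucasV_cycReal] at hs ⊢
  have f4 := lucasV_cycReal_congr (p := 7) (a := 4) (b := 3) (by decide)
  have f5 := lucasV_cycReal_congr (p := 7) (a := 5) (b := 2) (by decide)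
  have f6 := lucasV_cycReal_congr (p := 7) (a := 6) (b := 1) (by decide)
  have f9 := lucasV_cycReal_congr (p := 7) (a := 9) (b := 2) (by decide)
  have m (i j : ℕ) := lucasV_mul_lucasV (cycReal 7) i j
  have m11 := m 1 0
  have m12 := m 1 1
  have m13 := m 1 2
  have m22 := m 2 0
  have m23 := m 2 1
  have m33 := m 3 0
  simp only [Nat.reduceAdd, Nat.reduceMul, f4, f5, f6, f9, lucasV_zero] at m11 m12 m13 m22 m23 m33 ⊢
  clear m f4 f5 f6 f9
  generalize lucasV (cycReal 7) = T at *
  have e2 : (91 * T 1 + 12 * T 2 + 11 * T 3) *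
      (11 * T 1 + 91 * T 2 + 12 * T 3) =
      5240 * T 1 - 1091 * T 2 + 6268 * T 3 := by
    linear_combination
      1001 * m11 + 8413 * m12 + 1213 * m13 + 1092 * m22 + 1145 * m23 + 132 * m33 + 4450 * hs
  have e3 : (5240 * T 1 - 1091 * T 2 + 6268 * T 3) *
      (12 * T 1 + 11 * T 2 + 91 * T 3) =
      -657931 * T 1 - 657931 * T 2 - 657931 * T 3 := by
    linear_combination
      62880 * m11 + 44548 * m12 + 552056 * m13 - 12001 * m22 - 30333 * m23 + 570388 * m33 +
      1242534 * hs
  linear_combination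
      e2 * ((12 * T 1 + 11 * T 2 + 91 * T 3)) + e3 - 657931 * hs

theorem realForm_dvd_617_eleven : realForm ![4, 1, 1, 1, 2] (cycReal 11) ∣
    (517 : ℤ) - cycReal 11 := by
  have h := one_add_sum_lucasV_cycReal (p := 11) (n := 5) rfl
  generalize cycReal 11 = t at h ⊢
  refine ⟨realForm ![74, 12, -65, -49, -13] t, ?_⟩
  simp [realForm, Fin.sum_univ_succ, lucasV] at h ⊢
  linear_combination
    (
      26 * t ^ 5 + 85 * t ^ 4 - 49 * t ^ 3 - 429 * t ^ 2 - 210 * t + 517) * h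

theorem prod_realForm_617_eleven :
    ∏ i : Fin 5, realForm ![4, 1, 1, 1, 2] (lucasV (cycReal 11) (i + 1)) = -617 := by
  have hs := one_add_sum_lucasV_cycReal (p := 11) (n := 5) rfl
  simp [Fin.prod_univ_succ, realForm, Fin.sum_univ_succ, lucasV_lucasV_cycReal] at hs ⊢
  have f6 := lucasV_cycReal_congr (p := 11) (a := 6) (b := 5) (by decide)
  have f7 := lucasV_cycReal_congr (p := 11) (a := 7) (b := 4) (by decide)
  have f8 := lucasV_cycReal_congr (p := 11) (a := 8) (b := 3) (by decide)
  have f9 := lucasV_cycReal_congr (p := 11) (a := 9) (b := 2) (by decide)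
  have f10 := lucasV_cycReal_congr (p := 11) (a := 10) (b := 1) (by decide)
  have f12 := lucasV_cycReal_congr (p := 11) (a := 12) (b := 1) (by decide)
  have f15 := lucasV_cycReal_congr (p := 11) (a := 15) (b := 4) (by decide)
  have f16 := lucasV_cycReal_congr (p := 11) (a := 16) (b := 5) (by decide)
  have f20 := lucasV_cycReal_congr (p := 11) (a := 20) (b := 2) (by decide)
  have f25 := lucasV_cycReal_congr (p := 11) (a := 25) (b := 3) (by decide)
  have m (i j : ℕ) := lucasV_mul_lucasV (cycReal 11) i j
  have m11 := m 1 0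
  have m12 := m 1 1
  have m13 := m 1 2
  have m14 := m 1 3
  have m15 := m 1 4
  have m22 := m 2 0
  have m23 := m 2 1
  have m24 := m 2 2
  have m25 := m 2 3
  have m33 := m 3 0
  have m34 := m 3 1
  have m35 := m 3 2
  have m44 := m 4 0
  have m45 := m 4 1
  have m55 := m 5 0
  simp only [Nat.reduceAdd, Nat.reduceMul, f6, f7, f8, f9, f10, f12, f15, f16, f20, f25,
    lucasV_zero] at m11 m12 m13 m14 m15 m22 m23 m24 m25 m33 m34 m35 m44 m45 m55 ⊢
  clear m f6 f7 f8 f9 f10 f12 f15 f16 f20 f25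
  generalize lucasV (cycReal 11) = T at *
  have e2 : (4 * T 1 + 1 * T 2 + 1 * T 3 + 1 * T 4 + 2 * T 5) *
      (2 * T 1 + 4 * T 2 + 1 * T 3 + 1 * T 4 + 1 * T 5) =
      -2 * T 1 - 7 * T 2 + 5 * T 3 - 3 * T 4 - 7 * T 5 := by
    linear_combination
      8 * m11 + 18 * m12 + 6 * m13 + 6 * m14 + 8 * m15 + 4 * m22 + 5 * m23 + 5 * m24 + 9 * m25
      + 1 * m33 + 2 * m34 + 3 * m35 + 1 * m44 + 3 * m45 + 2 * m55 + 32 * hs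
  have e3 : (-2 * T 1 - 7 * T 2 + 5 * T 3 - 3 * T 4 - 7 * T 5) *
      (1 * T 1 + 1 * T 2 + 4 * T 3 + 2 * T 4 + 1 * T 5) =
      -54 * T 1 - 58 * T 2 - 55 * T 3 - 31 * T 4 - 32 * T 5 := by
    linear_combination
      -2 * m11 - 9 * m12 - 3 * m13 - 7 * m14 - 9 * m15 - 7 * m22 - 23 * m23 - 17 * m24 - 14 *
      m25 + 20 * m33 - 2 * m34 - 23 * m35 - 6 * m44 - 17 * m45 - 7 * m55 - 4 * hs
  have e4 : (-54 * T 1 - 58 * T 2 - 55 * T 3 - 31 * T 4 - 32 * T 5) *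
      (1 * T 1 + 2 * T 2 + 1 * T 3 + 4 * T 4 + 1 * T 5) =
      -14 * T 1 + 59 * T 2 + 16 * T 3 + 78 * T 4 - 88 * T 5 := by
    linear_combination
      -54 * m11 - 166 * m12 - 109 * m13 - 247 * m14 - 86 * m15 - 116 * m22 - 168 * m23 - 294 *
      m24 - 122 * m25 - 55 * m33 - 251 * m34 - 87 * m35 - 124 * m44 - 159 * m45 - 32 * m55 -
      762 * hs
  have e5 : (-14 * T 1 + 59 * T 2 + 16 * T 3 + 78 * T 4 - 88 * T 5) *
      (1 * T 1 + 1 * T 2 + 2 * T 3 + 1 * T 4 + 4 * T 5) =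
      617 * T 1 + 617 * T 2 + 617 * T 3 + 617 * T 4 + 617 * T 5 := by
    linear_combination
      -14 * m11 + 45 * m12 - 12 * m13 + 64 * m14 - 144 * m15 + 59 * m22 + 134 * m23 + 137 * m24
      + 148 * m25 + 32 * m33 + 172 * m34 - 112 * m35 + 78 * m44 + 224 * m45 - 352 * m55 - 394 *
      hs
  linear_combination
      e2 * ((1 * T 1 + 1 * T 2 + 4 * T 3 + 2 * T 4 + 1 * T 5) * (1 * T 1 + 2 * T 2 + 1 * T 3 +
      4 * T 4 + 1 * T 5) * (1 * T 1 + 1 * T 2 + 2 * T 3 + 1 * T 4 + 4 * T 5)) + e3 * ((1 * T 1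
      + 2 * T 2 + 1 * T 3 + 4 * T 4 + 1 * T 5) * (1 * T 1 + 1 * T 2 + 2 * T 3 + 1 * T 4 + 4 * T
      5)) + e4 * ((1 * T 1 + 1 * T 2 + 2 * T 3 + 1 * T 4 + 4 * T 5)) + e5 + 617 * hs

theorem realForm_dvd_657931_thirteen : realForm ![0, 6, 6, 0, 8, 3] (cycReal 13) ∣
    (572653 : ℤ) - cycReal 13 := by
  have h := one_add_sum_lucasV_cycReal (p := 13) (n := 6) rfl
  generalize cycReal 13 = t at h ⊢
  refine ⟨realForm ![68603, 47046, 84383, 41526, 80609, 54171] t, ?_⟩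
  simp [realForm, Fin.sum_univ_succ, lucasV] at h ⊢
  linear_combination
    (
      -162513 * t ^ 6 - 512682 * t ^ 5 + 880823 * t ^ 4 + 2422477 * t ^ 3 - 1800096 * t ^ 2 -
      1830716 * t + 1576223) * h

theorem prod_realForm_657931_thirteen :
    ∏ i : Fin 6, realForm ![0, 6, 6, 0, 8, 3] (lucasV (cycReal 13) (i + 1)) = -657931 := by
  have hs := one_add_sum_lucasV_cycReal (p := 13) (n := 6) rfl
  simp [Fin.prod_univ_succ, realForm, Fin.sum_univ_succ, lucasV_lucasV_cycReal] at hs ⊢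
  have f7 := lucasV_cycReal_congr (p := 13) (a := 7) (b := 6) (by decide)
  have f8 := lucasV_cycReal_congr (p := 13) (a := 8) (b := 5) (by decide)
  have f9 := lucasV_cycReal_congr (p := 13) (a := 9) (b := 4) (by decide)
  have f10 := lucasV_cycReal_congr (p := 13) (a := 10) (b := 3) (by decide)
  have f11 := lucasV_cycReal_congr (p := 13) (a := 11) (b := 2) (by decide)
  have f12 := lucasV_cycReal_congr (p := 13) (a := 12) (b := 1) (by decide)
  have f15 := lucasV_cycReal_congr (p := 13) (a := 15) (b := 2) (by decide)
  have f18 := lucasV_cycReal_congr (p := 13) (a := 18) (b := 5) (by decide)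
  have f20 := lucasV_cycReal_congr (p := 13) (a := 20) (b := 6) (by decide)
  have f24 := lucasV_cycReal_congr (p := 13) (a := 24) (b := 2) (by decide)
  have f25 := lucasV_cycReal_congr (p := 13) (a := 25) (b := 1) (by decide)
  have f30 := lucasV_cycReal_congr (p := 13) (a := 30) (b := 4) (by decide)
  have f36 := lucasV_cycReal_congr (p := 13) (a := 36) (b := 3) (by decide)
  have m (i j : ℕ) := lucasV_mul_lucasV (cycReal 13) i j
  have m11 := m 1 0
  have m12 := m 1 1
  have m13 := m 1 2
  have m14 := m 1 3
  have m15 := m 1 4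
  have m16 := m 1 5
  have m22 := m 2 0
  have m23 := m 2 1
  have m24 := m 2 2
  have m25 := m 2 3
  have m26 := m 2 4
  have m33 := m 3 0
  have m34 := m 3 1
  have m35 := m 3 2
  have m36 := m 3 3
  have m44 := m 4 0
  have m45 := m 4 1
  have m46 := m 4 2
  have m55 := m 5 0
  have m56 := m 5 1
  have m66 := m 6 0
  simp only [Nat.reduceAdd, Nat.reduceMul, f7, f8, f9, f10, f11, f12, f15, f18, f20, f24, f25, f30,
    f36, lucasV_zero]
    at m11 m12 m13 m14 m15 m16 m22 m23 m24 m25 m26 m33 m34 m35 m36 m44 m45 m46 m55 m56 m66 ⊢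
  clear m f7 f8 f9 f10 f11 f12 f15 f18 f20 f24 f25 f30 f36
  generalize lucasV (cycReal 13) = T at *
  have e2 : (6 * T 2 + 6 * T 3 + 8 * T 5 + 3 * T 6) *
      (3 * T 1 + 8 * T 3 + 6 * T 4 + 6 * T 6) =
      84 * T 1 + 52 * T 2 - 36 * T 3 + 54 * T 4 + 25 * T 5 + 21 * T 6 := by
    linear_combination
      18 * m12 + 18 * m13 + 24 * m15 + 9 * m16 + 48 * m23 + 36 * m24 + 36 * m26 + 48 * m33 + 36
      * m34 + 64 * m35 + 60 * m36 + 48 * m45 + 18 * m46 + 48 * m56 + 18 * m66 + 132 * hs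
  have e3 : (84 * T 1 + 52 * T 2 - 36 * T 3 + 54 * T 4 + 25 * T 5 + 21 * T 6) *
      (8 * T 2 + 6 * T 4 + 3 * T 5 + 6 * T 6) =
      -1063 * T 1 - 583 * T 2 - 41 * T 3 - 638 * T 4 - 466 * T 5 - 242 * T 6 := by
    linear_combination
      672 * m12 + 504 * m14 + 252 * m15 + 504 * m16 + 416 * m22 - 288 * m23 + 744 * m24 + 356 *
      m25 + 480 * m26 - 216 * m34 - 108 * m35 - 216 * m36 + 324 * m44 + 312 * m45 + 450 * m46 +
      75 * m55 + 213 * m56 + 126 * m66 + 1882 * hs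
  have e4 : (-1063 * T 1 - 583 * T 2 - 41 * T 3 - 638 * T 4 - 466 * T 5 - 242 * T 6) *
      (6 * T 1 + 3 * T 2 + 6 * T 5 + 8 * T 6) =
      7964 * T 1 + 6650 * T 2 + 2079 * T 3 + 5003 * T 4 + 6175 * T 5 - 222 * T 6 := by
    linear_combination
      -6378 * m11 - 6687 * m12 - 246 * m13 - 3828 * m14 - 9174 * m15 - 9956 * m16 - 1749 * m22
      - 123 * m23 - 1914 * m24 - 4896 * m25 - 5390 * m26 - 246 * m35 - 328 * m36 - 3828 * m45 -
      5104 * m46 - 2796 * m55 - 5180 * m56 - 1936 * m66 - 25718 * hs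
  have e5 : (7964 * T 1 + 6650 * T 2 + 2079 * T 3 + 5003 * T 4 + 6175 * T 5 - 222 * T 6) *
      (8 * T 1 + 6 * T 2 + 6 * T 3 + 3 * T 4) =
      -54052 * T 1 - 47710 * T 2 - 62238 * T 3 - 92613 * T 4 - 96949 * T 5 - 78819 * T 6 := by
    linear_combination
      63712 * m11 + 100984 * m12 + 64416 * m13 + 63916 * m14 + 49400 * m15 - 1776 * m16 + 39900
      * m22 + 52374 * m23 + 49968 * m24 + 37050 * m25 - 1332 * m26 + 12474 * m33 + 36255 * m34
      + 37050 * m35 - 1332 * m36 + 15009 * m44 + 18525 * m45 - 666 * m46 + 262190 * hs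
  have e6 : (-54052 * T 1 - 47710 * T 2 - 62238 * T 3 - 92613 * T 4 - 96949 * T 5 - 78819 * T 6) *
      (6 * T 1 + 3 * T 3 + 8 * T 4 + 6 * T 5) =
      657931 * T 1 + 657931 * T 2 + 657931 * T 3 + 657931 * T 4 + 657931 * T 5 + 657931 * T 6 := by
    linear_combination
      -324312 * m11 - 286260 * m12 - 535584 * m13 - 988094 * m14 - 906006 * m15 - 472914 * m16
      - 143130 * m23 - 381680 * m24 - 286260 * m25 - 186714 * m33 - 775743 * m34 - 664275 * m35
      - 236457 * m36 - 740904 * m44 - 1331270 * m45 - 630552 * m46 - 581694 * m55 - 472914 *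
      m56 - 3667248 * hs
  linear_combination
      e2 * ((8 * T 2 + 6 * T 4 + 3 * T 5 + 6 * T 6) * (6 * T 1 + 3 * T 2 + 6 * T 5 + 8 * T 6) *
      (8 * T 1 + 6 * T 2 + 6 * T 3 + 3 * T 4) * (6 * T 1 + 3 * T 3 + 8 * T 4 + 6 * T 5)) + e3 *
      ((6 * T 1 + 3 * T 2 + 6 * T 5 + 8 * T 6) * (8 * T 1 + 6 * T 2 + 6 * T 3 + 3 * T 4) * (6 *
      T 1 + 3 * T 3 + 8 * T 4 + 6 * T 5)) + e4 * ((8 * T 1 + 6 * T 2 + 6 * T 3 + 3 * T 4) * (6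
      * T 1 + 3 * T 3 + 8 * T 4 + 6 * T 5)) + e5 * ((6 * T 1 + 3 * T 3 + 8 * T 4 + 6 * T 5)) +
      e6 + 657931 * hs

/-- The unit `1 + ζ + ⋯ + ζ ^ (j + 1)`. -/
noncomputable def cycUnit {p r : ℕ} [hp : Fact p.Prime] (hr : p = 2 * r + 3) (j : Fin r) :
    (CycInt p)ˣ :=
  ((cycZeta_isPrimitiveRoot p).geom_sum_isUnit hp.out.two_le (j := j + 2)
    (Nat.coprime_of_lt_prime (n := j + 2) (by omega) (by omega) hp.out).symm).unit

/-- The value at `z` of a product of powers of the units `1 + ζ + ⋯ + ζ ^ (j + 1)`. -/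
def cycVal {R : Type*} [CommRing R] {r : ℕ} (b : Fin r → ℕ) (z : R) : R :=
  ∏ j : Fin r, (∑ i ∈ Finset.range (j + 2), z ^ i) ^ b j

theorem map_prod_cycUnit {p r : ℕ} [hp : Fact p.Prime] (hr : p = 2 * r + 3) (b : Fin r → ℕ)
    {S : Type*} [CommRing S] (φ : CycInt p →+* S) :
    φ ((∏ j, cycUnit hr j ^ b j : (CycInt p)ˣ) : CycInt p) = cycVal b (φ (cycZeta p)) := by
  simp [cycVal, cycUnit]

theorem geom_sum_inv_eq_zero {R : Type*} [CommRing R] {p : ℕ} (hp : 0 < p) {z z' : R}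
    (h : z * z' = 1 ∧ ∑ j ∈ Finset.range p, z ^ j = 0) : ∑ j ∈ Finset.range p, z' ^ j = 0 := by
  have h1 : z' ^ (p - 1) * ∑ j ∈ Finset.range p, z ^ j = ∑ j ∈ Finset.range p, z' ^ j := by
    rw [← Finset.sum_range_reflect (fun j => z' ^ j), Finset.mul_sum]
    refine Finset.sum_congr rfl fun j hj => ?_
    have hj' := Finset.mem_range.1 hj
    obtain ⟨k, hk⟩ : ∃ k, p - 1 = j + k := ⟨p - 1 - j, by omega⟩
    rw [hk, Nat.add_sub_cancel_left, pow_add, mul_right_comm, ← mul_pow, mul_comm z', h.1, one_pow,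
      one_mul]
  rw [← h1, h.2, mul_zero]

theorem exists_cycVal_exponents {p r ℓ q₀ e₀ : ℕ} [hp : Fact p.Prime] [hl : Fact ℓ.Prime]
    [hq : Fact q₀.Prime] (hr : p = 2 * r + 3) (hq₀ : q₀ = ℓ * e₀ + 1)
    (b : Fin r → Fin r → ℕ) (z z' : Fin r → ZMod q₀)
    (hz : ∀ i, z i * z' i = 1 ∧ ∑ j ∈ Finset.range p, z i ^ j = 0) {g : ZMod q₀}
    (hg : g ^ ℓ = 1 ∧ g ≠ 1)
    (hdual : ∀ i j, (cycVal (b j) (z i) * cycVal (b j) (z' i)) ^ e₀ = if i = j then g else 1)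
    (u : (CycInt p)ˣ) :
    ∃ a : Fin r → ℕ, (∀ i, a i < ℓ) ∧ ∀ q e : ℕ, q.Prime → q = ℓ * e + 1 → ∀ z z' : ZMod q,
      z * z' = 1 → ∀ φ φ' : CycInt p →+* ZMod q, φ (cycZeta p) = z → φ' (cycZeta p) = z' →
        (φ u * φ' u) ^ e = ∏ i, ((cycVal (b i) z * cycVal (b i) z') ^ e) ^ a i := by
  choose φ hφ using fun i => exists_ringHom_cycZeta p (hz i).2
  choose φ' hφ' using fun i => exists_ringHom_cycZeta p (geom_sum_inv_eq_zero hp.out.pos (hz i))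
  have hg' : IsPrimitiveRoot g ℓ := IsPrimitiveRoot.iff_orderOf.2 (orderOf_eq_prime hg.1 hg.2)
  obtain ⟨a, ha, h⟩ := exists_unit_exponents hr hq₀
    (fun i => ∏ j, cycUnit hr j ^ b i j) φ φ' (fun i => by rw [hφ, hφ']; exact (hz i).1) hg'
    (fun i j => by
      rw [map_prod_cycUnit, map_prod_cycUnit, hφ, hφ']
      exact hdual i j) u
  refine ⟨a, ha, fun q e hqp hqe z z' hzz φ φ' hφz hφz' => ?_⟩
  rw [h q e hqp hqe φ φ' (by rw [hφz, hφz', hzz])]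
  simp only [map_prod_cycUnit, hφz, hφz']

theorem exists_cycVal_exponents_two {p r q₀ e₀ : ℕ} [hp : Fact p.Prime]
    [hq : Fact q₀.Prime] (hr : p = 2 * r + 3) (hq₀ : q₀ = 2 * e₀ + 1) (hpe : p ∣ e₀)
    (heven : Even e₀) (b : Fin r → Fin r → ℕ) (z : Fin r → ZMod q₀)
    (hz : ∀ i, ∑ j ∈ Finset.range p, z i ^ j = 0)
    (hdual : ∀ i j, cycVal (b j) (z i) ^ e₀ = if i = j then -1 else 1) (u : (CycInt p)ˣ) :
    ∃ s < 2, ∃ a : Fin r → ℕ, (∀ i, a i < 2) ∧ ∀ q e : ℕ, q.Prime → q = 2 * e + 1 → p ∣ e →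
      ∀ φ : CycInt p →+* ZMod q,
        (φ u) ^ e = ((-1) ^ e) ^ s * ∏ i, (cycVal (b i) (φ (cycZeta p)) ^ e) ^ a i := by
  choose φ hφ using fun i => exists_ringHom_cycZeta p (hz i)
  obtain ⟨s, hs, a, ha, h⟩ := exists_unit_exponents_two hr hq₀ hpe heven
    (fun i => ∏ j, cycUnit hr j ^ b i j) φ
    (fun i j => by
      rw [map_prod_cycUnit, hφ]
      exact hdual i j) u
  refine ⟨s, hs, a, ha, fun q e hqp hqe hpe' φ => ?_⟩
  rw [h q e hqp hqe hpe' φ]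
  simp only [map_prod_cycUnit]

/-- `∏ hᵢ ^ aᵢ`, over the common length of the two lists. -/
def prodPow : List ℕ → List ℕ → ℕ
  | [], _ => 1
  | _ :: _, [] => 1
  | h :: hs, a :: as => Nat.mul (Nat.pow h a) (prodPow hs as)

theorem prodPow_ofFn (H : List ℕ) {N : ℕ} (hN : H.length ≤ N) (w : Fin N → ℕ) :
    prodPow H (List.ofFn w) = ∏ i : Fin N, H.getD i 1 ^ w i := by
  induction N generalizing H with
  | zero => obtain rfl : H = [] := List.length_eq_zero_iff.1 (by omega); rfl
  | succ N ih =>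
    cases H with
    | nil => simp [prodPow]
    | cons h H =>
      rw [List.ofFn_succ, Fin.prod_univ_succ, prodPow, ih H (by simpa using hN)]
      simp

theorem prodPow_append_of_length_le {H l : List ℕ} (h : H.length ≤ l.length) (l' : List ℕ) :
    prodPow H (l ++ l') = prodPow H l := by
  induction H generalizing l with
  | nil => simp [prodPow]
  | cons x H ih =>
    cases l with
    | nil => simp at h
    | cons a l => rw [List.cons_append, prodPow, prodPow, ih (by simpa using h)]

theorem prodPow_replicate_one_append (H l l' : List ℕ) :
    prodPow (List.replicate l.length 1 ++ H) (l ++ l') = prodPow H l' := by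
  induction l with
  | nil => simp
  | cons a l ih =>
    rw [List.length_cons, List.replicate_succ, List.cons_append, List.cons_append, prodPow, ih]
    simp

/-- A power residue condition `(y + sₘ x) ^ E ≡ P ∏ Hᵢ ^ aᵢ` modulo a prime, together with the
root of unity (and its inverse) from which it arises. -/
structure SieveRow where
  root : ℕ
  root' : ℕ
  exponent : ℕ
  slopes : List ℕ
  const : ℕ
  bases : List ℕ

/-- Test of the condition modulo `q` at the point `(x, y)` for the exponents `a`. -/
def SieveRow.check (R : SieveRow) (q m x y : ℕ) (a : List ℕ) : Bool :=
  Nat.beq (Nat.mod (Nat.pow (Nat.add y (Nat.mul (R.slopes.getD m 0) x)) R.exponent) q)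
    (Nat.mod (Nat.mul R.const (prodPow R.bases a)) q)

theorem SieveRow.check_eq_true {R : SieveRow} {q m x y : ℕ} {a : List ℕ}
    (h : ((y : ZMod q) + (R.slopes.getD m 0 : ℕ) * x) ^ R.exponent =
      (R.const : ZMod q) * (prodPow R.bases a : ℕ)) : R.check q m x y a = true := by
  rw [SieveRow.check, Nat.beq_eq]
  exact (ZMod.natCast_eq_natCast_iff' _ _ q).1 (by exact_mod_cast h)

/-- Whether all exponent vectors compatible with a list of conditions (one for each exponent, with
a bound for this exponent) pass the test `final`. -/
def sieveSearch (q m x y : ℕ) (final : List ℕ → Bool) : List (ℕ × SieveRow) → List ℕ → Bool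
  | [], acc => final acc
  | (b, R) :: steps, acc => (List.range b).all fun j =>
      (Nat.ble R.bases.length (acc.length + 1) && !R.check q m x y (acc ++ [j])) ||
        sieveSearch q m x y final steps (acc ++ [j])

theorem sieveSearch_sound {q m x y : ℕ} {final : List ℕ → Bool} :
    ∀ {steps : List (ℕ × SieveRow)} {acc w : List ℕ},
      sieveSearch q m x y final steps acc = true → List.Forall₂ (fun s j => j < s.1) steps w →
        (∀ s ∈ steps, s.2.check q m x y (acc ++ w) = true) → final (acc ++ w) = true
  | [], acc, w, h, hw, _ => by
    rw [List.forall₂_nil_left_iff.1 hw, List.append_nil]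
    exact h
  | (b, R) :: steps, acc, w, h, hw, hc => by
    obtain ⟨j, w', hj, hw', rfl⟩ := List.forall₂_cons_left_iff.1 hw
    rw [sieveSearch, List.all_eq_true] at h
    have h1 := h j (List.mem_range.2 hj)
    rw [List.append_cons] at hc ⊢
    have h2 : (Nat.ble R.bases.length (acc.length + 1) && !R.check q m x y (acc ++ [j])) =
        false := by
      by_cases hle : R.bases.length ≤ acc.length + 1
      · have h3 := hc (b, R) List.mem_cons_self
        rw [SieveRow.check, prodPow_append_of_length_le (by simpa using hle)] at h3
        rw [SieveRow.check, h3, Bool.not_true, Bool.and_false]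
      · rw [Bool.eq_false_iff.2 fun h => hle (Nat.le_of_ble_eq_true h), Bool.false_and]
    rw [h2, Bool.false_or] at h1
    exact sieveSearch_sound h1 hw' fun s hs => hc s (List.mem_cons_of_mem _ hs)

/-- The points of a Thue curve modulo `q`, with conditions on them. -/
structure SieveLevel where
  modulus : ℕ
  points : List (ℕ × ℕ)
  rows : List SieveRow

/-- Whether some point satisfies all the conditions. -/
def SieveLevel.sat (L : SieveLevel) (m : ℕ) (a : List ℕ) : Bool :=
  L.points.any fun v => L.rows.all fun R => R.check L.modulus m v.1 v.2 a

/-- Completeness of a list of points `(x, y)` with `∏ (y + sᵢ x) ≡ c` modulo `q`. -/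
def pointsComplete (q c : ℕ) (slopes : List ℕ) (points : List (ℕ × ℕ)) : Bool :=
  (List.range q).all fun x => (List.range q).all fun y =>
    !Nat.beq (Nat.mod (slopes.foldr (fun s r => Nat.mul (Nat.add y (Nat.mul s x)) r) 1) q)
      (Nat.mod c q) || points.contains (x, y)

/-- Whether each exponent vector compatible with the conditions of the level `L₀` violates the
conditions of one of the levels in `Ls`. -/
def sieveRefutes (n : ℕ) (bounds : List ℕ) (L₀ : SieveLevel) (Ls : List SieveLevel) : Bool :=
  (List.range n).all fun m => L₀.points.all fun v =>
    sieveSearch L₀.modulus m v.1 v.2 (fun a => Ls.any fun L => !L.sat m a)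
      (bounds.zip L₀.rows) []

theorem false_of_sieveRefutes {n m : ℕ} {bounds w : List ℕ} {L₀ : SieveLevel}
    {Ls : List SieveLevel} (h : sieveRefutes n bounds L₀ Ls = true) (hm : m < n)
    (hlen : bounds.length = L₀.rows.length) (hw : List.Forall₂ (fun b j => j < b) bounds w)
    (hsat : ∀ L ∈ L₀ :: Ls, ∃ v ∈ L.points, ∀ R ∈ L.rows,
      R.check L.modulus m v.1 v.2 w = true) : False := by
  obtain ⟨v, hv, hR⟩ := hsat L₀ List.mem_cons_self
  have h1 := List.all_eq_true.1 (List.all_eq_true.1 h m (List.mem_range.2 hm)) v hv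
  have h2 := sieveSearch_sound (w := w) h1
    (by
      rw [List.forall₂_iff_get] at hw ⊢
      refine ⟨by simpa [hlen] using hlen ▸ hw.1, fun i hi hi' => ?_⟩
      have h3 : i < bounds.length := by rw [List.length_zip] at hi; omega
      simpa using hw.2 i h3 hi')
    (fun s hs => hR s.2 (List.of_mem_zip hs).2)
  obtain ⟨L, hL, hL'⟩ := List.any_eq_true.1 h2
  obtain ⟨v', hv', hR'⟩ := hsat L (List.mem_cons_of_mem _ hL)
  have h3 : L.sat m w = true :=
    List.any_eq_true.2 ⟨v', hv', List.all_eq_true.2 fun R hRm => hR' R hRm⟩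
  simp [h3] at hL'

theorem mem_of_pointsComplete {q c n : ℕ} [NeZero q] {slopes : List ℕ} {points : List (ℕ × ℕ)}
    (h : pointsComplete q c slopes points = true) (hn : slopes.length = n) {x y : ZMod q}
    (hxy : ∏ i : Fin n, (y + (slopes.getD i 0 : ℕ) * x) = c) : (x.val, y.val) ∈ points := by
  have h1 := List.all_eq_true.1 (List.all_eq_true.1 h x.val (List.mem_range.2 x.val_lt)) y.val
    (List.mem_range.2 y.val_lt)
  have key : ∀ (l : List ℕ) (n : ℕ), l.length = n →
      ((l.foldr (fun s r => Nat.mul (Nat.add y.val (Nat.mul s x.val)) r) 1 : ℕ) : ZMod q) =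
        ∏ i : Fin n, (y + (l.getD i 0 : ℕ) * x) := by
    intro l
    induction l with
    | nil => rintro _ rfl; simp
    | cons s l ih =>
      rintro _ rfl
      rw [List.foldr_cons, List.length_cons, Fin.prod_univ_succ, Nat.mul_eq, Nat.cast_mul,
        ih _ rfl]
      simp
  have h2 : Nat.beq (Nat.mod (slopes.foldr
      (fun s r => Nat.mul (Nat.add y.val (Nat.mul s x.val)) r) 1) q) (Nat.mod c q) = true := by
    rw [Nat.beq_eq]
    exact (ZMod.natCast_eq_natCast_iff' _ _ q).1 ((key slopes n hn).trans hxy)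
  rw [h2, Bool.not_true, Bool.false_or] at h1
  simpa using h1

/-- The condition arises from a root of unity modulo `q`, and involves the real parts of the
units. -/
def SieveRow.IsReal (R : SieveRow) (q p ℓ : ℕ) {n r : ℕ} (c : Fin n → ℤ)
    (b : Fin r → Fin r → ℕ) : Prop :=
  ((R.root : ZMod q) * R.root' = 1 ∧ ∑ i ∈ Finset.range p, (R.root : ZMod q) ^ i = 0) ∧
    R.slopes.length = n ∧
    (∀ m : Fin n, ((R.slopes.getD m 0 : ℕ) : ZMod q) =
      -(2 + lucasV ((R.root : ZMod q) + R.root') (m + 1))) ∧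
    q = ℓ * ((q - 1) / ℓ) + 1 ∧ R.exponent = 2 * ((q - 1) / ℓ) ∧
    (R.const : ZMod q) = realForm c ((R.root : ZMod q) + R.root') ^ (2 * ((q - 1) / ℓ)) ∧
    R.bases.length ≤ r ∧
    ∀ i : Fin r, ((R.bases.getD i 1 : ℕ) : ZMod q) =
      (cycVal (b i) (R.root : ZMod q) * cycVal (b i) (R.root' : ZMod q)) ^ ((q - 1) / ℓ)

/-- The condition arises from a root of unity modulo `q`, and involves quadratic residues. -/
def SieveRow.IsQuadratic (R : SieveRow) (q p : ℕ) {n r : ℕ} (c : Fin n → ℤ)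
    (b : Fin r → Fin r → ℕ) : Prop :=
  ((R.root : ZMod q) * R.root' = 1 ∧ ∑ i ∈ Finset.range p, (R.root : ZMod q) ^ i = 0) ∧
    R.slopes.length = n ∧
    (∀ m : Fin n, ((R.slopes.getD m 0 : ℕ) : ZMod q) =
      -(2 + lucasV ((R.root : ZMod q) + R.root') (m + 1))) ∧
    q = 2 * ((q - 1) / 2) + 1 ∧ p ∣ (q - 1) / 2 ∧ R.exponent = (q - 1) / 2 ∧
    (R.const : ZMod q) = realForm c ((R.root : ZMod q) + R.root') ^ ((q - 1) / 2) ∧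
    R.bases = List.replicate r 1 ++ R.bases.drop r ∧ R.bases.length ≤ r + (r + 1) ∧
    (((R.bases.drop r).getD 0 1 : ℕ) : ZMod q) = (-1) ^ ((q - 1) / 2) ∧
    ∀ i : Fin r, (((R.bases.drop r).getD (i + 1) 1 : ℕ) : ZMod q) =
      cycVal (b i) (R.root : ZMod q) ^ ((q - 1) / 2)

instance (R : SieveRow) (q p ℓ : ℕ) {n r : ℕ} (c : Fin n → ℤ) (b : Fin r → Fin r → ℕ) :
    Decidable (R.IsReal q p ℓ c b) := by
  unfold SieveRow.IsReal; infer_instance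

instance (R : SieveRow) (q p : ℕ) {n r : ℕ} (c : Fin n → ℤ) (b : Fin r → Fin r → ℕ) :
    Decidable (R.IsQuadratic q p c b) := by
  unfold SieveRow.IsQuadratic; infer_instance

theorem SieveRow.IsReal.check {R : SieveRow} {p q ℓ n r : ℕ} [hp : Fact p.Prime] [NeZero q]
    {c : Fin n → ℤ} {b : Fin r → Fin r → ℕ} (hR : R.IsReal q p ℓ c b) {X Y : ℤ} {m : Fin n}
    {u : (CycInt p)ˣ}
    (hu : (Y : CycInt p) - (2 + lucasV (cycReal p) (m + 1)) * X = realForm c (cycReal p) * u)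
    {a : Fin r → ℕ}
    (ha : ∀ e : ℕ, q = ℓ * e + 1 → ∀ z z' : ZMod q,
      z * z' = 1 → ∀ φ φ' : CycInt p →+* ZMod q, φ (cycZeta p) = z → φ' (cycZeta p) = z' →
        (φ u * φ' u) ^ e = ∏ i, ((cycVal (b i) z * cycVal (b i) z') ^ e) ^ a i) (w : List ℕ) :
    R.check q m (X : ZMod q).val (Y : ZMod q).val (List.ofFn a ++ w) = true := by
  obtain ⟨hz, -, hs, hq, hE, hP, hlen, hH⟩ := hR
  obtain ⟨φ, hφ⟩ := exists_ringHom_cycZeta p hz.2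
  obtain ⟨φ', hφ'⟩ := exists_ringHom_cycZeta p (geom_sum_inv_eq_zero hp.out.pos hz)
  have h1 := congrArg φ hu
  have h2 := congrArg φ' hu
  simp only [map_sub, map_mul, map_add, map_lucasV, map_realForm, map_intCast, map_ofNat,
    map_cycReal φ hφ hz.1, map_cycReal φ' hφ' (z' := (R.root : ZMod q)) (by rw [mul_comm, hz.1]),
    add_comm (R.root' : ZMod q)] at h1 h2
  refine SieveRow.check_eq_true ?_
  rw [prodPow_append_of_length_le (by simpa using hlen), prodPow_ofFn _ hlen, ZMod.natCast_val,
    ZMod.natCast_val, ZMod.cast_id, ZMod.cast_id, hs, hE, hP]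
  push_cast
  simp only [hH]
  rw [← ha _ hq _ _ hz.1 φ φ' hφ hφ', pow_mul, pow_mul, ← mul_pow]
  congr 1
  linear_combination ((Y : ZMod q) - (2 + lucasV ((R.root : ZMod q) + R.root') (m + 1)) * X) * h1 +
    realForm c ((R.root : ZMod q) + R.root') * φ u * h2

theorem SieveRow.IsQuadratic.check {R : SieveRow} {p q n r : ℕ} [hp : Fact p.Prime] [NeZero q]
    {c : Fin n → ℤ} {b : Fin r → Fin r → ℕ} (hR : R.IsQuadratic q p c b) {X Y : ℤ} {m : Fin n}
    {u : (CycInt p)ˣ}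
    (hu : (Y : CycInt p) - (2 + lucasV (cycReal p) (m + 1)) * X = realForm c (cycReal p) * u)
    {s : ℕ} {a : Fin r → ℕ}
    (ha : ∀ e : ℕ, q = 2 * e + 1 → p ∣ e → ∀ φ : CycInt p →+* ZMod q,
        (φ u) ^ e = ((-1) ^ e) ^ s * ∏ i, (cycVal (b i) (φ (cycZeta p)) ^ e) ^ a i)
    {w : List ℕ} (hw : w.length = r) :
    R.check q m (X : ZMod q).val (Y : ZMod q).val (w ++ s :: List.ofFn a) = true := by
  obtain ⟨hz, -, hs, hq, hpe, hE, hP, hB, hlen, hH0, hH⟩ := hR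
  obtain ⟨φ, hφ⟩ := exists_ringHom_cycZeta p hz.2
  have h1 := congrArg φ hu
  simp only [map_sub, map_mul, map_add, map_lucasV, map_realForm, map_intCast, map_ofNat,
    map_cycReal φ hφ hz.1] at h1
  refine SieveRow.check_eq_true ?_
  subst hw
  rw [hB, prodPow_replicate_one_append, ← List.ofFn_cons, prodPow_ofFn _ (by simp; omega),
    Fin.prod_univ_succ, ZMod.natCast_val, ZMod.natCast_val, ZMod.cast_id, ZMod.cast_id, hs, hE, hP]
  push_cast
  simp only [Fin.cons_zero, Fin.cons_succ, Fin.val_zero, Fin.val_succ, hH, hH0]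
  rw [← hφ, ← ha _ hq hpe φ, hφ, ← mul_pow, ← h1]
  ring

/-- The part common to `SieveRow.IsReal` and `SieveRow.IsQuadratic`. -/
def SieveRow.IsRooted (R : SieveRow) (q p n : ℕ) : Prop :=
  ((R.root : ZMod q) * R.root' = 1 ∧ ∑ i ∈ Finset.range p, (R.root : ZMod q) ^ i = 0) ∧
    R.slopes.length = n ∧
    (∀ m : Fin n, ((R.slopes.getD m 0 : ℕ) : ZMod q) =
      -(2 + lucasV ((R.root : ZMod q) + R.root') (m + 1)))

/-- A sieve which refutes all exponent vectors of units refutes the Thue equation. -/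
theorem ThueF_ne_of_sieveRefutes {p n N : ℕ} [hp : Fact p.Prime] [hN : Fact N.Prime]
    (hpn : p = 2 * n + 1) (hn : 0 < n) (c : Fin n → ℤ) (ρ : ℤ)
    (hρ : (1 + ∑ i : Fin n, lucasV (ρ : ZMod N) (i + 1)) = 0)
    (hF : ∀ (R : Type) [CommRing R] (t X Y : R), 1 + ∑ i : Fin n, lucasV t (i + 1) = 0 →
      ∏ i : Fin n, (Y - (2 + lucasV t (i + 1)) * X) = ThueF X Y n)
    (hc : ∏ i : Fin n, realForm c (lucasV (cycReal p) (i + 1)) = N ∨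
      ∏ i : Fin n, realForm c (lucasV (cycReal p) (i + 1)) = -N)
    (hκ : realForm c (cycReal p) ∣ ρ - cycReal p) (P : ℕ → SieveRow → Prop)
    (hP : ∀ q R, P q R → R.IsRooted q p n) (bounds : List ℕ) (L₀ : SieveLevel)
    (Ls : List SieveLevel)
    (hunit : ∀ u : (CycInt p)ˣ, ∃ w, List.Forall₂ (fun b j => j < b) bounds w ∧
      ∀ q R, q.Prime → P q R → ∀ (X Y : ℤ) (m : Fin n),
        (Y : CycInt p) - (2 + lucasV (cycReal p) (m + 1)) * X = realForm c (cycReal p) * u →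
        R.check q m (X : ZMod q).val (Y : ZMod q).val w = true)
    (hprime : ∀ L ∈ L₀ :: Ls, L.modulus.Prime)
    (hrows : ∀ L ∈ L₀ :: Ls, ∀ R ∈ L.rows, P L.modulus R)
    (hpoints : ∀ L ∈ L₀ :: Ls, ∃ R ∈ L.rows,
      pointsComplete L.modulus N R.slopes L.points = true)
    (hlen : bounds.length = L₀.rows.length) (href : sieveRefutes n bounds L₀ Ls = true)
    (X Y : ℤ) : ThueF X Y n ≠ N := by
  intro hXY
  obtain ⟨m, u, hu⟩ := exists_eq_realForm_mul_unit hpn hn c ρ hρ hF hc hκ (Or.inl hXY)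
  obtain ⟨w, hw, hcheck⟩ := hunit u
  refine false_of_sieveRefutes href m.2 hlen hw fun L hL => ?_
  have hq := hprime L hL
  have : NeZero L.modulus := ⟨hq.ne_zero⟩
  obtain ⟨R, hR, hpts⟩ := hpoints L hL
  obtain ⟨hz, hs, hslope⟩ := hP _ _ (hrows L hL R hR)
  refine ⟨_, mem_of_pointsComplete hpts hs (x := (X : ZMod L.modulus)) (y := Y) ?_,
    fun R hR => hcheck _ R hq (hrows L hL R hR) X Y m hu⟩
  have h1 := hF (ZMod L.modulus) ((R.root : ZMod L.modulus) + R.root') X Y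
    (one_add_sum_lucasV hz.1 (hpn ▸ hz.2))
  have h2 := congrArg (Int.castRingHom (ZMod L.modulus)) hXY
  rw [map_ThueF] at h2
  simp only [eq_intCast, Int.cast_natCast] at h2
  rw [← h2, ← h1]
  exact Finset.prod_congr rfl fun i _ => by rw [hslope]; ring

theorem forall₂_ofFn_lt {r ℓ : ℕ} {a : Fin r → ℕ} (ha : ∀ i, a i < ℓ) :
    List.Forall₂ (fun b j => j < b) (List.replicate r ℓ) (List.ofFn a) := by
  rw [List.forall₂_iff_get]
  exact ⟨by simp, fun i _ _ => by simpa using ha _⟩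

theorem exists_check_of_real {p n r ℓ q₀ e₀ : ℕ} [hp : Fact p.Prime] [hl : Fact ℓ.Prime]
    [hq : Fact q₀.Prime] (hr : p = 2 * r + 3) (hq₀ : q₀ = ℓ * e₀ + 1) (c : Fin n → ℤ)
    (b : Fin r → Fin r → ℕ) (z z' : Fin r → ZMod q₀)
    (hz : ∀ i, z i * z' i = 1 ∧ ∑ j ∈ Finset.range p, z i ^ j = 0) {g : ZMod q₀}
    (hg : g ^ ℓ = 1 ∧ g ≠ 1)
    (hdual : ∀ i j, (cycVal (b j) (z i) * cycVal (b j) (z' i)) ^ e₀ = if i = j then g else 1)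
    (u : (CycInt p)ˣ) :
    ∃ w, List.Forall₂ (fun b j => j < b) (List.replicate r ℓ) w ∧
      ∀ q R, q.Prime → SieveRow.IsReal R q p ℓ c b → ∀ (X Y : ℤ) (m : Fin n),
        (Y : CycInt p) - (2 + lucasV (cycReal p) (m + 1)) * X = realForm c (cycReal p) * u →
        ∀ w', R.check q m (X : ZMod q).val (Y : ZMod q).val (w ++ w') = true := by
  obtain ⟨a, ha, h⟩ := exists_cycVal_exponents hr hq₀ b z z' hz hg hdual u
  refine ⟨_, forall₂_ofFn_lt ha, fun q R hq hR X Y m hu w' => ?_⟩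
  have : NeZero q := ⟨hq.ne_zero⟩
  exact hR.check hu (fun e he => h q e hq he) w'

theorem exists_check_of_quadratic {p n r q₀ e₀ : ℕ} [hp : Fact p.Prime]
    [hq : Fact q₀.Prime] (hr : p = 2 * r + 3) (hq₀ : q₀ = 2 * e₀ + 1) (hpe : p ∣ e₀)
    (heven : Even e₀) (c : Fin n → ℤ) (b : Fin r → Fin r → ℕ) (z : Fin r → ZMod q₀)
    (hz : ∀ i, ∑ j ∈ Finset.range p, z i ^ j = 0)
    (hdual : ∀ i j, cycVal (b j) (z i) ^ e₀ = if i = j then -1 else 1) (u : (CycInt p)ˣ) :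
    ∃ w', List.Forall₂ (fun b j => j < b) (2 :: List.replicate r 2) w' ∧
      ∀ q R, q.Prime → SieveRow.IsQuadratic R q p c b → ∀ (X Y : ℤ) (m : Fin n),
        (Y : CycInt p) - (2 + lucasV (cycReal p) (m + 1)) * X = realForm c (cycReal p) * u →
        ∀ w : List ℕ, w.length = r →
          R.check q m (X : ZMod q).val (Y : ZMod q).val (w ++ w') = true := by
  obtain ⟨s, hs, a, ha, h⟩ := exists_cycVal_exponents_two hr hq₀ hpe heven b z hz hdual u
  refine ⟨_, .cons hs (forall₂_ofFn_lt ha), fun q R hq hR X Y m hu w hw => ?_⟩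
  have : NeZero q := ⟨hq.ne_zero⟩
  exact hR.check hu (fun e he => h q e hq he) hw

instance fact_prime_twenty_nine : Fact (Nat.Prime 29) := ⟨by norm_num⟩

instance fact_prime_fifty_three : Fact (Nat.Prime 53) := ⟨by norm_num⟩

instance fact_prime_sixty_seven : Fact (Nat.Prime 67) := ⟨by norm_num⟩

instance fact_prime_six_hundred_seventeen : Fact (Nat.Prime 617) := ⟨by norm_num⟩

instance fact_prime_657931 : Fact (Nat.Prime 657931) := ⟨by norm_num⟩

/-- Sieving conditions modulo `29`. -/
def sieve617SevenAt29 : SieveLevel where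
  modulus := 29
  points := [(0, 2), (1, 10), (1, 11), (1, 13), (2, 2), (3, 20), (4, 6), (5, 19), (8, 7), (8, 26),
    (9, 4), (9, 8), (10, 2), (11, 1), (11, 10), (11, 15), (12, 27), (14, 11), (15, 6), (17, 6),
    (19, 10), (20, 12), (22, 11), (25, 3), (27, 0), (27, 23), (27, 25)]
  rows := [
    ⟨16, 20, 8, [20, 9, 24], 1, [16]⟩,
    ⟨24, 23, 8, [9, 24, 20], 16, [1, 16]⟩,
    ⟨7, 25, 8, [24, 20, 9], 23, [20, 20]⟩,
    ⟨16, 20, 14, [20, 9, 24], 28, [1, 1, 1, 28]⟩,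
    ⟨24, 23, 14, [9, 24, 20], 28, [1, 1, 1, 1, 28]⟩]

/-- Sieving conditions modulo `43`. -/
def sieve617SevenAt43 : SieveLevel where
  modulus := 43
  points := [(1, 34), (2, 15), (2, 17), (2, 21), (4, 37), (5, 9), (5, 20), (5, 39), (6, 32),
    (7, 42), (8, 23), (8, 28), (8, 32), (9, 23), (10, 5), (10, 21), (10, 24), (11, 9), (12, 4),
    (12, 16), (12, 40), (13, 11), (15, 42), (16, 4), (16, 8), (16, 25), (17, 15), (17, 30),
    (17, 40), (19, 3), (19, 24), (19, 25), (20, 14), (23, 11), (24, 7), (28, 15), (28, 18),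
    (28, 21), (29, 10), (29, 24), (29, 25), (30, 11), (30, 19), (30, 34), (32, 31), (34, 41),
    (35, 23), (36, 20), (37, 7), (38, 9), (39, 4), (39, 22), (39, 40), (42, 37)]
  rows := [
    ⟨41, 21, 12, [22, 26, 33], 11, [21, 21]⟩,
    ⟨4, 11, 12, [26, 33, 22], 4, [41]⟩,
    ⟨35, 16, 12, [33, 22, 26], 35, [1, 41]⟩,
    ⟨41, 21, 21, [22, 26, 33], 1, [1, 1, 42, 42]⟩,
    ⟨4, 11, 21, [26, 33, 22], 1, [1, 1, 42, 42, 42]⟩,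
    ⟨35, 16, 21, [33, 22, 26], 1, [1, 1, 42]⟩]

/-- Sieving conditions modulo `113`. -/
def sieve617SevenAt113 : SieveLevel where
  modulus := 113
  points := [(0, 87), (4, 67), (4, 78), (4, 101), (5, 38), (6, 49), (7, 37), (7, 55), (7, 56),
    (8, 25), (9, 1), (14, 49), (16, 36), (17, 107), (20, 71), (21, 7), (21, 28), (21, 70), (23, 16),
    (23, 36), (23, 63), (24, 27), (25, 45), (26, 0), (26, 52), (26, 78), (27, 99), (28, 7),
    (28, 23), (28, 110), (30, 56), (31, 11), (31, 54), (31, 90), (33, 102), (34, 43), (36, 3),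
    (37, 31), (38, 55), (39, 82), (41, 34), (41, 62), (41, 109), (42, 35), (44, 8), (45, 18),
    (45, 47), (46, 75), (47, 53), (48, 49), (50, 104), (54, 26), (55, 92), (56, 86), (59, 55),
    (61, 35), (62, 31), (63, 96), (64, 22), (64, 36), (65, 24), (66, 18), (66, 98), (66, 101),
    (68, 103), (70, 25), (70, 33), (70, 66), (72, 25), (73, 56), (76, 94), (78, 57), (78, 109),
    (78, 111), (79, 13), (80, 12), (80, 52), (80, 110), (81, 2), (82, 16), (83, 20), (83, 60),
    (83, 109), (84, 101), (87, 31), (87, 87), (87, 91), (88, 54), (90, 98), (92, 54), (92, 68),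
    (92, 112), (93, 52), (93, 89), (93, 98), (95, 40), (96, 4), (96, 50), (96, 87), (99, 78),
    (100, 110), (103, 80), (104, 16), (105, 74), (106, 7), (107, 35), (108, 83), (109, 79),
    (110, 18), (111, 41), (112, 46)]
  rows := [
    ⟨49, 30, 32, [32, 87, 102], 16, [1, 30]⟩,
    ⟨28, 109, 32, [87, 102, 32], 30, [49, 49]⟩,
    ⟨16, 106, 32, [102, 32, 87], 30, [30]⟩,
    ⟨49, 30, 56, [32, 87, 102], 112, [1, 1, 1, 1, 112]⟩,
    ⟨28, 109, 56, [87, 102, 32], 1, [1, 1, 1, 112, 112]⟩,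
    ⟨16, 106, 56, [102, 32, 87], 112, [1, 1, 1, 112]⟩]

theorem ThueF_ne_617_seven (X Y : ℤ) : ThueF X Y 3 ≠ 617 := by
  refine ThueF_ne_of_sieveRefutes (p := 7) (N := 617) rfl (by norm_num) ![2, 9, 5] 254
    (by decide +kernel) prod_eq_ThueF_seven (Or.inl (mod_cast prod_realForm_617_seven))
    realForm_dvd_617_seven
    (fun q R => SieveRow.IsReal R q 7 7 ![2, 9, 5] ![![4, 4], ![1, 3]] ∨
      SieveRow.IsQuadratic R q 7 ![2, 9, 5] ![![1, 0], ![1, 1]])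
    (fun q R h => h.elim (fun h => ⟨h.1, h.2.1, h.2.2.1⟩) fun h => ⟨h.1, h.2.1, h.2.2.1⟩)
      [7, 7, 2, 2, 2] sieve617SevenAt29
    [sieve617SevenAt43, sieve617SevenAt113]
    (fun u => ?_) (fun L hL => ?_) (by decide +kernel) (by decide +kernel) rfl
    (by decide +kernel) X Y
  · obtain ⟨w, hw, h⟩ := exists_check_of_real (p := 7) (n := 3) (r := 2) (ℓ := 7) (q₀ := 29)
      (e₀ := 4) rfl rfl
      ![2, 9, 5]
      ![![4, 4], ![1, 3]]
      ![16, 24]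
      ![20, 23]
      (by decide +kernel) (g := 16) (by decide +kernel) (by decide +kernel) u
    obtain ⟨w', hw', h'⟩ := exists_check_of_quadratic (p := 7) (n := 3) (r := 2) (q₀ := 29)
      (e₀ := 14) rfl rfl (by norm_num) (by decide) ![2, 9, 5]
      ![![1, 0], ![1, 1]] ![16, 24] (by decide +kernel) (by decide +kernel) u
    exact ⟨w ++ w', List.rel_append hw hw', fun q R hq hR X Y m hu => hR.elim
      (fun hR => h q R hq hR X Y m hu w')
      fun hR => h' q R hq hR X Y m hu w (by simpa using hw.length_eq.symm)⟩
  · simp only [List.mem_cons, List.not_mem_nil, or_false] at hL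
    rcases hL with rfl | rfl | rfl <;>
      norm_num [sieve617SevenAt29, sieve617SevenAt43, sieve617SevenAt113]

/-- Sieving conditions modulo `29`. -/
def sieve657931SevenAt29 : SieveLevel where
  modulus := 29
  points := [(0, 2), (1, 10), (1, 11), (1, 13), (2, 2), (3, 20), (4, 6), (5, 19), (8, 7), (8, 26),
    (9, 4), (9, 8), (10, 2), (11, 1), (11, 10), (11, 15), (12, 27), (14, 11), (15, 6), (17, 6),
    (19, 10), (20, 12), (22, 11), (25, 3), (27, 0), (27, 23), (27, 25)]
  rows := [
    ⟨16, 20, 8, [20, 9, 24], 16, [16]⟩,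
    ⟨24, 23, 8, [9, 24, 20], 16, [1, 16]⟩,
    ⟨7, 25, 8, [24, 20, 9], 25, [20, 20]⟩,
    ⟨16, 20, 14, [20, 9, 24], 1, [1, 1, 1, 28]⟩,
    ⟨24, 23, 14, [9, 24, 20], 28, [1, 1, 1, 1, 28]⟩]

/-- Sieving conditions modulo `43`. -/
def sieve657931SevenAt43 : SieveLevel where
  modulus := 43
  points := [(1, 27), (2, 33), (3, 27), (4, 32), (5, 23), (6, 33), (8, 11), (10, 13), (12, 26),
    (13, 8), (15, 34), (16, 38), (17, 35), (18, 33), (19, 41), (21, 15), (21, 18), (21, 29),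
    (22, 26), (24, 20), (25, 3), (25, 12), (25, 24), (28, 31), (29, 27), (30, 9), (35, 5), (36, 26),
    (38, 30), (39, 14), (40, 2), (40, 4), (40, 22)]
  rows := [
    ⟨41, 21, 12, [22, 26, 33], 35, [21, 21]⟩,
    ⟨4, 11, 12, [26, 33, 22], 1, [41]⟩,
    ⟨35, 16, 12, [33, 22, 26], 4, [1, 41]⟩,
    ⟨41, 21, 21, [22, 26, 33], 42, [1, 1, 42, 42]⟩,
    ⟨4, 11, 21, [26, 33, 22], 1, [1, 1, 42, 42, 42]⟩,
    ⟨35, 16, 21, [33, 22, 26], 42, [1, 1, 42]⟩]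

/-- Sieving conditions modulo `113`. -/
def sieve657931SevenAt113 : SieveLevel where
  modulus := 113
  points := [(0, 70), (2, 104), (4, 112), (5, 14), (7, 87), (8, 40), (11, 24), (11, 70), (11, 74),
    (13, 42), (13, 55), (13, 81), (15, 104), (16, 3), (16, 89), (16, 101), (20, 33), (20, 89),
    (20, 91), (22, 78), (24, 16), (24, 41), (24, 63), (25, 39), (25, 96), (25, 103), (26, 97),
    (27, 97), (28, 72), (28, 86), (28, 95), (29, 16), (30, 2), (31, 49), (33, 73), (34, 12),
    (35, 95), (36, 68), (37, 44), (38, 48), (39, 11), (40, 96), (42, 104), (42, 109), (42, 110),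
    (43, 0), (43, 16), (43, 86), (44, 56), (44, 108), (45, 19), (45, 103), (46, 7), (46, 21),
    (46, 89), (48, 37), (49, 29), (50, 111), (51, 31), (52, 41), (53, 28), (54, 6), (55, 25),
    (55, 42), (55, 95), (56, 92), (57, 23), (57, 41), (57, 108), (59, 96), (62, 68), (65, 105),
    (67, 110), (69, 53), (70, 70), (70, 73), (70, 94), (71, 42), (73, 66), (73, 88), (73, 98),
    (74, 59), (76, 98), (77, 97), (81, 37), (81, 57), (81, 85), (83, 46), (84, 68), (85, 47),
    (88, 23), (89, 22), (91, 32), (93, 37), (95, 108), (96, 103), (98, 43), (99, 110), (100, 69),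
    (100, 98), (100, 107), (101, 20), (102, 77), (103, 18), (104, 100), (106, 23), (106, 82),
    (106, 86), (107, 50), (109, 73), (110, 64)]
  rows := [
    ⟨49, 30, 32, [32, 87, 102], 109, [1, 30]⟩,
    ⟨28, 109, 32, [87, 102, 32], 28, [49, 49]⟩,
    ⟨16, 106, 32, [102, 32, 87], 28, [30]⟩,
    ⟨49, 30, 56, [32, 87, 102], 112, [1, 1, 1, 1, 112]⟩,
    ⟨28, 109, 56, [87, 102, 32], 112, [1, 1, 1, 112, 112]⟩,
    ⟨16, 106, 56, [102, 32, 87], 112, [1, 1, 1, 112]⟩]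

theorem ThueF_ne_657931_seven (X Y : ℤ) : ThueF X Y 3 ≠ 657931 := by
  refine ThueF_ne_of_sieveRefutes (p := 7) (N := 657931) rfl (by norm_num) ![91, 12, 11] 355206
    (by decide +kernel) prod_eq_ThueF_seven (Or.inl (mod_cast prod_realForm_657931_seven))
    realForm_dvd_657931_seven
    (fun q R => SieveRow.IsReal R q 7 7 ![91, 12, 11] ![![4, 4], ![1, 3]] ∨
      SieveRow.IsQuadratic R q 7 ![91, 12, 11] ![![1, 0], ![1, 1]])
    (fun q R h => h.elim (fun h => ⟨h.1, h.2.1, h.2.2.1⟩) fun h => ⟨h.1, h.2.1, h.2.2.1⟩)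
      [7, 7, 2, 2, 2] sieve657931SevenAt29
    [sieve657931SevenAt43, sieve657931SevenAt113]
    (fun u => ?_) (fun L hL => ?_) (by decide +kernel) (by decide +kernel) rfl
    (by decide +kernel) X Y
  · obtain ⟨w, hw, h⟩ := exists_check_of_real (p := 7) (n := 3) (r := 2) (ℓ := 7) (q₀ := 29)
      (e₀ := 4) rfl rfl
      ![91, 12, 11]
      ![![4, 4], ![1, 3]]
      ![16, 24]
      ![20, 23]
      (by decide +kernel) (g := 16) (by decide +kernel) (by decide +kernel) u
    obtain ⟨w', hw', h'⟩ := exists_check_of_quadratic (p := 7) (n := 3) (r := 2) (q₀ := 29)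
      (e₀ := 14) rfl rfl (by norm_num) (by decide) ![91, 12, 11]
      ![![1, 0], ![1, 1]] ![16, 24] (by decide +kernel) (by decide +kernel) u
    exact ⟨w ++ w', List.rel_append hw hw', fun q R hq hR X Y m hu => hR.elim
      (fun hR => h q R hq hR X Y m hu w')
      fun hR => h' q R hq hR X Y m hu w (by simpa using hw.length_eq.symm)⟩
  · simp only [List.mem_cons, List.not_mem_nil, or_false] at hL
    rcases hL with rfl | rfl | rfl <;>
      norm_num [sieve657931SevenAt29, sieve657931SevenAt43, sieve657931SevenAt113]

/-- Sieving conditions modulo `67`. -/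
def sieve617ElevenAt67 : SieveLevel where
  modulus := 67
  points := [(0, 40), (1, 45), (2, 29), (3, 51), (3, 64), (4, 54), (5, 60), (7, 22), (7, 56),
    (8, 42), (8, 61), (9, 61), (11, 44), (12, 54), (12, 66), (14, 30), (15, 20), (16, 40), (16, 43),
    (17, 18), (17, 49), (18, 26), (20, 27), (21, 11), (22, 35), (23, 29), (24, 45), (24, 66),
    (26, 3), (26, 39), (27, 0), (27, 14), (27, 27), (28, 41), (30, 4), (32, 12), (33, 2), (33, 41),
    (34, 58), (37, 38), (40, 13), (41, 9), (41, 48), (41, 54), (43, 27), (45, 19), (47, 36),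
    (47, 48), (49, 15), (49, 45), (50, 40), (51, 38), (52, 61), (54, 17), (54, 19), (54, 50),
    (56, 36), (58, 4), (58, 32), (60, 21), (61, 14), (63, 2), (63, 29)]
  rows := [
    ⟨64, 22, 12, [46, 41, 30, 27, 48], 40, [64]⟩,
    ⟨9, 15, 12, [41, 27, 48, 30, 46], 64, [1, 64]⟩,
    ⟨40, 62, 12, [30, 48, 41, 46, 27], 59, [1, 1, 64]⟩,
    ⟨14, 24, 12, [27, 30, 46, 48, 41], 64, [1, 1, 1, 64]⟩]

/-- Sieving conditions modulo `23`. -/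
def sieve617ElevenAt23 : SieveLevel where
  modulus := 23
  points := [(0, 10), (4, 10), (4, 20), (5, 3), (8, 10), (9, 7), (9, 13), (9, 21), (10, 19),
    (10, 20), (10, 21), (11, 4), (13, 0), (13, 13), (13, 16), (17, 13), (21, 2), (22, 2), (22, 3)]
  rows := [
    ⟨2, 12, 4, [7, 11, 10, 15, 17], 1, [6, 6, 8, 2]⟩,
    ⟨4, 6, 4, [11, 15, 17, 10, 7], 12, [3, 18, 6, 18]⟩,
    ⟨8, 3, 4, [10, 17, 11, 7, 15], 2, [8, 9, 1, 4]⟩,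
    ⟨16, 13, 4, [15, 10, 7, 17, 11], 3, [4, 12, 3, 3]⟩,
    ⟨9, 18, 4, [17, 7, 15, 11, 10], 1, [1, 8, 4, 9]⟩]

theorem ThueF_ne_617_eleven (X Y : ℤ) : ThueF X Y 5 ≠ 617 := by
  refine ThueF_ne_of_sieveRefutes (p := 11) (N := 617) rfl (by norm_num) ![4, 1, 1, 1, 2] 517
    (by decide +kernel) prod_eq_ThueF_eleven (Or.inr (mod_cast prod_realForm_617_eleven))
    realForm_dvd_617_eleven
    (fun q R => SieveRow.IsReal R q 11 11 ![4, 1, 1, 1, 2]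
      ![![9, 9, 10, 0], ![8, 9, 8, 5], ![6, 1, 2, 2], ![6, 3, 8, 3]])
    (fun q R h => ⟨h.1, h.2.1, h.2.2.1⟩) [11, 11, 11, 11] sieve617ElevenAt67
    [sieve617ElevenAt23]
    (fun u => ?_) (fun L hL => ?_) (by decide +kernel) (by decide +kernel) rfl
    (by decide +kernel) X Y
  · obtain ⟨w, hw, h⟩ := exists_check_of_real (p := 11) (n := 5) (r := 4) (ℓ := 11) (q₀ := 67)
      (e₀ := 6) rfl rfl
      ![4, 1, 1, 1, 2]
      ![![9, 9, 10, 0], ![8, 9, 8, 5], ![6, 1, 2, 2], ![6, 3, 8, 3]]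
      ![64, 9, 40, 14]
      ![22, 15, 62, 24]
      (by decide +kernel) (g := 64) (by decide +kernel) (by decide +kernel) u
    exact ⟨w, hw, fun q R hq hR X Y m hu => by simpa using h q R hq hR X Y m hu []⟩
  · simp only [List.mem_cons, List.not_mem_nil, or_false] at hL
    rcases hL with rfl | rfl <;>
      norm_num [sieve617ElevenAt67, sieve617ElevenAt23]

/-- Sieving conditions modulo `53`. -/
def sieve657931ThirteenAt53 : SieveLevel where
  modulus := 53
  points := [(0, 7), (0, 46), (1, 18), (2, 4), (3, 23), (4, 2), (5, 24), (6, 49), (7, 0), (7, 7),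
    (7, 21), (11, 51), (12, 40), (12, 52), (15, 3), (15, 10), (16, 27), (17, 15), (17, 46),
    (19, 43), (20, 19), (22, 48), (23, 7), (25, 33), (26, 47), (27, 6), (28, 20), (30, 46), (31, 5),
    (33, 34), (34, 10), (36, 7), (36, 38), (37, 26), (38, 43), (38, 50), (41, 1), (41, 13), (42, 2),
    (46, 0), (46, 32), (46, 46), (47, 4), (48, 29), (49, 51), (50, 30), (51, 49), (52, 35)]
  rows := [
    ⟨16, 10, 8, [25, 13, 43, 40, 38, 42], 49, [16]⟩,
    ⟨44, 47, 8, [13, 40, 42, 38, 43, 25], 42, [1, 16]⟩,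
    ⟨15, 46, 8, [43, 42, 40, 25, 13, 38], 28, [1, 1, 16]⟩,
    ⟨28, 36, 8, [40, 38, 25, 43, 42, 13], 28, [1, 1, 1, 16]⟩,
    ⟨24, 42, 8, [38, 43, 13, 42, 25, 40], 36, [1, 1, 1, 1, 16]⟩]

/-- Sieving conditions modulo `79`. -/
def sieve657931ThirteenAt79 : SieveLevel where
  modulus := 79
  points := [(1, 25), (2, 20), (2, 47), (2, 59), (3, 22), (4, 27), (4, 73), (5, 18), (6, 23),
    (7, 25), (8, 15), (8, 39), (8, 58), (9, 13), (10, 47), (11, 56), (12, 27), (13, 20), (13, 68),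
    (14, 1), (16, 24), (17, 14), (17, 16), (20, 24), (21, 4), (23, 22), (24, 47), (26, 28),
    (26, 29), (26, 70), (27, 1), (28, 63), (30, 17), (31, 6), (31, 57), (31, 73), (33, 14),
    (33, 25), (33, 65), (34, 44), (34, 49), (34, 67), (36, 19), (38, 42), (39, 68), (40, 11),
    (41, 37), (43, 60), (45, 12), (45, 30), (45, 35), (46, 14), (46, 54), (46, 65), (48, 6),
    (48, 22), (48, 73), (49, 62), (51, 16), (52, 78), (53, 9), (53, 50), (53, 51), (55, 32),
    (56, 57), (58, 75), (59, 55), (62, 63), (62, 65), (63, 55), (65, 78), (66, 11), (66, 59),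
    (67, 52), (68, 23), (69, 32), (70, 66), (71, 21), (71, 40), (71, 64), (72, 54), (73, 56),
    (74, 61), (75, 6), (75, 52), (76, 57), (77, 20), (77, 32), (77, 59), (78, 54)]
  rows := [
    ⟨18, 22, 12, [37, 59, 29, 71, 43, 66], 8, [10, 65, 64, 38, 38]⟩,
    ⟨8, 10, 12, [59, 71, 66, 43, 29, 37], 10, [21, 52, 8, 22, 8]⟩,
    ⟨65, 62, 12, [29, 66, 71, 37, 59, 43], 18, [65, 65, 67, 18, 62]⟩,
    ⟨64, 21, 12, [71, 43, 37, 29, 66, 59], 67, [10, 52, 1, 46, 62]⟩,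
    ⟨46, 67, 12, [43, 29, 59, 66, 37, 71], 1, [1, 10, 62, 52, 46]⟩,
    ⟨38, 52, 12, [66, 37, 43, 59, 71, 29], 65, [46, 67, 8, 67, 38]⟩]

theorem ThueF_ne_657931_thirteen (X Y : ℤ) : ThueF X Y 6 ≠ 657931 := by
  refine ThueF_ne_of_sieveRefutes (p := 13) (N := 657931) rfl (by norm_num) ![0, 6, 6, 0, 8, 3]
    572653
    (by decide +kernel) prod_eq_ThueF_thirteen (Or.inr (mod_cast prod_realForm_657931_thirteen))
    realForm_dvd_657931_thirteen
    (fun q R => SieveRow.IsReal R q 13 13 ![0, 6, 6, 0, 8, 3]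
      ![![8, 6, 8, 7, 2], ![3, 8, 2, 0, 10], ![5, 6, 5, 5, 7], ![10, 3, 8, 2, 5],
      ![3, 11, 10, 10, 0]])
    (fun q R h => ⟨h.1, h.2.1, h.2.2.1⟩) [13, 13, 13, 13, 13] sieve657931ThirteenAt53
    [sieve657931ThirteenAt79]
    (fun u => ?_) (fun L hL => ?_) (by decide +kernel) (by decide +kernel) rfl
    (by decide +kernel) X Y
  · obtain ⟨w, hw, h⟩ := exists_check_of_real (p := 13) (n := 6) (r := 5) (ℓ := 13) (q₀ := 53)
      (e₀ := 4) rfl rfl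
      ![0, 6, 6, 0, 8, 3]
      ![![8, 6, 8, 7, 2], ![3, 8, 2, 0, 10], ![5, 6, 5, 5, 7], ![10, 3, 8, 2, 5],
        ![3, 11, 10, 10, 0]]
      ![16, 44, 15, 28, 24]
      ![10, 47, 46, 36, 42]
      (by decide +kernel) (g := 16) (by decide +kernel) (by decide +kernel) u
    exact ⟨w, hw, fun q R hq hR X Y m hu => by simpa using h q R hq hR X Y m hu []⟩
  · simp only [List.mem_cons, List.not_mem_nil, or_false] at hL
    rcases hL with rfl | rfl <;>
      norm_num [sieve657931ThirteenAt53, sieve657931ThirteenAt79]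

theorem ThueF_neg_neg {R : Type*} [CommRing R] (X Y : R) (m : ℕ) :
    ThueF (-X) (-Y) m = (-1) ^ m * ThueF X Y m := by
  induction m using Nat.twoStepInduction with
  | zero => simp [ThueF]
  | one => simp [ThueF]; ring
  | more k h1 h2 => simp only [ThueF, h1, h2]; ring

theorem no_integer_points_on_exceptional_curves :
    (¬∃ X Y : ℤ, Y ^ 2 = 5 * X ^ 42 - 524) ∧
    (¬∃ X Y : ℤ, ThueF X Y 3 = 617) ∧
    (¬∃ X Y : ℤ, ThueF X Y 3 = -617) ∧
    (¬∃ X Y : ℤ, ThueF X Y 3 = 657931) ∧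
    (¬∃ X Y : ℤ, ThueF X Y 3 = -657931) ∧
    (¬∃ X Y : ℤ, ThueF X Y 5 = 617) ∧
    (¬∃ X Y : ℤ, ThueF X Y 5 = -617) ∧
    (¬∃ X Y : ℤ, ThueF X Y 6 = 657931) ∧
    (¬∃ X Y : ℤ, Y ^ 2 = X ^ 25 - 657931) := by
  have neg (m : ℕ) (hm : Odd m) (N : ℤ) (h : ∀ X Y : ℤ, ThueF X Y m ≠ N) :
      ¬∃ X Y : ℤ, ThueF X Y m = -N := fun ⟨X, Y, hXY⟩ =>
    h (-X) (-Y) (by rw [ThueF_neg_neg, hXY, hm.neg_one_pow]; ring)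
  exact ⟨fun ⟨X, Y, h⟩ => five_mul_pow_sub_ne_sq X Y h,
    fun ⟨X, Y, h⟩ => ThueF_ne_617_seven X Y h,
    neg 3 (by decide) 617 ThueF_ne_617_seven,
    fun ⟨X, Y, h⟩ => ThueF_ne_657931_seven X Y h,
    neg 3 (by decide) 657931 ThueF_ne_657931_seven,
    fun ⟨X, Y, h⟩ => ThueF_ne_617_eleven X Y h,
    neg 5 (by decide) 617 ThueF_ne_617_eleven,
    fun ⟨X, Y, h⟩ => ThueF_ne_657931_thirteen X Y h,
    fun ⟨X, Y, h⟩ => sq_ne_pow_twentyfive_sub X Y h⟩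
end

section
/- For each c ∈ {9, 27, 33, 81, 99}, the equation Y² = X^11 − c has no solution in integers X, Y. -/
open QuadraticAlgebra

/-- A positive definite binary quadratic form of discriminant `-D` represents a positive integer
at most `√(D / 3)`. -/
theorem exists_small_value_of_posDef_form (D : ℤ) (hD : 0 < D) (m : ℕ) :
    ∀ a b c : ℤ, 0 < a → a.toNat ≤ m → 4 * a * c - b ^ 2 = D →
      ∃ x y : ℤ, 0 < a * x ^ 2 + b * x * y + c * y ^ 2 ∧
        3 * (a * x ^ 2 + b * x * y + c * y ^ 2) ^ 2 ≤ D := by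
  induction m with
  | zero => intro a b c ha hm; omega
  | succ m ih =>
    intro a b c ha hm hdisc
    obtain ⟨t, ht₁, ht₂⟩ : ∃ t : ℤ, -a ≤ 2 * a * t + b ∧ 2 * a * t + b ≤ a := by
      refine ⟨-((b + a) / (2 * a)), ?_, ?_⟩
      · have := Int.mul_ediv_self_le (x := b + a) (k := 2 * a) (by omega)
        linarith
      · have := Int.lt_mul_ediv_self_add (x := b + a) (k := 2 * a) (by omega)
        linarith
    have hdisc' : 4 * a * (a * t ^ 2 + b * t + c) - (2 * a * t + b) ^ 2 = D := by
      linear_combination hdisc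
    by_cases hac : a ≤ a * t ^ 2 + b * t + c
    · refine ⟨1, 0, by simpa using ha, ?_⟩
      nlinarith [sq_le_sq' ht₁ ht₂, mul_le_mul_of_nonneg_left hac ha.le]
    · have hc : 0 < a * t ^ 2 + b * t + c := by
        by_contra h
        nlinarith [sq_nonneg (2 * a * t + b)]
      obtain ⟨x, y, hpos, hle⟩ := ih (a * t ^ 2 + b * t + c) (2 * a * t + b) a hc (by omega)
        (by linear_combination hdisc')
      have key : a * (y + t * x) ^ 2 + b * (y + t * x) * x + c * x ^ 2 =
          (a * t ^ 2 + b * t + c) * x ^ 2 + (2 * a * t + b) * x * y + a * y ^ 2 := by ring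
      exact ⟨y + t * x, x, by rwa [key], by rwa [key]⟩

/-- If a primitive element `α` of a quadratic order has norm an eleventh power, then some multiple
of `α` by an element of small norm `k ^ 11` is an eleventh power. -/
theorem exists_pow_eleven_eq_mul {n e : ℤ} (hD : 0 < 4 * n - e ^ 2)
    (α : QuadraticAlgebra ℤ (-n) e) {X : ℤ} (hX : 0 < X) (hα : norm α = X ^ 11)
    (hcop : IsCoprime α.im X) :
    ∃ k : ℤ, 0 < k ∧ 3 * k ^ 2 ≤ 4 * n - e ^ 2 ∧
      ∃ γ ε : QuadraticAlgebra ℤ (-n) e, γ ^ 11 = α * ε ∧ norm ε = k ^ 11 := by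
  obtain ⟨t, s, hts⟩ := hcop
  obtain ⟨p, q⟩ := α
  simp only [norm_def] at hα hts
  set r := t * p with hr
  obtain ⟨c, hc⟩ : X ∣ r ^ 2 + e * r + n := by
    refine ⟨t ^ 2 * X ^ 10 + (1 + t * q) * s * n + e * r * s, ?_⟩
    linear_combination t ^ 2 * hα - (e * r + n * (1 + t * q)) * hts
  obtain ⟨x, y, hpos, hle⟩ := exists_small_value_of_posDef_form _ hD X.toNat X (2 * r + e) c hX
    le_rfl (by linear_combination -4 * hc)
  set k := X * x ^ 2 + (2 * r + e) * x * y + c * y ^ 2 with hk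
  set γ : QuadraticAlgebra ℤ (-n) e := ⟨X * x + r * y, y⟩ with hγ
  have hnγ : norm γ = k * X := by
    simp only [norm_def, hγ, hk]
    linear_combination y ^ 2 * hc
  set α : QuadraticAlgebra ℤ (-n) e := ⟨p, q⟩ with hαdef
  have hαX : α ∣ (X : QuadraticAlgebra ℤ (-n) e) ^ 11 := by
    refine ⟨star α, ?_⟩
    rw [← algebraMap_norm_eq_mul_star, norm_def]
    simp only [hαdef, hα]
    simp
  have hlin : (q : QuadraticAlgebra ℤ (-n) e) * γ =
      y * α + X * ((q * x - s * p * y : ℤ) : QuadraticAlgebra ℤ (-n) e) := by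
    ext
    · simp [hγ, hαdef, hr]
      linear_combination p * y * hts
    · simp [hγ, hαdef]
      ring
  have hqγ : α ∣ (q : QuadraticAlgebra ℤ (-n) e) ^ 11 * γ ^ 11 := by
    rw [← mul_pow, hlin]
    have h₁ := sub_dvd_pow_sub_pow
      (y * α + X * ((q * x - s * p * y : ℤ) : QuadraticAlgebra ℤ (-n) e))
      (X * ((q * x - s * p * y : ℤ) : QuadraticAlgebra ℤ (-n) e)) 11
    rw [add_sub_cancel_right] at h₁
    have h₂ := (dvd_mul_left α (y : QuadraticAlgebra ℤ (-n) e)).trans h₁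
    rw [mul_pow (X : QuadraticAlgebra ℤ (-n) e)] at h₂
    exact (dvd_sub_left (hαX.mul_right _)).mp h₂
  have hcopR : IsCoprime ((q : QuadraticAlgebra ℤ (-n) e) ^ 11)
      ((X : QuadraticAlgebra ℤ (-n) e) ^ 11) := by
    apply IsCoprime.pow
    exact ⟨t, s, by exact_mod_cast congrArg (Int.cast (R := QuadraticAlgebra ℤ (-n) e)) hts⟩
  obtain ⟨u, v, huv⟩ := hcopR
  have hdvd : α ∣ γ ^ 11 := by
    have : γ ^ 11 = u * (q ^ 11 * γ ^ 11) + X ^ 11 * (v * γ ^ 11) := by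
      linear_combination -γ ^ 11 * huv
    rw [this]
    exact dvd_add (hqγ.mul_left _) (hαX.mul_right _)
  obtain ⟨ε, hε⟩ := hdvd
  refine ⟨k, hpos, hle, γ, ε, hε, ?_⟩
  have h := congrArg QuadraticAlgebra.norm hε
  rw [map_pow, map_mul, hnγ] at h
  have hα' : norm α = X ^ 11 := by simpa only [norm_def] using hα
  rw [hα', mul_pow, mul_comm] at h
  exact (mul_left_cancel₀ (by positivity) h).symm

/-- The coefficient of `√(-n)` in `(a + b√(-n)) ^ 11`. -/
def imPowEleven {R : Type*} [CommRing R] (n a b : R) : R :=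
  b * (11 * a ^ 10 - 165 * n * a ^ 8 * b ^ 2 + 462 * n ^ 2 * a ^ 6 * b ^ 4
    - 330 * n ^ 3 * a ^ 4 * b ^ 6 + 55 * n ^ 4 * a ^ 2 * b ^ 8 - n ^ 5 * b ^ 10)

theorem im_pow_eleven {n : ℤ} (γ : QuadraticAlgebra ℤ (-n) 0) :
    (γ ^ 11).im = imPowEleven n γ.re γ.im := by
  simp [pow_succ, imPowEleven]
  ring

theorem dvd_of_imPowEleven_eq {n a b m : ℤ} (h : imPowEleven n a b = m) : b ∣ m :=
  ⟨_, h.symm⟩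

theorem imPowEleven_ne_of_zmod (q : ℕ) (n b m : ℤ)
    (h : ∀ z : ZMod q, imPowEleven (n : ZMod q) z b ≠ m) (a : ℤ) : imPowEleven n a b ≠ m := by
  intro hab
  apply h a
  rw [← hab]
  simp [imPowEleven]

theorem eleven_dvd_im_pow_eleven (γ : QuadraticAlgebra ℤ (-3) 1) : (11 : ℤ) ∣ (γ ^ 11).im := by
  refine ⟨γ.re ^ 10 * γ.im + 5 * γ.re ^ 9 * γ.im ^ 2 - 30 * γ.re ^ 8 * γ.im ^ 3
    - 150 * γ.re ^ 7 * γ.im ^ 4 + 42 * γ.re ^ 6 * γ.im ^ 5 + 672 * γ.re ^ 5 * γ.im ^ 6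
    + 390 * γ.re ^ 4 * γ.im ^ 7 - 525 * γ.re ^ 3 * γ.im ^ 8 - 370 * γ.re ^ 2 * γ.im ^ 9
    + 31 * γ.re * γ.im ^ 10 + 23 * γ.im ^ 11, ?_⟩
  simp [pow_succ]
  ring

/-- Primitive Gaussian integers whose norm is an eleventh power are eleventh powers. -/
theorem exists_pow_eleven_eq_gaussian (α : QuadraticAlgebra ℤ (-1) 0) {X : ℤ} (hX : 0 < X)
    (hα : norm α = X ^ 11) (hcop : IsCoprime α.im X) :
    ∃ γ : QuadraticAlgebra ℤ (-1) 0, γ ^ 11 = α := by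
  obtain ⟨k, hk, hk', γ, ε, hγ, hε⟩ := exists_pow_eleven_eq_mul (by norm_num) α hX hα hcop
  obtain rfl : k = 1 := by nlinarith
  have hε4 : ε ^ 4 = 1 := by
    obtain ⟨s, t⟩ := ε
    simp only [norm_def] at hε
    have hs : s ^ 2 ≤ 1 := by nlinarith [sq_nonneg t]
    have ht : t ^ 2 ≤ 1 := by nlinarith [sq_nonneg s]
    obtain ⟨hs₁, hs₂⟩ := abs_le.mp ((sq_le_one_iff_abs_le_one s).mp hs)
    obtain ⟨ht₁, ht₂⟩ := abs_le.mp ((sq_le_one_iff_abs_le_one t).mp ht)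
    interval_cases s <;> interval_cases t <;> first | omega | (ext <;> simp [pow_succ])
  exact ⟨γ * ε, by rw [mul_pow, hγ]; linear_combination α * (ε ^ 8 + ε ^ 4 + 1) * hε4⟩

/-- Primitive elements of `ℤ[√-3]` whose norm is an eleventh power are eleventh powers. -/
theorem exists_pow_eleven_eq_sqrt_neg_three (α : QuadraticAlgebra ℤ (-3) 0) {X : ℤ} (hX : 0 < X)
    (hα : norm α = X ^ 11) (hcop : IsCoprime α.im X) :
    ∃ γ : QuadraticAlgebra ℤ (-3) 0, γ ^ 11 = α := by
  obtain ⟨k, hk, hk', γ, ε, hγ, hε⟩ := exists_pow_eleven_eq_mul (by norm_num) α hX hα hcop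
  have hε2 : ε ^ 2 = 1 := by
    obtain ⟨s, t⟩ := ε
    simp only [norm_def] at hε
    have hk2 : k ≤ 2 := by nlinarith
    interval_cases k
    · have ht : t = 0 := by
        have : t ^ 2 < 1 := by nlinarith [sq_nonneg s]
        nlinarith
      subst ht
      ext
      · simp [pow_two]; linarith
      · simp [pow_two]
    · have h3 := congrArg (Int.cast : ℤ → ZMod 3) hε
      push_cast at h3
      exfalso
      generalize (s : ZMod 3) = s' at h3
      generalize (t : ZMod 3) = t' at h3
      revert s' t'
      decide
  exact ⟨γ * ε, by
    rw [mul_pow, hγ]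
    linear_combination α * (ε ^ 10 + ε ^ 8 + ε ^ 6 + ε ^ 4 + ε ^ 2 + 1) * hε2⟩

/-- Primitive elements of the maximal order of `ℚ(√-11)` whose norm is an eleventh power are
eleventh powers. -/
theorem exists_pow_eleven_eq_sqrt_neg_eleven (α : QuadraticAlgebra ℤ (-3) 1) {X : ℤ} (hX : 0 < X)
    (hα : norm α = X ^ 11) (hcop : IsCoprime α.im X) :
    ∃ γ : QuadraticAlgebra ℤ (-3) 1, γ ^ 11 = α := by
  obtain ⟨k, hk, hk', γ, ε, hγ, hε⟩ := exists_pow_eleven_eq_mul (by norm_num) α hX hα hcop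
  obtain rfl : k = 1 := by nlinarith
  have hε2 : ε ^ 2 = 1 := by
    obtain ⟨s, t⟩ := ε
    simp only [norm_def] at hε
    have ht : t = 0 := by
      have : t ^ 2 < 1 := by nlinarith [sq_nonneg (2 * s + t)]
      nlinarith
    subst ht
    ext
    · simp [pow_two]; linarith
    · simp [pow_two]
  exact ⟨γ * ε, by
    rw [mul_pow, hγ]
    linear_combination α * (ε ^ 10 + ε ^ 8 + ε ^ 6 + ε ^ 4 + ε ^ 2 + 1) * hε2⟩

/-- A solution of `Y ^ 2 + c = X ^ 11` has odd `X` when `c ≡ 1, 3 mod 8`. -/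
theorem odd_of_sq_add_eq_pow {X Y c : ℤ} (h : Y ^ 2 + c = X ^ 11) (hc : c % 8 = 1 ∨ c % 8 = 3) :
    X % 2 = 1 := by
  by_contra hX
  obtain ⟨Z, rfl⟩ : (2 : ℤ) ∣ X := by omega
  have h8 : (Y ^ 2 + c) % 8 = 0 := by
    rw [h]; apply Int.emod_eq_zero_of_dvd; exact ⟨256 * Z ^ 11, by ring⟩
  rcases hc with hc | hc <;>
  · have : Y % 8 = 0 ∨ Y % 8 = 1 ∨ Y % 8 = 2 ∨ Y % 8 = 3 ∨ Y % 8 = 4 ∨ Y % 8 = 5 ∨ Y % 8 = 6 ∨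
      Y % 8 = 7 := by omega
    rcases this with h' | h' | h' | h' | h' | h' | h' | h' <;>
      simp [pow_two, Int.add_emod, Int.mul_emod, h', hc] at h8

theorem pos_of_sq_add_eq_pow {X Y c : ℤ} (h : Y ^ 2 + c = X ^ 11) (hc : 0 < c) : 0 < X := by
  have : 0 < X ^ 11 := by nlinarith [sq_nonneg Y]
  exact (Odd.pow_pos_iff (by decide)).mp this

theorem isCoprime_three_of_not_dvd {X : ℤ} (h : ¬(3 : ℤ) ∣ X) : IsCoprime 3 X :=
  (Prime.coprime_iff_not_dvd Int.prime_three).mpr h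

theorem three_dvd_of_sq {Y : ℤ} (h : (3 : ℤ) ∣ Y ^ 2) : (3 : ℤ) ∣ Y :=
  Int.prime_three.dvd_of_dvd_pow h

theorem not_three_dvd_sq_add_one (y : ℤ) : ¬(3 : ℤ) ∣ y ^ 2 + 1 := by
  intro h
  have h0 := Int.emod_eq_zero_of_dvd h
  have : y % 3 = 0 ∨ y % 3 = 1 ∨ y % 3 = 2 := by omega
  rcases this with h' | h' | h' <;> simp [pow_two, Int.add_emod, Int.mul_emod, h'] at h0

theorem sq_add_nine_ne (X Y : ℤ) : Y ^ 2 + 9 ≠ X ^ 11 := by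
  intro h
  have h3 : ¬(3 : ℤ) ∣ X := by
    rintro ⟨x, rfl⟩
    obtain ⟨y, rfl⟩ := three_dvd_of_sq (Y := Y) ⟨3 ^ 10 * x ^ 11 - 3, by linear_combination h⟩
    exact not_three_dvd_sq_add_one y ⟨3 ^ 8 * x ^ 11, by linarith⟩
  obtain ⟨γ, hγ⟩ := exists_pow_eleven_eq_gaussian ⟨Y, 3⟩ (pos_of_sq_add_eq_pow h (by norm_num))
    (by rw [norm_def]; linear_combination h) (isCoprime_three_of_not_dvd h3)
  have him : imPowEleven 1 γ.re γ.im = 3 := by rw [← im_pow_eleven, hγ]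
  have hb : γ.im ∣ 3 := dvd_of_imPowEleven_eq him
  have hub := Int.le_of_dvd (by norm_num) hb
  have hlb := Int.le_of_dvd (by norm_num) ((neg_dvd).mpr hb)
  generalize γ.re = a at him
  generalize γ.im = b at him hb hub hlb
  revert him
  have : b = -3 ∨ b = -1 ∨ b = 1 ∨ b = 3 := by
    have : -3 ≤ b := by omega
    interval_cases b <;> revert hb <;> decide
  rcases this with rfl | rfl | rfl | rfl
  · exact imPowEleven_ne_of_zmod 7 1 (-3) 3 (by decide) a
  · exact imPowEleven_ne_of_zmod 3 1 (-1) 3 (by decide) a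
  · exact imPowEleven_ne_of_zmod 3 1 1 3 (by decide) a
  · exact imPowEleven_ne_of_zmod 4 1 3 3 (by decide) a

theorem sq_add_eighty_one_ne (X Y : ℤ) : Y ^ 2 + 81 ≠ X ^ 11 := by
  intro h
  have h3 : ¬(3 : ℤ) ∣ X := by
    rintro ⟨x, rfl⟩
    obtain ⟨y, rfl⟩ := three_dvd_of_sq (Y := Y) ⟨3 ^ 10 * x ^ 11 - 27, by linear_combination h⟩
    obtain ⟨z, rfl⟩ := three_dvd_of_sq (Y := y) ⟨3 ^ 8 * x ^ 11 - 3, by linarith⟩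
    exact not_three_dvd_sq_add_one z ⟨3 ^ 6 * x ^ 11, by linarith⟩
  obtain ⟨γ, hγ⟩ := exists_pow_eleven_eq_gaussian ⟨Y, 9⟩ (pos_of_sq_add_eq_pow h (by norm_num))
    (by rw [norm_def]; linear_combination h)
    (by simpa using (isCoprime_three_of_not_dvd h3).pow_left (m := 2))
  have him : imPowEleven 1 γ.re γ.im = 9 := by rw [← im_pow_eleven, hγ]
  have hb : γ.im ∣ 9 := dvd_of_imPowEleven_eq him
  have hub := Int.le_of_dvd (by norm_num) hb
  have hlb := Int.le_of_dvd (by norm_num) ((neg_dvd).mpr hb)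
  generalize γ.re = a at him
  generalize γ.im = b at him hb hub hlb
  revert him
  have : b = -9 ∨ b = -3 ∨ b = -1 ∨ b = 1 ∨ b = 3 ∨ b = 9 := by
    have : -9 ≤ b := by omega
    interval_cases b <;> revert hb <;> decide
  rcases this with rfl | rfl | rfl | rfl | rfl | rfl
  · exact imPowEleven_ne_of_zmod 7 1 (-9) 9 (by decide) a
  · exact imPowEleven_ne_of_zmod 4 1 (-3) 9 (by decide) a
  · exact imPowEleven_ne_of_zmod 3 1 (-1) 9 (by decide) a
  · exact imPowEleven_ne_of_zmod 3 1 1 9 (by decide) a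
  · exact imPowEleven_ne_of_zmod 11 1 3 9 (by decide) a
  · exact imPowEleven_ne_of_zmod 4 1 9 9 (by decide) a

theorem sq_add_twenty_seven_ne (X Y : ℤ) : Y ^ 2 + 27 ≠ X ^ 11 := by
  intro h
  have h3 : ¬(3 : ℤ) ∣ X := by
    rintro ⟨x, rfl⟩
    obtain ⟨y, rfl⟩ := three_dvd_of_sq (Y := Y) ⟨3 ^ 10 * x ^ 11 - 9, by linear_combination h⟩
    obtain ⟨z, rfl⟩ := three_dvd_of_sq (Y := y) ⟨3 ^ 8 * x ^ 11 - 1, by linarith⟩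
    have h9 : 3 * z ^ 2 + 1 = 3 * (3 ^ 7 * x ^ 11) := by linarith
    omega
  obtain ⟨γ, hγ⟩ := exists_pow_eleven_eq_sqrt_neg_three ⟨Y, 3⟩
    (pos_of_sq_add_eq_pow h (by norm_num))
    (by rw [norm_def]; linear_combination h) (isCoprime_three_of_not_dvd h3)
  have him : imPowEleven 3 γ.re γ.im = 3 := by rw [← im_pow_eleven, hγ]
  have hb : γ.im ∣ 3 := dvd_of_imPowEleven_eq him
  have hub := Int.le_of_dvd (by norm_num) hb
  have hlb := Int.le_of_dvd (by norm_num) ((neg_dvd).mpr hb)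
  generalize γ.re = a at him
  generalize γ.im = b at him hb hub hlb
  revert him
  have : b = -3 ∨ b = -1 ∨ b = 1 ∨ b = 3 := by
    have : -3 ≤ b := by omega
    interval_cases b <;> revert hb <;> decide
  rcases this with rfl | rfl | rfl | rfl
  · exact imPowEleven_ne_of_zmod 4 3 (-3) 3 (by decide) a
  · exact imPowEleven_ne_of_zmod 9 3 (-1) 3 (by decide) a
  · exact imPowEleven_ne_of_zmod 4 3 1 3 (by decide) a
  · exact imPowEleven_ne_of_zmod 5 3 3 3 (by decide) a

theorem eq_zero_of_sq_add_mul_sq_eq_four_pow (m : ℕ) :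
    ∀ s t : ℤ, s ^ 2 + 33 * t ^ 2 = 4 ^ m → t = 0 := by
  induction m with
  | zero => intro s t h; nlinarith [sq_nonneg s]
  | succ m ih =>
    intro s t h
    have h4 : (s ^ 2 + 33 * t ^ 2) % 4 = 0 := by omega
    have hs : s % 4 = 0 ∨ s % 4 = 1 ∨ s % 4 = 2 ∨ s % 4 = 3 := by omega
    have ht : t % 4 = 0 ∨ t % 4 = 1 ∨ t % 4 = 2 ∨ t % 4 = 3 := by omega
    have hst : (2 : ℤ) ∣ s ∧ (2 : ℤ) ∣ t := by
      rcases hs with hs | hs | hs | hs <;> rcases ht with ht | ht | ht | ht <;>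
        first
          | omega
          | simp [pow_two, Int.add_emod, Int.mul_emod, hs, ht] at h4
    obtain ⟨⟨s, rfl⟩, ⟨t, rfl⟩⟩ := hst
    have := ih s t (by linarith [pow_succ (4 : ℤ) m])
    omega

theorem sq_add_mul_sq_ne_of_zmod (q : ℕ) (k : ℤ)
    (h : ∀ s t : ZMod q, s ^ 2 + 33 * t ^ 2 ≠ (k : ZMod q) ^ 11) (s t : ℤ) :
    s ^ 2 + 33 * t ^ 2 ≠ k ^ 11 := fun hst =>
  h s t (by exact_mod_cast congrArg (Int.cast : ℤ → ZMod q) hst)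

theorem sq_add_thirty_three_ne (X Y : ℤ) : Y ^ 2 + 33 ≠ X ^ 11 := by
  intro h
  obtain ⟨k, hk, hk', γ, ε, hγ, hε⟩ := exists_pow_eleven_eq_mul (n := 33) (e := 0) (by norm_num)
    ⟨Y, 1⟩ (pos_of_sq_add_eq_pow h (by norm_num)) (by rw [norm_def]; linear_combination h)
    isCoprime_one_left
  have him := congrArg im hγ
  rw [im_pow_eleven, imPowEleven] at him
  obtain ⟨s, t⟩ := ε
  simp only [norm_def, im_mul] at hε him
  have hst : s ^ 2 + 33 * t ^ 2 = k ^ 11 := by linear_combination hε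
  obtain ⟨w, hw⟩ : (11 : ℤ) ∣ s + Y * t := by
    refine ⟨γ.im * (γ.re ^ 10 - 15 * 33 * γ.re ^ 8 * γ.im ^ 2 + 42 * 33 ^ 2 * γ.re ^ 6 * γ.im ^ 4
      - 30 * 33 ^ 3 * γ.re ^ 4 * γ.im ^ 6 + 5 * 33 ^ 4 * γ.re ^ 2 * γ.im ^ 8
      - 3 * 33 ^ 4 * γ.im ^ 10), ?_⟩
    linear_combination -him
  have hk6 : k ≤ 6 := by nlinarith
  have hk14 : k = 1 ∨ k = 4 := by
    interval_cases k
    · exact .inl rfl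
    · exact absurd hst (sq_add_mul_sq_ne_of_zmod 3 2 (by decide) s t)
    · exact absurd hst (sq_add_mul_sq_ne_of_zmod 4 3 (by decide) s t)
    · exact .inr rfl
    · exact absurd hst (sq_add_mul_sq_ne_of_zmod 3 5 (by decide) s t)
    · exact absurd hst (sq_add_mul_sq_ne_of_zmod 11 6 (by decide) s t)
  have ht : t = 0 := by
    rcases hk14 with rfl | rfl
    · exact eq_zero_of_sq_add_mul_sq_eq_four_pow 0 s t (by simpa using hst)
    · exact eq_zero_of_sq_add_mul_sq_eq_four_pow 11 s t hst
  obtain rfl : s = 11 * w := by rw [← hw, ht]; ring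
  subst ht
  rcases hk14 with rfl | rfl <;> ring_nf at hst <;> omega

/-- Reduction of the order of discriminant `-11` modulo a prime above `23`. -/
theorem pow_eleven_zmod_twenty_three (γ : QuadraticAlgebra ℤ (-3) 1) (u : ZMod 23)
    (hu : u * u = -3 + u) :
    ((γ ^ 11).re : ZMod 23) + (γ ^ 11).im * u = 0 ∨
      ((γ ^ 11).re : ZMod 23) + (γ ^ 11).im * u = 1 ∨
      ((γ ^ 11).re : ZMod 23) + (γ ^ 11).im * u = -1 := by
  have hpow : ∀ z : ZMod 23, z ^ 11 = 0 ∨ z ^ 11 = 1 ∨ z ^ 11 = -1 := by decide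
  let f := lift (R := ℤ) (a := -3) (b := 1) (⟨u, by simpa using hu⟩ : {u : ZMod 23 // _})
  have hf : ∀ z, f z = z.re + z.im * u := by intro z; simp [f]
  rw [← hf, map_pow]
  exact hpow _

/-- The solutions of `Y ^ 2 + 99 = X ^ 11` with `3 ∣ X` are obstructed at `23`. -/
theorem false_of_sq_add_eleven_eq {x y : ℤ} (h : y ^ 2 + 11 = 3 ^ 9 * x ^ 11)
    (hx : (3 * x) % 2 = 1) (hy : y % 3 = 1) : False := by
  have hX : (3 * y) ^ 2 + 99 = (3 * x) ^ 11 := by linear_combination 9 * h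
  have hyodd : (y - 5) % 2 = 1 := by
    by_contra hc
    obtain ⟨z, rfl⟩ : ∃ z, y = 2 * z + 1 := ⟨y / 2, by omega⟩
    obtain ⟨v, rfl⟩ : ∃ v, x = 2 * v + 1 := ⟨x / 2, by omega⟩
    ring_nf at h
    omega
  have h2 : IsCoprime (y - 5) 2 := ⟨1, -((y - 5) / 2), by omega⟩
  have h3 : IsCoprime (y - 5) 3 := ⟨-1, (y - 5) / 3 + 1, by omega⟩
  have h18 : IsCoprime (y - 5) (2 ^ 2 * 3 ^ 4) := h2.pow_right.mul_right h3.pow_right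
  have hcop : IsCoprime (y - 5) (3 * x) := by
    rw [← IsCoprime.pow_right_iff (m := 11) (by norm_num)]
    obtain ⟨u, v, huv⟩ := h18
    exact ⟨u - v * (9 * (y + 5)), v, by linear_combination huv - v * hX⟩
  obtain ⟨γ, hγ⟩ := exists_pow_eleven_eq_sqrt_neg_eleven ⟨-3 * y - 3, y - 5⟩
    (pos_of_sq_add_eq_pow hX (by norm_num)) (by rw [norm_def]; linear_combination hX) hcop
  have h₁ := pow_eleven_zmod_twenty_three γ 5 (by decide)
  have h₂ := pow_eleven_zmod_twenty_three γ (-4) (by decide)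
  rw [hγ] at h₁ h₂
  push_cast at h₁ h₂
  generalize (y : ZMod 23) = z at h₁ h₂
  revert z
  decide

theorem sq_add_ninety_nine_ne (X Y : ℤ) : Y ^ 2 + 99 ≠ X ^ 11 := by
  intro h
  have hodd := odd_of_sq_add_eq_pow h (.inr (by norm_num))
  by_cases h3 : (3 : ℤ) ∣ X
  · obtain ⟨x, rfl⟩ := h3
    obtain ⟨y, rfl⟩ := three_dvd_of_sq (Y := Y) ⟨3 ^ 10 * x ^ 11 - 33, by linear_combination h⟩
    have h' : y ^ 2 + 11 = 3 ^ 9 * x ^ 11 := by linarith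
    have hy : y % 3 = 0 ∨ y % 3 = 1 ∨ -y % 3 = 1 := by omega
    rcases hy with hy | hy | hy
    · obtain ⟨z, rfl⟩ := Int.dvd_of_emod_eq_zero hy
      ring_nf at h'
      omega
    · exact false_of_sq_add_eleven_eq h' hodd hy
    · exact false_of_sq_add_eleven_eq (by rw [neg_sq]; exact h') hodd hy
  · have h2 : IsCoprime 2 X := ⟨-(X / 2), 1, by omega⟩
    obtain ⟨γ, hγ⟩ := exists_pow_eleven_eq_sqrt_neg_eleven ⟨Y - 3, 6⟩
      (pos_of_sq_add_eq_pow h (by norm_num)) (by rw [norm_def]; linear_combination h)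
      (by simpa using h2.mul_left (isCoprime_three_of_not_dvd h3))
    have h11 := eleven_dvd_im_pow_eleven γ
    rw [hγ] at h11
    norm_num at h11

theorem no_integer_points_C6_minus (c : ℤ) (hc : c ∈ ({9, 27, 33, 81, 99} : Set ℤ)) :
    ¬∃ X Y : ℤ, Y ^ 2 = X ^ 11 - c := by
  rintro ⟨X, Y, h⟩
  have h' : Y ^ 2 + c = X ^ 11 := by rw [h]; ring
  rcases hc with rfl | rfl | rfl | rfl | rfl
  · exact sq_add_nine_ne X Y h'
  · exact sq_add_twenty_seven_ne X Y h'
  · exact sq_add_thirty_three_ne X Y h'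
  · exact sq_add_eighty_one_ne X Y h'
  · exact sq_add_ninety_nine_ne X Y h'
end

section
/- For each D ∈ {60, −60, 180, −180, −100, −132, −220}, the equation Y² = 5X^22 + D has no solution in integers X, Y. -/
/-- A solution of `w² + w n - n² = 1` with `0 ≤ n` and `0 < w` is a pair
`(F (2k - 1), F (2k))` of consecutive Fibonacci numbers. -/
theorem exists_fib_of_sq_add_mul_sub_sq_eq_one (n : ℕ) (w : ℤ) (hw : 0 < w)
    (h : w ^ 2 + w * n - n ^ 2 = 1) :
    ∃ k : ℕ, n = Nat.fib (2 * k) ∧ w + n = Nat.fib (2 * k + 1) := by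
  induction n using Nat.strong_induction_on generalizing w with
  | _ n ih =>
    rcases Nat.eq_zero_or_pos n with rfl | hn
    · refine ⟨0, by simp, ?_⟩
      push_cast at h
      have : w = 1 := by nlinarith
      simp [this]
    · have hn' : (0 : ℤ) < n := by exact_mod_cast hn
      have hwn : w ≤ n := by nlinarith
      have hnw : (n : ℤ) < 2 * w := by nlinarith
      obtain ⟨m, hm⟩ := Int.eq_ofNat_of_zero_le (sub_nonneg.2 hwn)
      obtain ⟨k, hk, hk'⟩ := ih m (by omega) (2 * w - n) (by omega)
        (by rw [← hm]; linear_combination h)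
      have hs : Nat.fib (2 * k + 2) = Nat.fib (2 * k) + Nat.fib (2 * k + 1) :=
        Nat.fib_add_two
      have hs' : Nat.fib (2 * k + 3) = Nat.fib (2 * k + 1) + Nat.fib (2 * k + 2) :=
        Nat.fib_add_two
      refine ⟨k + 1, ?_, ?_⟩
      · rw [show 2 * (k + 1) = 2 * k + 2 by ring]
        omega
      · rw [show 2 * (k + 1) + 1 = 2 * k + 3 by ring]
        omega

theorem fib_mod_thirtySix_periodic : Function.Periodic (fun n => Nat.fib n % 36) 24 := by
  intro n
  have h : Nat.fib (n + 24) = Nat.fib n * 28657 + Nat.fib (n + 1) * 46368 := Nat.fib_add n 23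
  simp only [h]
  omega

/-- If a Lucas number of even index, i.e. a solution `m` of `m² - 5 n² = 4`, is divisible by `9`,
then it is congruent to `2` modulo `4`. -/
theorem emod_four_eq_two_of_sq_sub_five_mul_sq_eq_four {m n : ℤ} (hm : 0 ≤ m) (hn : 0 ≤ n)
    (h : m ^ 2 - 5 * n ^ 2 = 4) (h9 : 9 ∣ m) : m % 4 = 2 := by
  obtain ⟨n, rfl⟩ := Int.eq_ofNat_of_zero_le hn
  have hpar : Even (m - n) := by
    have : Even (m ^ 2 - 5 * (n : ℤ) ^ 2) := by rw [h]; decide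
    simpa [parity_simps, show ¬ Even (5 : ℤ) by decide] using this
  obtain ⟨w, hw⟩ := hpar
  obtain rfl : m = n + 2 * w := by linarith
  obtain ⟨k, hk, hk'⟩ := exists_fib_of_sq_add_mul_sub_sq_eq_one n w (by nlinarith) (by linarith)
  have h₀ : Nat.fib (2 * k % 24) % 36 = Nat.fib (2 * k) % 36 :=
    fib_mod_thirtySix_periodic.map_mod_nat (2 * k)
  have h₁ : Nat.fib ((2 * k + 1) % 24) % 36 = Nat.fib (2 * k + 1) % 36 :=
    fib_mod_thirtySix_periodic.map_mod_nat (2 * k + 1)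
  rw [show 2 * k % 24 = 2 * (k % 12) by omega] at h₀
  rw [show (2 * k + 1) % 24 = 2 * (k % 12) + 1 by omega] at h₁
  have hlt : k % 12 < 12 := Nat.mod_lt _ (by norm_num)
  generalize k % 12 = r at h₀ h₁ hlt
  interval_cases r <;> norm_num [Nat.fib_add_two] at h₀ h₁ <;> omega

theorem sq_ne_five_mul_pow_sub_one_hundred_eighty (X Y : ℤ) : Y ^ 2 ≠ 5 * X ^ 22 - 180 := by
  intro h
  obtain ⟨y, rfl⟩ : (5 : ℤ) ∣ Y :=
    (Nat.prime_iff_prime_int.1 Nat.prime_five).dvd_of_dvd_pow (n := 2) ⟨X ^ 22 - 36, by rw [h]; ring⟩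
  have h₁ : X ^ 22 - 5 * y ^ 2 = 36 := by linarith
  have hmod : (X : ZMod 3) = 0 ∧ (y : ZMod 3) = 0 := by
    have key : ∀ a b : ZMod 3, a ^ 22 - 5 * b ^ 2 = 36 → a = 0 ∧ b = 0 := by decide
    exact key _ _ (by exact_mod_cast congrArg (Int.cast : ℤ → ZMod 3) h₁)
  obtain ⟨x, rfl⟩ := (ZMod.intCast_zmod_eq_zero_iff_dvd X 3).1 hmod.1
  obtain ⟨z, rfl⟩ := (ZMod.intCast_zmod_eq_zero_iff_dvd y 3).1 hmod.2
  have h₂ : |3 ^ 10 * x ^ 11| ^ 2 - 5 * |z| ^ 2 = 4 := by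
    rw [sq_abs, sq_abs]
    push_cast at h₁
    linarith
  have h₃ := emod_four_eq_two_of_sq_sub_five_mul_sq_eq_four (abs_nonneg _) (abs_nonneg _) h₂
    ((dvd_abs _ _).2 ⟨3 ^ 8 * x ^ 11, by ring⟩)
  have h₄ : (3 ^ 10 * x ^ 11) % 4 = 2 := by
    rcases abs_choice (3 ^ 10 * x ^ 11) with ha | ha <;> rw [ha] at h₃ <;> omega
  have key : ∀ a : ZMod 4, 3 ^ 10 * a ^ 11 ≠ 2 := by decide
  refine key x ?_
  have := (ZMod.intCast_eq_intCast_iff (3 ^ 10 * x ^ 11) 2 4).2 h₄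
  exact_mod_cast this

theorem sq_ne_five_mul_pow_add_of_zmod (m : ℕ) (D : ℤ)
    (key : ∀ a b : ZMod m, b ^ 2 ≠ 5 * a ^ 22 + D) (X Y : ℤ) : Y ^ 2 ≠ 5 * X ^ 22 + D :=
  fun h => key X Y (by exact_mod_cast congrArg (Int.cast : ℤ → ZMod m) h)

theorem no_integer_points_H6 (D : ℤ)
    (hD : D ∈ ({60, -60, 180, -180, -100, -132, -220} : Set ℤ)) :
    ¬∃ X Y : ℤ, Y ^ 2 = 5 * X ^ 22 + D := by
  rintro ⟨X, Y, h⟩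
  simp only [Set.mem_insert_iff, Set.mem_singleton_iff] at hD
  rcases hD with rfl | rfl | rfl | rfl | rfl | rfl | rfl
  · exact sq_ne_five_mul_pow_add_of_zmod 9 _ (by decide) X Y h
  · exact sq_ne_five_mul_pow_add_of_zmod 9 _ (by decide) X Y h
  · exact sq_ne_five_mul_pow_add_of_zmod 27 _ (by decide +kernel) X Y h
  · exact sq_ne_five_mul_pow_sub_one_hundred_eighty X Y h
  · exact sq_ne_five_mul_pow_add_of_zmod 23 _ (by decide +kernel) X Y h
  · exact sq_ne_five_mul_pow_add_of_zmod 5 _ (by decide) X Y h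
  · exact sq_ne_five_mul_pow_add_of_zmod 23 _ (by decide +kernel) X Y h
end
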